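/- arXiv:2504.16486 — 3 statements merged into one kernel-verified Lean document; each statement's English description precedes it below -/
import Mathlib

section
/- Let w : [0, π] × ℝ → ℝ be a continuous function such that w(0, y) = w(π, y) = 0 for all y ∈ ℝ, such that 0 < sup w ≤ 1, and such that w is C² on the open set U := {(x, y) : 0 < x < π and w(x, y) > 0} with ∂²_x w + ∂²_y w + w ≥ 0 on U. Then there exists a constant a > 0 such that w(x, y) = a·sin(x) for all (x, y) ∈ [0, π] × ℝ. -/
open Real Set Filter

/-- Partial derivative in the first variable of a function on the plane. -/
noncomputable def pdx (f : ℝ × ℝ → ℝ) (p : ℝ × ℝ) : ℝ := fderiv ℝ f p (1, 0)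

/-- Partial derivative in the second variable of a function on the plane. -/
noncomputable def pdy (f : ℝ × ℝ → ℝ) (p : ℝ × ℝ) : ℝ := fderiv ℝ f p (0, 1)

open Topology in
lemma second_test {f : ℝ → ℝ} {t : ℝ} (hf : IsLocalMax f t) (hc : ContinuousAt f t) :
    deriv (deriv f) t ≤ 0 := by
  by_contra! h
  have h1 : deriv f t = 0 := hf.deriv_eq_zero
  have h2 := isLocalMin_of_deriv_deriv_pos h h1 hc
  have h3 : f =ᶠ[𝓝 t] fun _ => f t := by
    filter_upwards [hf, h2] with s hs hs'
    exact le_antisymm hs hs'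
  have h4 : deriv f =ᶠ[𝓝 t] fun _ => 0 := by
    simpa using h3.deriv
  have h5 := h4.deriv_eq
  simp at h5
  linarith

lemma cd_diff {F : ℝ × ℝ → ℝ} {p : ℝ × ℝ} (v : ℝ × ℝ) (hF : ContDiffAt ℝ 2 F p) :
    DifferentiableAt ℝ (fun q => fderiv ℝ F q v) p := by
  have : ContDiffAt ℝ 1 (fderiv ℝ F) p := hF.fderiv_right (by norm_num)
  exact (this.differentiableAt (by norm_num)).clm_apply (differentiableAt_const v)

open Topology in
lemma cd_ev {F : ℝ × ℝ → ℝ} {p : ℝ × ℝ} (hF : ContDiffAt ℝ 2 F p) :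
    ∀ᶠ q in 𝓝 p, DifferentiableAt ℝ F q := by
  filter_upwards [hF.eventually (by simp)] with q hq
  exact hq.differentiableAt (by norm_num)

open Topology in
lemma second_dir {F : ℝ × ℝ → ℝ} {p : ℝ × ℝ} (v : ℝ × ℝ) (hF : ContDiffAt ℝ 2 F p)
    (hm : IsLocalMax F p) : fderiv ℝ (fun q => fderiv ℝ F q v) p v ≤ 0 := by
  have hl : ∀ t : ℝ, HasDerivAt (fun t : ℝ => p + t • v) v t := by
    intro t
    simpa using ((hasDerivAt_id t).smul_const v).const_add p
  have hl0 : Tendsto (fun t : ℝ => p + t • v) (𝓝 0) (𝓝 p) := by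
    have := (hl 0).continuousAt.tendsto
    simpa using this
  have h1 : ∀ᶠ t in 𝓝 (0:ℝ), deriv (fun t : ℝ => F (p + t • v)) t
      = fderiv ℝ F (p + t • v) v := by
    filter_upwards [hl0.eventually (cd_ev hF)] with t ht
    exact (ht.hasFDerivAt.comp_hasDerivAt t (hl t)).deriv
  have h2 : deriv (deriv (fun t : ℝ => F (p + t • v))) 0
      = fderiv ℝ (fun q => fderiv ℝ F q v) p v := by
    rw [EventuallyEq.deriv_eq h1]
    have h3 := cd_diff v hF
    have h4 : DifferentiableAt ℝ (fun q => fderiv ℝ F q v) (p + (0:ℝ) • v) := by simpa using h3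
    have := (h4.hasFDerivAt.comp_hasDerivAt 0 (hl 0)).deriv
    simpa [Function.comp_def] using this
  rw [← h2]
  apply second_test
  · have := hl0.eventually hm
    filter_upwards [this] with t ht
    simpa using ht
  · have h4 : ContinuousAt F (p + (0:ℝ) • v) := by simpa using hF.continuousAt
    exact ContinuousAt.comp (f := fun t : ℝ => p + t • v) h4 (hl 0).continuousAt

open Topology in
lemma second_lin {w H P : ℝ × ℝ → ℝ} {p : ℝ × ℝ} (m : ℝ) (v : ℝ × ℝ) (hw : ContDiffAt ℝ 2 w p)
    (hH : ContDiffAt ℝ 2 H p) (hP : ContDiffAt ℝ 2 P p) :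
    fderiv ℝ (fun q => fderiv ℝ (fun z => w z - H z - m * P z) q v) p v
    = fderiv ℝ (fun q => fderiv ℝ w q v) p v - fderiv ℝ (fun q => fderiv ℝ H q v) p v
      - m * fderiv ℝ (fun q => fderiv ℝ P q v) p v := by
  have h1 : (fun q => fderiv ℝ (fun z => w z - H z - m * P z) q v) =ᶠ[𝓝 p]
      fun q => fderiv ℝ w q v - fderiv ℝ H q v - m * fderiv ℝ P q v := by
    filter_upwards [cd_ev hw, cd_ev hH, cd_ev hP] with q h1 h2 h3
    have := ((h1.hasFDerivAt.sub h2.hasFDerivAt).sub (h3.hasFDerivAt.const_mul m)).fderiv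
    have h4 := congrArg (fun L => L v) this
    exact h4.trans (by simp)
  rw [h1.fderiv_eq]
  have := (((cd_diff v hw).hasFDerivAt.sub (cd_diff v hH).hasFDerivAt).sub
    ((cd_diff v hP).hasFDerivAt.const_mul m)).fderiv
  have h4 := congrArg (fun L => L v) this
  exact h4.trans (by simp)

lemma pdx_of {f : ℝ × ℝ → ℝ} (hf : Differentiable ℝ f) {x y d : ℝ}
    (h : HasDerivAt (fun t => f (t, y)) d x) : pdx f (x, y) = d := by
  have h1 : HasDerivAt (fun t : ℝ => (t, y)) ((1 : ℝ), (0 : ℝ)) x :=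
    (hasDerivAt_id x).prodMk (hasDerivAt_const x y)
  exact ((hf (x, y)).hasFDerivAt.comp_hasDerivAt x h1).unique h

lemma pdy_of {f : ℝ × ℝ → ℝ} (hf : Differentiable ℝ f) {x y d : ℝ}
    (h : HasDerivAt (fun t => f (x, t)) d y) : pdy f (x, y) = d := by
  have h1 : HasDerivAt (fun t : ℝ => (x, t)) ((0 : ℝ), (1 : ℝ)) y :=
    (hasDerivAt_const y x).prodMk (hasDerivAt_id y)
  exact ((hf (x, y)).hasFDerivAt.comp_hasDerivAt y h1).unique h

lemma lap_of {f fx fy : ℝ × ℝ → ℝ} {x y dx dy : ℝ} (hf : ContDiff ℝ 2 f)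
    (hfx : ∀ x y, HasDerivAt (fun t => f (t, y)) (fx (x, y)) x)
    (hfy : ∀ x y, HasDerivAt (fun t => f (x, t)) (fy (x, y)) y)
    (hfxx : HasDerivAt (fun t => fx (t, y)) dx x)
    (hfyy : HasDerivAt (fun t => fy (x, t)) dy y) :
    pdx (pdx f) (x, y) + pdy (pdy f) (x, y) = dx + dy := by
  have hd : Differentiable ℝ f := hf.differentiable (by norm_num)
  have e1 : pdx f = fx := by
    ext ⟨a, b⟩; exact pdx_of hd (hfx a b)
  have e2 : pdy f = fy := by
    ext ⟨a, b⟩; exact pdy_of hd (hfy a b)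
  have d1 : Differentiable ℝ (pdx f) := fun q => cd_diff (1, 0) hf.contDiffAt
  have d2 : Differentiable ℝ (pdy f) := fun q => cd_diff (0, 1) hf.contDiffAt
  rw [pdx_of d1 (d := dx) (by rw [e1]; exact hfxx), pdy_of d2 (d := dy) (by rw [e2]; exact hfyy)]

/-- hypotheses bundled -/
structure Hyp (w : ℝ × ℝ → ℝ) : Prop where
  hcont : ContinuousOn w {p : ℝ × ℝ | p.1 ∈ Set.Icc 0 π}
  hside0 : ∀ y : ℝ, w (0, y) = 0
  hsideπ : ∀ y : ℝ, w (π, y) = 0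
  hle : ∀ p : ℝ × ℝ, p.1 ∈ Set.Icc 0 π → w p ≤ 1
  hsmooth : ContDiffOn ℝ 2 w {p : ℝ × ℝ | p.1 ∈ Set.Ioo 0 π ∧ 0 < w p}
  hsub : ∀ p ∈ {p : ℝ × ℝ | p.1 ∈ Set.Ioo 0 π ∧ 0 < w p},
      0 ≤ pdx (pdx w) p + pdy (pdy w) p + w p

open Topology in
lemma Hyp.cda {w : ℝ × ℝ → ℝ} (h : Hyp w) {p : ℝ × ℝ} (hp : p.1 ∈ Set.Ioo 0 π) (hw : 0 < w p) :
    ContDiffAt ℝ 2 w p := by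
  apply h.hsmooth.contDiffAt
  have h1 : {p : ℝ × ℝ | p.1 ∈ Set.Ioo 0 π} ∈ 𝓝 p :=
    (isOpen_Ioo.preimage continuous_fst).mem_nhds hp
  have h2 : ContinuousAt w p := h.hcont.continuousAt
    (mem_of_superset h1 fun q hq => Ioo_subset_Icc_self hq)
  filter_upwards [h1, h2.eventually (lt_mem_nhds hw)] with q a b
  exact ⟨a, b⟩

open Topology in
lemma comparison {w : ℝ × ℝ → ℝ} (h : Hyp w) {H : ℝ × ℝ → ℝ} (hH : ContDiff ℝ 2 H)
    {a b c d : ℝ} (ha : 0 ≤ a) (hb : b ≤ π)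
    (hd : ∀ x y, x ∈ Icc a b → y ∈ Icc c d → w (x, y) ≤ H (x, y) ∨
      (x ∈ Ioo a b ∧ y ∈ Ioo c d ∧ 0 ≤ H (x, y) ∧
        pdx (pdx H) (x, y) + pdy (pdy H) (x, y) + H (x, y) < 0))
    (x y : ℝ) (hx : x ∈ Icc a b) (hy : y ∈ Icc c d) : w (x, y) ≤ H (x, y) := by
  have hcd : c ≤ d := hy.1.trans hy.2
  set γ : ℝ := 1 / (d - c + 2) with hγ
  have hγ0 : 0 < γ := by positivity
  have hγ1 : γ * (d - c) < 1 := by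
    rw [hγ, one_div, inv_mul_lt_iff₀ (by linarith)]; linarith
  have hγ2 : γ < 1 := by
    rw [hγ, div_lt_one (by linarith)]; linarith
  set β : ℝ := √(1 - γ ^ 2) with hβ
  have hβ2 : β ^ 2 = 1 - γ ^ 2 := Real.sq_sqrt (by nlinarith)
  have hβ0 : 0 ≤ β := Real.sqrt_nonneg _
  have hβ1 : β < 1 := by nlinarith
  have hpi := Real.pi_gt_three
  set P : ℝ × ℝ → ℝ := fun p => Real.cos (β * (p.1 - π / 2)) * Real.cos (γ * (p.2 - c)) with hP
  have hPc : ContDiff ℝ 2 P := by rw [hP]; fun_prop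
  have hPlap : ∀ x y, pdx (pdx P) (x, y) + pdy (pdy P) (x, y) + P (x, y) = 0 := by
    intro x y
    have gx : ∀ x : ℝ, HasDerivAt (fun t : ℝ => β * (t - π / 2)) β x := fun x => by
      simpa using ((hasDerivAt_id x).sub_const (π / 2)).const_mul β
    have gy : ∀ x : ℝ, HasDerivAt (fun t : ℝ => γ * (t - c)) γ x := fun x => by
      simpa using ((hasDerivAt_id x).sub_const c).const_mul γ
    rw [lap_of (fx := fun p => (Real.sin (β * (p.1 - π / 2)) * (-β)) * Real.cos (γ * (p.2 - c)))
      (fy := fun p => Real.cos (β * (p.1 - π / 2)) * (Real.sin (γ * (p.2 - c)) * (-γ))) hPc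
      (fun x y => ((gx x).cos.mul_const (Real.cos (γ * (y - c)))).congr_deriv (by ring)) (fun x y => ((gy y).cos.const_mul (Real.cos (β * (x - π / 2)))).congr_deriv (by ring))
      (((gx x).sin.mul_const (-β)).mul_const (Real.cos (γ * (y - c))))
      (((gy y).sin.mul_const (-γ)).const_mul (Real.cos (β * (x - π / 2))))]
    simp only [hP]
    linear_combination (-Real.cos (β * (x - π / 2)) * Real.cos (γ * (y - c))) * hβ2
  have hPpos : ∀ x y, x ∈ Icc a b → y ∈ Icc c d → 0 < P (x, y) := by
    intro x y hx hy
    have h1 : 0 ≤ x := ha.trans hx.1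
    have h2 : x ≤ π := hx.2.trans hb
    apply mul_pos
    · apply Real.cos_pos_of_mem_Ioo
      constructor <;> simp only <;> nlinarith
    · apply Real.cos_pos_of_mem_Ioo
      have := hy.1
      have := hy.2
      constructor <;> simp only <;> nlinarith
  set K : Set (ℝ × ℝ) := Icc a b ×ˢ Icc c d with hK
  have hKc : IsCompact K := isCompact_Icc.prod isCompact_Icc
  have hKs : K ⊆ {p : ℝ × ℝ | p.1 ∈ Set.Icc 0 π} := fun p hp =>
    ⟨ha.trans hp.1.1, hp.1.2.trans hb⟩
  have hQ : ContinuousOn (fun p => (w p - H p) / P p) K :=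
    ((h.hcont.mono hKs).sub hH.continuous.continuousOn).div hPc.continuous.continuousOn
      (fun p hp => (hPpos p.1 p.2 hp.1 hp.2).ne')
  obtain ⟨⟨x0, y0⟩, hpK, hmax⟩ := hKc.exists_isMaxOn ⟨(x, y), hx, hy⟩ hQ
  by_contra! hcon
  set m := (w (x0, y0) - H (x0, y0)) / P (x0, y0) with hm
  have hP0 := hPpos x0 y0 hpK.1 hpK.2
  have hmpos : 0 < m := by
    have h1 := hmax (show (x, y) ∈ K from ⟨hx, hy⟩)
    have h2 : 0 < (w (x, y) - H (x, y)) / P (x, y) := div_pos (by linarith) (hPpos x y hx hy)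
    exact h2.trans_le h1
  have hmeq : w (x0, y0) - H (x0, y0) = m * P (x0, y0) := by
    rw [hm]; field_simp
  have hgt : H (x0, y0) < w (x0, y0) := by
    have := mul_pos hmpos hP0
    linarith
  rcases hd x0 y0 hpK.1 hpK.2 with h1 | ⟨hx0, hy0, hH0, hlap⟩
  · linarith
  have hst : x0 ∈ Ioo 0 π := ⟨ha.trans_lt hx0.1, hx0.2.trans_le hb⟩
  have hwp : 0 < w (x0, y0) := by linarith
  have hwc := h.cda (p := (x0, y0)) hst hwp
  have hloc : IsLocalMax (fun z => w z - H z - m * P z) (x0, y0) := by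
    have : K ∈ 𝓝 (x0, y0) := prod_mem_nhds (Icc_mem_nhds hx0.1 hx0.2) (Icc_mem_nhds hy0.1 hy0.2)
    filter_upwards [this] with q hq
    have h1 : (w q - H q) / P q ≤ m := hmax hq
    rw [div_le_iff₀ (hPpos q.1 q.2 hq.1 hq.2)] at h1
    linarith
  have hFc : ContDiffAt ℝ 2 (fun z => w z - H z - m * P z) (x0, y0) :=
    (hwc.sub hH.contDiffAt).sub (contDiffAt_const.mul hPc.contDiffAt)
  have s1 := second_dir (1, 0) hFc hloc
  have s2 := second_dir (0, 1) hFc hloc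
  rw [second_lin m _ hwc hH.contDiffAt hPc.contDiffAt] at s1 s2
  have hs := h.hsub (x0, y0) ⟨hst, hwp⟩
  have hp := hPlap x0 y0
  have hp' := congrArg (fun t => m * t) hp
  simp only [mul_add, mul_zero] at hp'
  change pdx (pdx w) (x0, y0) - pdx (pdx H) (x0, y0) - m * pdx (pdx P) (x0, y0) ≤ 0 at s1
  change pdy (pdy w) (x0, y0) - pdy (pdy H) (x0, y0) - m * pdy (pdy P) (x0, y0) ≤ 0 at s2
  linarith

lemma bar1 {w : ℝ × ℝ → ℝ} (h : Hyp w) (x y : ℝ) (hx : x ∈ Icc 0 (1/2)) :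
    w (x, y) ≤ 4 * x := by
  have hpi := Real.pi_gt_three
  have hc := comparison h (H := fun p => 4 * (p.1 - p.1 ^ 2) + (p.2 - y) ^ 2) (by fun_prop)
    (a := 0) (b := 1/2) (c := y - 1) (d := y + 1) le_rfl (by linarith) ?_ x y hx
    ⟨by linarith, by linarith⟩
  · simp only at hc
    nlinarith [sq_nonneg x]
  intro s t hs ht
  have hw1 := h.hle (s, t) ⟨hs.1, by linarith [hs.2]⟩
  have hs0 := hs.1
  have hs1 := hs.2
  have ht0 := ht.1
  have ht1 := ht.2
  have hq : 0 ≤ s - s ^ 2 := by nlinarith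
  simp only
  rcases eq_or_lt_of_le hs0 with e | l1
  · left
    rw [← e, h.hside0]; nlinarith [sq_nonneg (t - y)]
  rcases eq_or_lt_of_le hs1 with e | l2
  · left
    subst e; nlinarith [sq_nonneg (t - y)]
  rcases eq_or_lt_of_le ht0 with e | l3
  · left
    have : t - y = -1 := by linarith
    rw [this]; nlinarith
  rcases eq_or_lt_of_le ht1 with e | l4
  · left
    have : t - y = 1 := by linarith
    rw [this]; nlinarith
  right
  refine ⟨⟨l1, l2⟩, ⟨l3, l4⟩, by nlinarith [sq_nonneg (t - y)], ?_⟩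
  rw [lap_of (fx := fun p => 4 * (1 - 2 * p.1)) (fy := fun p => 2 * (p.2 - y)) (by fun_prop)
    (fun x z => (((((hasDerivAt_id x).sub ((hasDerivAt_id x).pow 2)).const_mul 4).add_const
      ((z - y) ^ 2)).congr_deriv (by simp)))
    (fun x z => (((((hasDerivAt_id z).sub_const y).pow 2).const_add
      (4 * (x - x ^ 2))).congr_deriv (by simp)))
    ((((hasDerivAt_id s).const_mul 2).const_sub 1).const_mul 4)
    (((hasDerivAt_id t).sub_const y).const_mul 2)]
  nlinarith [sq_nonneg s]

lemma bar2 {w : ℝ × ℝ → ℝ} (h : Hyp w) (x y : ℝ) (hx : x ∈ Icc (π - 1/2) π) :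
    w (x, y) ≤ 4 * (π - x) := by
  have hpi := Real.pi_gt_three
  have hc := comparison h (H := fun p => 4 * ((π - p.1) - (π - p.1) ^ 2) + (p.2 - y) ^ 2)
    (by fun_prop)
    (a := π - 1/2) (b := π) (c := y - 1) (d := y + 1) (by linarith) le_rfl ?_ x y hx
    ⟨by linarith, by linarith⟩
  · simp only at hc
    nlinarith [sq_nonneg (π - x)]
  intro s t hs ht
  have hw1 := h.hle (s, t) ⟨by linarith [hs.1], hs.2⟩
  have hs0 := hs.1
  have hs1 := hs.2
  have ht0 := ht.1
  have ht1 := ht.2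
  have hq : 0 ≤ (π - s) - (π - s) ^ 2 := by nlinarith
  simp only
  rcases eq_or_lt_of_le hs0 with e | l1
  · left
    have : π - s = 1 / 2 := by linarith
    rw [this]; nlinarith [sq_nonneg (t - y)]
  rcases eq_or_lt_of_le hs1 with e | l2
  · left
    rw [e, h.hsideπ]; nlinarith [sq_nonneg (t - y)]
  rcases eq_or_lt_of_le ht0 with e | l3
  · left
    have : t - y = -1 := by linarith
    rw [this]; nlinarith
  rcases eq_or_lt_of_le ht1 with e | l4
  · left
    have : t - y = 1 := by linarith
    rw [this]; nlinarith
  right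
  refine ⟨⟨l1, l2⟩, ⟨l3, l4⟩, by nlinarith [sq_nonneg (t - y)], ?_⟩
  rw [lap_of (fx := fun p => 4 * (2 * (π - p.1) - 1)) (fy := fun p => 2 * (p.2 - y)) (by fun_prop)
    (fun x z => ((((((hasDerivAt_id x).const_sub π)).sub
      (((hasDerivAt_id x).const_sub π).pow 2)).const_mul 4).add_const
      ((z - y) ^ 2)).congr_deriv (by simp; ring))
    (fun x z => (((((hasDerivAt_id z).sub_const y).pow 2).const_add
      (4 * ((π - x) - (π - x) ^ 2))).congr_deriv (by simp)))
    (((((hasDerivAt_id s).const_sub π).const_mul 2).sub_const 1).const_mul 4)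
    (((hasDerivAt_id t).sub_const y).const_mul 2)]
  nlinarith [sq_nonneg (π - s)]

lemma bdd {w : ℝ × ℝ → ℝ} (h : Hyp w) (x y : ℝ) (hx : x ∈ Icc 0 π) :
    w (x, y) ≤ 8 * Real.sin x := by
  have hpi := Real.pi_gt_three
  have hpi4 := Real.pi_lt_four
  have key : ∀ t : ℝ, 0 ≤ t → t ≤ π / 2 → t ≤ 2 * Real.sin t := by
    intro t h0 h1
    have h2 := Real.mul_le_sin h0 h1
    have h3 : 1 / 2 * t ≤ 2 / π * t := by
      gcongr ?_ * t
      rw [div_le_div_iff₀] <;> linarith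
    linarith
  obtain ⟨h0, h1⟩ := hx
  have hw := h.hle (x, y) ⟨h0, h1⟩
  rcases le_total x (π / 2) with hh | hh
  · have k := key x h0 hh
    rcases le_total x (1/2) with h2 | h2
    · have := bar1 h x y ⟨h0, h2⟩
      linarith
    · linarith
  · have k := key (π - x) (by linarith) (by linarith)
    rw [Real.sin_pi_sub] at k
    rcases le_total (π - x) (1/2) with h2 | h2
    · have := bar2 h x y ⟨by linarith, h1⟩
      linarith
    · linarith

lemma tangent (x x0 : ℝ) (hx : x ∈ Ioo 0 π) (hx0 : x0 ∈ Ioo 0 π) :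
    Real.cos x * (x - x0) ≤ Real.sin x := by
  obtain ⟨h0, h1⟩ := hx
  obtain ⟨h2, h3⟩ := hx0
  have key : ∀ t : ℝ, 0 < t → t < π / 2 → Real.cos t * t ≤ Real.sin t := by
    intro t a b
    have hc : 0 < Real.cos t := Real.cos_pos_of_mem_Ioo ⟨by linarith, b⟩
    have := Real.lt_tan a b
    rw [Real.tan_eq_sin_div_cos, lt_div_iff₀ hc] at this
    linarith
  have hs := Real.sin_pos_of_pos_of_lt_pi h0 h1
  rcases lt_trichotomy x (π / 2) with hh | hh | hh
  · have := key x h0 hh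
    have hc : 0 < Real.cos x := Real.cos_pos_of_mem_Ioo ⟨by linarith, hh⟩
    nlinarith
  · rw [hh]; simp
  · have := key (π - x) (by linarith) (by linarith)
    rw [Real.sin_pi_sub, Real.cos_pi_sub] at this
    have hc : Real.cos x < 0 := Real.cos_neg_of_pi_div_two_lt_of_lt hh (by linarith)
    nlinarith

open Topology in
lemma step1 {w : ℝ × ℝ → ℝ} (h : Hyp w) {a x0 y0 : ℝ} (ha : 0 < a)
    (hwa : ∀ x y, x ∈ Icc 0 π → w (x, y) ≤ a * Real.sin x) (hx0 : x0 ∈ Ioo 0 π)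
    (hlt : w (x0, y0) < a * Real.sin x0) :
    ∃ δ, 0 < δ ∧ δ ≤ a ∧ ∀ x ∈ Icc 0 π, w (x, y0) ≤ (a - δ) * Real.sin x := by
  have hpi := Real.pi_gt_three
  have hpi4 := Real.pi_lt_four
  have hs0 := Real.sin_pos_of_pos_of_lt_pi hx0.1 hx0.2
  obtain ⟨c, hc0, hca, hc⟩ : ∃ c, 0 < c ∧ c ≤ a ∧ w (x0, y0) < (a - c) * Real.sin x0 := by
    have h1 : 0 < (a * Real.sin x0 - w (x0, y0)) / 2 / Real.sin x0 := by
      apply div_pos _ hs0; linarith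
    refine ⟨min a ((a * Real.sin x0 - w (x0, y0)) / 2 / Real.sin x0), lt_min ha h1,
      min_le_left _ _, ?_⟩
    have h2 := min_le_right a ((a * Real.sin x0 - w (x0, y0)) / 2 / Real.sin x0)
    rw [le_div_iff₀ hs0] at h2
    linarith
  obtain ⟨r, hr0, hr⟩ : ∃ r > 0, ∀ x y, (x - x0) ^ 2 + (y - y0) ^ 2 < r ^ 2 →
      w (x, y) ≤ (a - c) * Real.sin x := by
    have h1 : {p : ℝ × ℝ | p.1 ∈ Set.Ioo 0 π} ∈ 𝓝 (x0, y0) :=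
      (isOpen_Ioo.preimage continuous_fst).mem_nhds hx0
    have h2 : ContinuousAt w (x0, y0) := h.hcont.continuousAt
      (mem_of_superset h1 fun q hq => Ioo_subset_Icc_self hq)
    have h3 : ContinuousAt (fun p : ℝ × ℝ => (a - c) * Real.sin p.1) (x0, y0) := by fun_prop
    have h4 := h2.eventually_lt h3 hc
    obtain ⟨r, hr, hb⟩ := Metric.eventually_nhds_iff.1 h4
    refine ⟨r, hr, fun x y hxy => (hb (y := (x, y)) ?_).le⟩
    rw [Prod.dist_eq, max_lt_iff, Real.dist_eq, Real.dist_eq]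
    constructor <;> apply abs_lt_of_sq_lt_sq _ hr.le <;> nlinarith [sq_nonneg (x - x0), sq_nonneg (y - y0)]
  set α : ℝ := 3 / r ^ 2 with hα
  have hα0 : 0 < α := by positivity
  have hαr : α * r ^ 2 = 3 := by rw [hα]; field_simp
  set e0 := Real.exp (-(16 * α)) with he0
  have he00 : 0 < e0 := Real.exp_pos _
  set E : ℝ → ℝ → ℝ := fun x y => Real.exp (-(α * ((x - x0) ^ 2 + (y - y0) ^ 2))) with hE
  have hE1 : ∀ x y, E x y ≤ 1 := fun x y => by
    apply Real.exp_le_one_iff.2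
    have : 0 ≤ (x - x0) ^ 2 + (y - y0) ^ 2 := by positivity
    nlinarith
  have hE0 : ∀ x y, 0 < E x y := fun x y => Real.exp_pos _
  have hEx : ∀ x y, HasDerivAt (fun t => E t y) (E x y * (-(2 * α * (x - x0)))) x := by
    intro x y
    refine ((((((hasDerivAt_id x).sub_const x0).pow 2).add_const ((y - y0) ^ 2)).const_mul
      α).neg.exp).congr_deriv ?_
    simp [hE]; ring
  have hEy : ∀ x y, HasDerivAt (fun t => E x t) (E x y * (-(2 * α * (y - y0)))) y := by
    intro x y
    refine ((((((hasDerivAt_id y).sub_const y0).pow 2).const_add ((x - x0) ^ 2)).const_mul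
      α).neg.exp).congr_deriv ?_
    simp [hE]; ring
  have hlin : ∀ z z0 : ℝ, HasDerivAt (fun t => -(2 * α * (t - z0))) (-(2 * α)) z := fun z z0 => by
    exact ((((hasDerivAt_id z).sub_const z0).const_mul (2 * α)).neg).congr_deriv (by simp)
  set H : ℝ × ℝ → ℝ := fun p => Real.sin p.1 * (a - c * (E p.1 p.2 - e0)) with hH
  have hHc : ContDiff ℝ 2 H := by
    simp only [hH, hE]; fun_prop
  have hG : ∀ x y, a - c ≤ a - c * (E x y - e0) := fun x y => by
    have := hE1 x y
    nlinarith
  have hlap : ∀ x y, pdx (pdx H) (x, y) + pdy (pdy H) (x, y) + H (x, y) =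
      - (c * E x y * (4 * α) * (Real.sin x * (α * ((x - x0) ^ 2 + (y - y0) ^ 2) - 1)
        - Real.cos x * (x - x0))) := by
    intro x y
    have gx : ∀ x y, HasDerivAt (fun t => a - c * (E t y - e0))
        (-(c * (E x y * (-(2 * α * (x - x0)))))) x := fun x y =>
      (((hEx x y).sub_const e0).const_mul c).const_sub a
    have gy : ∀ x y, HasDerivAt (fun t => a - c * (E x t - e0))
        (-(c * (E x y * (-(2 * α * (y - y0)))))) y := fun x y =>
      (((hEy x y).sub_const e0).const_mul c).const_sub a
    rw [lap_of (fx := fun p => Real.cos p.1 * (a - c * (E p.1 p.2 - e0)) +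
        Real.sin p.1 * (-(c * (E p.1 p.2 * (-(2 * α * (p.1 - x0)))))))
      (fy := fun p => Real.sin p.1 * (-(c * (E p.1 p.2 * (-(2 * α * (p.2 - y0)))))))
      hHc (fun x y => (Real.hasDerivAt_sin x).mul (gx x y))
      (fun x y => (gy x y).const_mul (Real.sin x))
      (((Real.hasDerivAt_cos x).mul (gx x y)).add ((Real.hasDerivAt_sin x).mul
        (((hEx x y).mul (hlin x x0)).const_mul c).neg))
      ((((hEy x y).mul (hlin y y0)).const_mul c).neg.const_mul (Real.sin x))]
    simp only [hH]
    ring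
  have hsn : ∀ x ∈ Icc 0 π, 0 ≤ Real.sin x := fun x hx => Real.sin_nonneg_of_nonneg_of_le_pi hx.1 hx.2
  have hfar : ∀ x y, x ∈ Icc 0 π → 16 ≤ (y - y0) ^ 2 → w (x, y) ≤ H (x, y) := by
    intro x y hx hy
    refine (hwa x y hx).trans ?_
    have : E x y ≤ e0 := by
      apply Real.exp_le_exp.2
      nlinarith [sq_nonneg (x - x0)]
    simp only [hH]
    have h1 : a ≤ a - c * (E x y - e0) := by nlinarith
    nlinarith [hsn x hx]
  have hcmp := comparison h hHc (a := 0) (b := π) (c := y0 - 4) (d := y0 + 4) le_rfl le_rfl ?_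
  · set e1 := Real.exp (-(α * π ^ 2)) with he1
    have he10 : e0 < e1 := by
      apply Real.exp_lt_exp.2
      nlinarith
    have he11 : e1 ≤ 1 := Real.exp_le_one_iff.2 (by nlinarith [sq_nonneg π])
    refine ⟨c * (e1 - e0), mul_pos hc0 (by linarith), by nlinarith, fun x hx => ?_⟩
    have h1 := hcmp x y0 hx ⟨by linarith, by linarith⟩
    refine h1.trans ?_
    have h2 : e1 ≤ E x y0 := by
      apply Real.exp_le_exp.2
      have : (x - x0) ^ 2 ≤ π ^ 2 := by
        apply sq_le_sq'
        · linarith [hx.1, hx0.2]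
        · linarith [hx.2, hx0.1]
      nlinarith
    simp only [hH]
    have h3 : a - c * (E x y0 - e0) ≤ a - c * (e1 - e0) := by nlinarith
    nlinarith [hsn x hx]
  intro x y hx hy
  have hs := hsn x hx
  by_cases hin : (x - x0) ^ 2 + (y - y0) ^ 2 < r ^ 2
  · left
    refine (hr x y hin).trans ?_
    simp only [hH]
    nlinarith [hG x y]
  rcases eq_or_lt_of_le hx.1 with e | l1
  · left
    rw [← e, h.hside0]; simp [hH]
  rcases eq_or_lt_of_le hx.2 with e | l2
  · left
    rw [e, h.hsideπ]; simp [hH]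
  rcases eq_or_lt_of_le hy.1 with e | l3
  · left
    exact hfar x y hx (by rw [← e]; norm_num)
  rcases eq_or_lt_of_le hy.2 with e | l4
  · left
    exact hfar x y hx (by rw [e]; norm_num)
  right
  refine ⟨⟨l1, l2⟩, ⟨l3, l4⟩, ?_, ?_⟩
  · simp only [hH]
    exact mul_nonneg hs (by linarith [hG x y])
  · rw [hlap, neg_lt_zero]
    have ht := tangent x x0 ⟨l1, l2⟩ hx0
    have hsp := Real.sin_pos_of_pos_of_lt_pi l1 l2
    have h3 : 3 ≤ α * ((x - x0) ^ 2 + (y - y0) ^ 2) := by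
      rw [← hαr]; gcongr; linarith
    have : 0 < Real.sin x * (α * ((x - x0) ^ 2 + (y - y0) ^ 2) - 1) - Real.cos x * (x - x0) := by
      nlinarith
    have := hE0 x y
    positivity

lemma step2 {w : ℝ × ℝ → ℝ} (h : Hyp w) {a δ y0 σ : ℝ} (hσ : σ = 1 ∨ σ = -1)
    (hwa : ∀ x y, x ∈ Icc 0 π → w (x, y) ≤ a * Real.sin x) (hδ : 0 < δ) (hδa : δ ≤ a)
    (hsl : ∀ x ∈ Icc 0 π, w (x, y0) ≤ (a - δ) * Real.sin x)
    (x y : ℝ) (hx : x ∈ Icc 0 π) (hy : 0 ≤ σ * (y - y0)) :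
    w (x, y) ≤ (a - δ / 4) * Real.sin x := by
  have hσ2 : σ ^ 2 = 1 := by rcases hσ with e | e <;> rw [e] <;> norm_num
  set s := σ * (y - y0) with hs
  set S := 2 * s + 1 with hS
  have hS0 : 0 < S := by linarith
  clear_value S s
  have hsn : ∀ x ∈ Icc 0 π, 0 ≤ Real.sin x := fun x hx => Real.sin_nonneg_of_nonneg_of_le_pi hx.1 hx.2
  have hyy : y = y0 + σ * s := by rw [hs]; linear_combination (-(y - y0)) * hσ2
  set H : ℝ × ℝ → ℝ := fun p => Real.sin p.1 * (a - δ * (1 - σ * (p.2 - y0) / S) ^ 2) with hH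
  have hHc : ContDiff ℝ 2 H := by
    simp only [hH]; fun_prop
  have hlap : ∀ x y, pdx (pdx H) (x, y) + pdy (pdy H) (x, y) + H (x, y) =
      - (Real.sin x * (2 * δ / S ^ 2)) := by
    intro x y
    have g : ∀ y, HasDerivAt (fun t => 1 - σ * (t - y0) / S) (-(σ / S)) y := fun y => by
      simpa using ((((hasDerivAt_id y).sub_const y0).const_mul σ).div_const S).const_sub 1
    rw [lap_of (fx := fun p => Real.cos p.1 * (a - δ * (1 - σ * (p.2 - y0) / S) ^ 2))
      (fy := fun p => Real.sin p.1 * (2 * δ * σ / S * (1 - σ * (p.2 - y0) / S)))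
      hHc (fun x y => (Real.hasDerivAt_sin x).mul_const (a - δ * (1 - σ * (y - y0) / S) ^ 2))
      (fun x y => ((((g y).pow 2).const_mul δ).const_sub a).const_mul (Real.sin x) |>.congr_deriv
        (by push_cast; ring))
      ((Real.hasDerivAt_cos x).mul_const (a - δ * (1 - σ * (y - y0) / S) ^ 2))
      (((g y).const_mul (2 * δ * σ / S)).const_mul (Real.sin x))]
    simp only [hH]
    linear_combination (-(Real.sin x * (2 * δ / S ^ 2))) * hσ2
  have hend : ∀ x t, x ∈ Icc 0 π → (t = y0 ∨ t = y0 + σ * S) → w (x, t) ≤ H (x, t) := by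
    intro x t hx ht
    rcases ht with e | e
    · subst e
      have := hsl x hx
      simp [hH]; linarith
    · have h1 := hwa x t hx
      have h2 : σ * (t - y0) / S = 1 := by
        rw [e, div_eq_one_iff_eq hS0.ne']; linear_combination S * hσ2
      simp only [hH, h2]; linarith
  have hinter : ∀ x t, x ∈ Ioo 0 π → 0 < σ * (t - y0) → σ * (t - y0) < S → 0 ≤ H (x, t) ∧
        pdx (pdx H) (x, t) + pdy (pdy H) (x, t) + H (x, t) < 0 := by
    intro x t hx h1 h2
    have hsp := Real.sin_pos_of_pos_of_lt_pi hx.1 hx.2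
    constructor
    · have h3 : σ * (t - y0) / S < 1 := (div_lt_one hS0).2 h2
      have h4 : 0 < σ * (t - y0) / S := div_pos h1 hS0
      apply mul_nonneg hsp.le
      simp only
      have : (1 - σ * (t - y0) / S) ^ 2 ≤ 1 := by nlinarith
      nlinarith
    · rw [hlap, neg_lt_zero]; positivity
  have hfin : w (x, y) ≤ H (x, y) := by
    have hgen : ∀ c d, c ≤ d → y ∈ Icc c d → (c = y0 ∨ c = y0 + σ * S) → (d = y0 ∨ d = y0 + σ * S) →
        (∀ t ∈ Ioo c d, 0 < σ * (t - y0) ∧ σ * (t - y0) < S) → w (x, y) ≤ H (x, y) := by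
      intro c d hcd hycd hc hd hI
      refine comparison h hHc (a := 0) (b := π) (c := c) (d := d) le_rfl le_rfl ?_ x y hx hycd
      intro x y hx hy
      rcases eq_or_lt_of_le hx.1 with e | l1
      · left
        rw [← e, h.hside0]; simp [hH]
      rcases eq_or_lt_of_le hx.2 with e | l2
      · left
        rw [e, h.hsideπ]; simp [hH]
      rcases eq_or_lt_of_le hy.1 with e | l3
      · left
        exact hend x y hx (e ▸ hc)
      rcases eq_or_lt_of_le hy.2 with e | l4
      · left
        exact hend x y hx (e ▸ hd)
      right
      have := hI y ⟨l3, l4⟩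
      exact ⟨⟨l1, l2⟩, ⟨l3, l4⟩, hinter x y ⟨l1, l2⟩ this.1 this.2⟩
    rcases hσ with e | e
    · rw [e] at hyy
      refine hgen y0 (y0 + S) (by linarith) ⟨by linarith, by linarith⟩ (Or.inl rfl)
        (Or.inr (by rw [e]; ring)) ?_
      intro t ht
      rw [e]; exact ⟨by linarith [ht.1], by linarith [ht.2]⟩
    · rw [e] at hyy
      refine hgen (y0 - S) y0 (by linarith) ⟨by linarith, by linarith⟩ (Or.inr (by rw [e]; ring))
        (Or.inl rfl) ?_
      intro t ht
      rw [e]; exact ⟨by linarith [ht.2], by linarith [ht.1]⟩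
  refine hfin.trans ?_
  have h1 : s / S ≤ 1 / 2 := by rw [div_le_div_iff₀ hS0 (by norm_num)]; linarith
  have h2 : 1 / 4 ≤ (1 - s / S) ^ 2 := by nlinarith
  simp only [hH]
  rw [← hs]
  have h3 : a - δ * (1 - s / S) ^ 2 ≤ a - δ / 4 := by nlinarith
  nlinarith [hsn x hx]

/-- **Lemma 3.4 (uniqueness in the strip).** A continuous function on the strip
`[0, π] × ℝ`, vanishing on the sides, with `0 < sup w ≤ 1`, satisfying `Δw + w ≥ 0`
classically on the open set where it is positive, is a positive multiple of `sin x`. -/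
theorem strip_uniqueness (w : ℝ × ℝ → ℝ)
    (hcont : ContinuousOn w {p : ℝ × ℝ | p.1 ∈ Set.Icc 0 π})
    (hside0 : ∀ y : ℝ, w (0, y) = 0) (hsideπ : ∀ y : ℝ, w (π, y) = 0)
    (hpos : ∃ p : ℝ × ℝ, p.1 ∈ Set.Icc 0 π ∧ 0 < w p)
    (hle : ∀ p : ℝ × ℝ, p.1 ∈ Set.Icc 0 π → w p ≤ 1)
    (hsmooth : ContDiffOn ℝ 2 w {p : ℝ × ℝ | p.1 ∈ Set.Ioo 0 π ∧ 0 < w p})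
    (hsub : ∀ p ∈ {p : ℝ × ℝ | p.1 ∈ Set.Ioo 0 π ∧ 0 < w p},
      0 ≤ pdx (pdx w) p + pdy (pdy w) p + w p) :
    ∃ a : ℝ, 0 < a ∧ ∀ p : ℝ × ℝ, p.1 ∈ Set.Icc 0 π → w p = a * Real.sin p.1 := by
  have h : Hyp w := ⟨hcont, hside0, hsideπ, hle, hsmooth, hsub⟩
  obtain ⟨⟨px, py⟩, hp, hwp⟩ := hpos
  simp only at hp
  have hsp : 0 < Real.sin px := by
    by_contra! hn
    have := bdd h px py hp
    linarith
  set A : Set ℝ := {a | ∀ x y, x ∈ Icc 0 π → w (x, y) ≤ a * Real.sin x} with hA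
  have hlb : ∀ a ∈ A, w (px, py) / Real.sin px ≤ a := fun a ha => by
    rw [div_le_iff₀ hsp]; exact ha px py hp
  have hbdd : BddBelow A := ⟨_, hlb⟩
  have hne : A.Nonempty := ⟨8, fun x y hx => bdd h x y hx⟩
  have ha0 : 0 < sInf A := (div_pos hwp hsp).trans_le (le_csInf hne hlb)
  have hsn : ∀ x ∈ Icc 0 π, 0 ≤ Real.sin x := fun x hx => Real.sin_nonneg_of_nonneg_of_le_pi hx.1 hx.2
  have hwa : ∀ x y, x ∈ Icc 0 π → w (x, y) ≤ sInf A * Real.sin x := by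
    intro x y hx
    rcases eq_or_lt_of_le (hsn x hx) with e | hs
    · have := bdd h x y hx
      rw [← e] at this ⊢; linarith
    · rw [← div_le_iff₀ hs]
      refine le_csInf hne fun a ha => ?_
      rw [div_le_iff₀ hs]; exact ha x y hx
  refine ⟨sInf A, ha0, ?_⟩
  rintro ⟨x0, y0⟩ hx0
  simp only at hx0 ⊢
  rcases eq_or_lt_of_le hx0.1 with e | l1
  · rw [← e, hside0]; simp
  rcases eq_or_lt_of_le hx0.2 with e | l2
  · rw [e, hsideπ]; simp
  by_contra hcon
  obtain ⟨δ, hδ, hδa, hsl⟩ := step1 h ha0 hwa ⟨l1, l2⟩ (lt_of_le_of_ne (hwa x0 y0 hx0) hcon)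
  have hmem : sInf A - δ / 4 ∈ A := by
    intro x y hx
    rcases le_total y0 y with hy | hy
    · exact step2 h (Or.inl rfl) hwa hδ hδa hsl x y hx (by linarith)
    · exact step2 h (Or.inr rfl) hwa hδ hδa hsl x y hx (by linarith)
  have := csInf_le hbdd hmem
  linarith
end

section
/- For every η ∈ (0, 1) there exist constants c > 0 and M with the following property: for every integer m ≥ M, every real μ with m ≤ μ ≤ m + 1 − η, and every a ∈ (0, π/2), if w : (−a, π/2) → ℝ is a bounded C² function which is positive on (−a, π/2), satisfies w(φ) → 0 as φ → (−a)⁺, and solves w''(φ) − tan(φ)·w'(φ) + μ(μ+1)·w(φ) = (m²/cos²(φ))·w(φ) for all φ ∈ (−a, π/2), then a ≥ c/√m. -/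
open Real Set Filter

lemma sd_cos_pow (m : ℕ) (φ : ℝ) (h : 0 < cos φ) :
    HasDerivAt (fun x => cos x ^ m) (-(m : ℝ) * tan φ * cos φ ^ m) φ := by
  have := (hasDerivAt_cos φ).pow m
  refine this.congr_deriv ?_
  rw [tan_eq_sin_div_cos]
  rcases m with _ | n
  · simp
  · simp only [Nat.add_sub_cancel, pow_succ]
    field_simp

lemma sd_core (m : ℕ) (hm : 1 ≤ m) (ν a : ℝ) (ha : a ∈ Ioo 0 (π / 2))
    (w w₁ w₂ V V₁ V₂ : ℝ → ℝ)
    (hw : ∀ φ ∈ Ioo (-a) (π / 2), HasDerivAt w (w₁ φ) φ)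
    (hw1 : ∀ φ ∈ Ioo (-a) (π / 2), HasDerivAt w₁ (w₂ φ) φ)
    (B : ℝ) (hB : ∀ φ ∈ Ioo (-a) (π / 2), |w φ| ≤ B)
    (hpos : ∀ φ ∈ Ioo (-a) (π / 2), 0 < w φ)
    (hlim : Tendsto w (nhdsWithin (-a) (Ioi (-a))) (nhds 0))
    (heq : ∀ φ ∈ Ioo (-a) (π / 2),
      w₂ φ - tan φ * w₁ φ + ν * w φ = ((m : ℝ) ^ 2 / cos φ ^ 2) * w φ)
    (hV : ∀ φ ∈ Ioo (-a) (π / 2), HasDerivAt V (V₁ φ) φ)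
    (hV1 : ∀ φ ∈ Ioo (-a) (π / 2), HasDerivAt V₁ (V₂ φ) φ)
    (hVpos : ∀ φ ∈ Ioo (-a) (π / 2), 0 < V φ)
    (L : ℝ) (hL : 0 < L) (hVlim : Tendsto V (nhdsWithin (-a) (Ioi (-a))) (nhds L))
    (K : ℝ) (hK : 0 < K) (hVK : ∀ φ ∈ Ioo (-a) (π / 2), V φ ≤ K * cos φ ^ m)
    (k ψ₀ : ℝ) (hk : 0 < k) (hψ₀ : ψ₀ ∈ Ioo 0 (π / 2))
    (hVk : ∀ φ ∈ Ioo ψ₀ (π / 2), k * cos φ ^ m ≤ V φ)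
    (hQ : ∀ φ ∈ Ioo (-a) (π / 2),
      V₂ φ - tan φ * V₁ φ + ν * V φ ≤ ((m : ℝ) ^ 2 / cos φ ^ 2) * V φ) : False := by
  obtain ⟨ha0, ha1⟩ := ha
  have hc : ∀ φ ∈ Ioo (-a) (π / 2), 0 < cos φ := fun φ h =>
    cos_pos_of_mem_Ioo ⟨by linarith [h.1], h.2⟩
  set G : ℝ → ℝ := fun φ => cos φ * (w₁ φ * V φ - w φ * V₁ φ) with hG
  have hGd : ∀ φ ∈ Ioo (-a) (π / 2), HasDerivAt G
      (cos φ * (w φ * (((m : ℝ) ^ 2 / cos φ ^ 2) * V φ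
        - (V₂ φ - tan φ * V₁ φ + ν * V φ)))) φ := by
    intro φ h
    have h1 := (hasDerivAt_cos φ).mul (((hw1 φ h).mul (hV φ h)).sub ((hw φ h).mul (hV1 φ h)))
    refine h1.congr_deriv ?_
    have e := heq φ h
    have c0 := hc φ h
    have e2 : w₂ φ = tan φ * w₁ φ - ν * w φ + ((m : ℝ) ^ 2 / cos φ ^ 2) * w φ := by linarith
    have e3 : sin φ = tan φ * cos φ := (tan_mul_cos c0.ne').symm
    simp only [Pi.sub_apply, Pi.mul_apply]
    rw [e2, e3]
    ring
  have hGm : MonotoneOn G (Ioo (-a) (π / 2)) := by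
    apply monotoneOn_of_deriv_nonneg (convex_Ioo _ _)
    · exact fun φ h => (hGd φ h).continuousAt.continuousWithinAt
    · rw [interior_Ioo]
      exact fun φ h => (hGd φ h).differentiableAt.differentiableWithinAt
    · rw [interior_Ioo]
      intro φ h
      rw [(hGd φ h).deriv]
      exact mul_nonneg (hc φ h).le (mul_nonneg (hpos φ h).le (by linarith [hQ φ h]))
  have hq : ∀ φ ∈ Ioo (-a) (π / 2),
      HasDerivAt (fun x => w x / V x) (G φ / (cos φ * V φ ^ 2)) φ := by
    intro φ h
    refine ((hw φ h).div (hV φ h) (hVpos φ h).ne').congr_deriv ?_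
    have := (hVpos φ h).ne'
    have := (hc φ h).ne'
    simp only [hG]
    field_simp
  by_cases hex : ∃ φ₀ ∈ Ioo (-a) (π / 2), 0 < G φ₀
  · obtain ⟨φ₀, hφ₀, hδ⟩ := hex
    set ψ := max φ₀ ψ₀ with hψ
    have hψI : ψ < π / 2 := max_lt hφ₀.2 hψ₀.2
    have hψ0 : 0 < ψ := lt_of_lt_of_le hψ₀.1 (le_max_right _ _)
    have hsub : ∀ φ ∈ Ico ψ (π / 2), φ ∈ Ioo (-a) (π / 2) := fun φ h =>
      ⟨by linarith [h.1], h.2⟩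
    set δ := G φ₀ with hδd
    have hGδ : ∀ φ ∈ Ico ψ (π / 2), δ ≤ G φ := fun φ h =>
      hGm hφ₀ (hsub φ h) ((le_max_left _ _).trans h.1)
    have hm0 : (0 : ℝ) < m := by exact_mod_cast hm
    set ε := δ / (2 * m * K ^ 2) with hε
    have hεpos : 0 < ε := by positivity
    have hP : ∀ φ ∈ Ico ψ (π / 2), HasDerivAt (fun x => w x / V x - ε * ((cos x ^ m) ^ 2)⁻¹)
        (G φ / (cos φ * V φ ^ 2) - ε * (2 * m * tan φ / (cos φ ^ m) ^ 2)) φ := by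
      intro φ h
      have c0 := hc φ (hsub φ h)
      have c1 : cos φ ^ m ≠ 0 := (pow_pos c0 m).ne'
      have h2 := ((sd_cos_pow m φ c0).pow 2).inv (pow_ne_zero 2 c1)
      refine (hq φ (hsub φ h)).sub ((h2.const_mul ε).congr_deriv ?_)
      simp only [Pi.pow_apply]
      field_simp
      norm_num
      try ring
    have hPm : MonotoneOn (fun x => w x / V x - ε * ((cos x ^ m) ^ 2)⁻¹) (Ico ψ (π / 2)) := by
      apply monotoneOn_of_deriv_nonneg (convex_Ico _ _)
      · exact fun φ h => (hP φ h).continuousAt.continuousWithinAt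
      · rw [interior_Ico]
        exact fun φ h => (hP φ ⟨h.1.le, h.2⟩).differentiableAt.differentiableWithinAt
      · rw [interior_Ico]
        intro φ h'
        have h : φ ∈ Ico ψ (π / 2) := ⟨h'.1.le, h'.2⟩
        rw [(hP φ h).deriv, sub_nonneg]
        have c0 := hc φ (hsub φ h)
        have c1 : 0 < cos φ ^ m := pow_pos c0 m
        have v0 := hVpos φ (hsub φ h)
        have v1 := hVK φ (hsub φ h)
        calc ε * (2 * m * tan φ / (cos φ ^ m) ^ 2)
            = δ * sin φ / (cos φ * (K * cos φ ^ m) ^ 2) := by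
              rw [hε, tan_eq_sin_div_cos]; field_simp
          _ ≤ δ * 1 / (cos φ * (K * cos φ ^ m) ^ 2) := by
              gcongr; exact sin_le_one φ
          _ ≤ G φ / (cos φ * V φ ^ 2) := by
              rw [mul_one]
              have := hGδ φ h
              have hG0 : 0 ≤ G φ := hδ.le.trans this
              gcongr
    set P0 := w ψ / V ψ - ε * ((cos ψ ^ m) ^ 2)⁻¹ with hP0
    have key : ∀ φ ∈ Ioo ψ (π / 2), ε + P0 * (cos φ ^ m) ^ 2 ≤ B / k * cos φ ^ m := by
      intro φ h'
      have h : φ ∈ Ico ψ (π / 2) := ⟨h'.1.le, h'.2⟩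
      have h1 : P0 ≤ w φ / V φ - ε * ((cos φ ^ m) ^ 2)⁻¹ := hPm ⟨le_rfl, hψI⟩ h h.1
      have c0 := hc φ (hsub φ h)
      have c1 : 0 < cos φ ^ m := pow_pos c0 m
      have v1 := hVk φ ⟨(le_max_right _ _).trans_lt h'.1, h.2⟩
      have wB : w φ ≤ B := (le_abs_self _).trans (hB φ (hsub φ h))
      have B0 : 0 ≤ B := (hpos φ (hsub φ h)).le.trans wB
      have h2 : w φ / V φ ≤ B / (k * cos φ ^ m) := by gcongr
      have h3 : P0 + ε * ((cos φ ^ m) ^ 2)⁻¹ ≤ B / (k * cos φ ^ m) := by linarith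
      have h4 := mul_le_mul_of_nonneg_right h3 (sq_nonneg (cos φ ^ m))
      have e1 : (P0 + ε * ((cos φ ^ m) ^ 2)⁻¹) * (cos φ ^ m) ^ 2 = ε + P0 * (cos φ ^ m) ^ 2 := by
        field_simp; ring
      have e2 : B / (k * cos φ ^ m) * (cos φ ^ m) ^ 2 = B / k * cos φ ^ m := by
        field_simp
      rwa [e1, e2] at h4
    have hev : ∀ᶠ φ in nhdsWithin (π / 2) (Iio (π / 2)),
        ε + P0 * (cos φ ^ m) ^ 2 ≤ B / k * cos φ ^ m := by
      filter_upwards [Ioo_mem_nhdsLT hψI] with φ h using key φ h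
    have hz : cos (π / 2) ^ m = 0 := by rw [cos_pi_div_two]; exact zero_pow (by omega)
    have t1 : Tendsto (fun φ => ε + P0 * (cos φ ^ m) ^ 2) (nhdsWithin (π / 2) (Iio (π / 2)))
        (nhds ε) := by
      have : Continuous (fun φ => ε + P0 * (cos φ ^ m) ^ 2) := by fun_prop
      have := (this.tendsto (π / 2)).mono_left (nhdsWithin_le_nhds (s := Iio (π / 2)))
      have hm' : m ≠ 0 := by omega
      simpa [hm'] using this
    have t2 : Tendsto (fun φ => B / k * cos φ ^ m) (nhdsWithin (π / 2) (Iio (π / 2)))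
        (nhds 0) := by
      have : Continuous (fun φ => B / k * cos φ ^ m) := by fun_prop
      have := (this.tendsto (π / 2)).mono_left (nhdsWithin_le_nhds (s := Iio (π / 2)))
      have hm' : m ≠ 0 := by omega
      simpa [hm'] using this
    have := le_of_tendsto_of_tendsto t1 t2 hev
    linarith
  · push Not at hex
    have hqa : AntitoneOn (fun x => w x / V x) (Ioo (-a) (π / 2)) := by
      apply antitoneOn_of_deriv_nonpos (convex_Ioo _ _)
      · exact fun φ h => (hq φ h).continuousAt.continuousWithinAt
      · rw [interior_Ioo]
        exact fun φ h => (hq φ h).differentiableAt.differentiableWithinAt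
      · rw [interior_Ioo]
        intro φ h
        rw [(hq φ h).deriv]
        have := hc φ h
        exact div_nonpos_of_nonpos_of_nonneg (hex φ h) (by positivity)
    have h0 : (0 : ℝ) ∈ Ioo (-a) (π / 2) := ⟨by linarith, by linarith⟩
    have ht := hlim.div hVlim hL.ne'
    have : w 0 / V 0 ≤ 0 / L := by
      refine ge_of_tendsto ht ?_
      filter_upwards [Ioo_mem_nhdsGT (show -a < 0 by linarith)] with φ h
      exact hqa ⟨h.1, by linarith [h.2]⟩ h0 h.2.le
    rw [zero_div] at this
    exact absurd (div_pos (hpos 0 h0) (hVpos 0 h0)) (not_lt.mpr this)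

/-- the polynomial inequality behind the supersolution -/
lemma sd_poly (η y : ℝ) (h0 : 0 < η) (h1 : η < 1) (hy : -(η / 44) < y) :
    η / 11 * (-1 + 11 * y ^ 2 + 3 * y ^ 4) ≤ η * y * (1 + y ^ 2) ^ 3 := by
  have : (-1 + 11 * y ^ 2 + 3 * y ^ 4) ≤ 11 * (y * (1 + y ^ 2) ^ 3) := by
    rcases le_total 0 y with h | h
    · nlinarith [mul_nonneg h (sq_nonneg (y - 1)), mul_nonneg (pow_nonneg h 3) (sq_nonneg (y - 1)),
        pow_nonneg h 3, pow_nonneg h 5, pow_nonneg h 7]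
    · have hz : -(1 / 44) ≤ y := by linarith
      have h2 : y ^ 2 ≤ 1 / 1000 := by nlinarith
      have h4 : y ^ 4 ≤ 1 / 1000 := by nlinarith [sq_nonneg y]
      have h5 : (1 + y ^ 2) ^ 3 ≤ 1.1 := by
        calc (1 + y ^ 2) ^ 3 ≤ (1 + 1 / 1000) ^ 3 := by gcongr
          _ ≤ 1.1 := by norm_num
      nlinarith [sq_nonneg y]
  nlinarith

set_option maxHeartbeats 2000000 in
theorem sector_depth_lower_bound (η : ℝ) (hη : η ∈ Set.Ioo (0 : ℝ) 1) :
    ∃ c : ℝ, 0 < c ∧ ∃ M : ℕ, ∀ m : ℕ, M ≤ m →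
      ∀ μ : ℝ, (m : ℝ) ≤ μ → μ ≤ (m : ℝ) + 1 - η →
      ∀ a : ℝ, a ∈ Set.Ioo 0 (π / 2) →
      ∀ w w₁ w₂ : ℝ → ℝ,
        (∀ φ ∈ Set.Ioo (-a) (π / 2), HasDerivAt w (w₁ φ) φ) →
        (∀ φ ∈ Set.Ioo (-a) (π / 2), HasDerivAt w₁ (w₂ φ) φ) →
        ContinuousOn w₂ (Set.Ioo (-a) (π / 2)) →
        (∃ B : ℝ, ∀ φ ∈ Set.Ioo (-a) (π / 2), |w φ| ≤ B) →
        (∀ φ ∈ Set.Ioo (-a) (π / 2), 0 < w φ) →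
        Filter.Tendsto w (nhdsWithin (-a) (Set.Ioi (-a))) (nhds 0) →
        (∀ φ ∈ Set.Ioo (-a) (π / 2),
          w₂ φ - Real.tan φ * w₁ φ + μ * (μ + 1) * w φ
            = ((m : ℝ) ^ 2 / Real.cos φ ^ 2) * w φ) →
        c / Real.sqrt m ≤ a := by
  obtain ⟨η0, η1⟩ := hη
  refine ⟨η / 88, by positivity, 1, ?_⟩
  intro m hm μ hμ1 hμ2 a ha w w₁ w₂ hw hw1 _ hB hpos hlim heq
  obtain ⟨B, hB⟩ := hB
  by_contra hlt
  push Not at hlt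
  have hm1 : (1 : ℝ) ≤ m := by exact_mod_cast hm
  have hsm : 0 < √(m : ℝ) := sqrt_pos.mpr (by linarith)
  rw [lt_div_iff₀ hsm] at hlt
  set N : ℝ := 2 * (m + 1) with hN
  have hNpos : 0 < N := by positivity
  have hN4 : 4 ≤ N := by linarith
  set r := √N with hr
  have hr0 : 0 < r := sqrt_pos.mpr hNpos
  have hr2 : r ^ 2 = N := sq_sqrt hNpos.le
  have hr1 : r ≤ 2 * √(m : ℝ) := by
    rw [hr, sqrt_le_left (by positivity), mul_pow, sq_sqrt (by linarith)]
    linarith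
  have har : a * r < η / 44 := by
    have := mul_le_mul_of_nonneg_left hr1 ha.1.le
    linarith
  set τ := η / 11 with hτ
  have hτ0 : 0 < τ := by positivity
  -- lower bound of y on the closed sector
  have hy : ∀ φ, -a ≤ φ → φ < π / 2 → -(η / 44) < r * sin φ := by
    intro φ h h'
    have h1 : -a ≤ sin φ := by
      have h2 : sin (-a) ≤ sin φ := sin_le_sin_of_le_of_le_pi_div_two (by linarith [ha.2]) h'.le h
      rw [sin_neg] at h2
      linarith [sin_le ha.1.le]
    nlinarith
  -- profile g as a function of y = r x
  have hgpos : ∀ y : ℝ, -(η / 44) < y → 0 < y + τ * (1 + y ^ 2)⁻¹ := by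
    intro y h
    rcases le_total 0 y with h0 | h0
    · positivity
    · have h2 : y ^ 2 ≤ 1 := by nlinarith
      have : 1 / 2 ≤ (1 + y ^ 2)⁻¹ := by
        rw [le_inv_comm₀ (by norm_num) (by positivity)]; linarith
      nlinarith
  have hg : ∀ y : ℝ, HasDerivAt (fun y : ℝ => y + τ * (1 + y ^ 2)⁻¹)
      (1 - 2 * τ * y * ((1 + y ^ 2) ^ 2)⁻¹) y := by
    intro y
    have hne : (1 + y ^ 2) ≠ 0 := by positivity
    have h1 := (((hasDerivAt_id y).pow 2).const_add 1).inv (by simpa using hne)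
    refine ((hasDerivAt_id y).add (h1.const_mul τ)).congr_deriv ?_
    simp
    field_simp
    try ring
  have hg' : ∀ y : ℝ, HasDerivAt (fun y : ℝ => 1 - 2 * τ * y * ((1 + y ^ 2) ^ 2)⁻¹)
      (τ * (6 * y ^ 2 - 2) * ((1 + y ^ 2) ^ 3)⁻¹) y := by
    intro y
    have hne : (1 + y ^ 2) ≠ 0 := by positivity
    have h1 := ((((hasDerivAt_id y).pow 2).const_add 1).pow 2).inv
      (by simpa using hne)
    refine ((((hasDerivAt_id y).const_mul (2 * τ)).mul h1).const_sub 1).congr_deriv ?_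
    simp
    field_simp
    try ring
  set g : ℝ → ℝ := fun y : ℝ => y + τ * (1 + y ^ 2)⁻¹ with hgdef
  set g' : ℝ → ℝ := fun y : ℝ => 1 - 2 * τ * y * ((1 + y ^ 2) ^ 2)⁻¹ with hgdef'
  set g'' : ℝ → ℝ := fun y : ℝ => τ * (6 * y ^ 2 - 2) * ((1 + y ^ 2) ^ 3)⁻¹ with hgdef''
  have hyd : ∀ φ, HasDerivAt (fun φ => r * sin φ) (r * cos φ) φ := fun φ =>
    (hasDerivAt_sin φ).const_mul r
  have hgφ : ∀ φ, HasDerivAt (fun φ => g (r * sin φ)) (g' (r * sin φ) * (r * cos φ)) φ :=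
    fun φ => (hg _).comp φ (hyd φ)
  have hgφ' : ∀ φ, HasDerivAt (fun φ => g' (r * sin φ)) (g'' (r * sin φ) * (r * cos φ)) φ :=
    fun φ => (hg' _).comp φ (hyd φ)
  have hc : ∀ φ ∈ Ioo (-a) (π / 2), 0 < cos φ := fun φ h =>
    cos_pos_of_mem_Ioo ⟨by linarith [h.1, ha.2], h.2⟩
  have hVd : ∀ φ, 0 < cos φ → HasDerivAt (fun φ => cos φ ^ m * g (r * sin φ))
      (cos φ ^ m * (g' (r * sin φ) * (r * cos φ) - m * tan φ * g (r * sin φ))) φ := by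
    intro φ h
    refine ((sd_cos_pow m φ h).mul (hgφ φ)).congr_deriv ?_
    ring
  have hpi := pi_pos
  have hVcont : Continuous (fun φ => cos φ ^ m * g (r * sin φ)) := by
    have : Continuous g := continuous_iff_continuousAt.mpr fun y => (hg y).continuousAt
    fun_prop
  refine sd_core m hm (μ * (μ + 1)) a ha w w₁ w₂
    (fun φ => cos φ ^ m * g (r * sin φ))
    (fun φ => cos φ ^ m * (g' (r * sin φ) * (r * cos φ) - m * tan φ * g (r * sin φ)))
    (fun φ => cos φ ^ m * (-(m * tan φ) * (g' (r * sin φ) * (r * cos φ)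
        - m * tan φ * g (r * sin φ)) + (g'' (r * sin φ) * (r * cos φ) * (r * cos φ)
        + g' (r * sin φ) * (r * (-sin φ))) - (m * (1 / cos φ ^ 2) * g (r * sin φ)
        + m * tan φ * (g' (r * sin φ) * (r * cos φ)))))
    hw hw1 B hB hpos hlim heq (fun φ h => hVd φ (hc φ h)) ?_ ?_
    (cos (-a) ^ m * g (r * sin (-a))) ?_ ?_ (r + τ) (by positivity) ?_
    (r / 2) (π / 6) (by positivity) ⟨by positivity, by linarith⟩ ?_ ?_
  · intro φ h
    have c0 := hc φ h
    have ht := ((hasDerivAt_tan c0.ne').const_mul (m : ℝ)).mul (hgφ φ)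
    have h2 := ((hgφ' φ).mul ((hasDerivAt_cos φ).const_mul r)).sub ht
    refine ((sd_cos_pow m φ c0).mul h2).congr_deriv ?_
    simp only [Pi.sub_apply, Pi.mul_apply]
    ring
  · intro φ h
    exact mul_pos (pow_pos (hc φ h) m) (hgpos _ (hy φ h.1.le h.2))
  · refine mul_pos (pow_pos (cos_pos_of_mem_Ioo ⟨by linarith [ha.2], by linarith [ha.1]⟩) m)
      (hgpos _ (hy _ le_rfl (by linarith [ha.1])))
  · exact (hVcont.tendsto (-a)).mono_left nhdsWithin_le_nhds
  · intro φ h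
    have c1 := pow_pos (hc φ h) m
    show cos φ ^ m * g (r * sin φ) ≤ _
    rw [mul_comm]
    refine mul_le_mul_of_nonneg_right ?_ c1.le
    have : (1 + (r * sin φ) ^ 2)⁻¹ ≤ 1 := inv_le_one_of_one_le₀ (by nlinarith [sq_nonneg (r * sin φ)])
    have := sin_le_one φ
    simp only [hgdef]
    nlinarith
  · intro φ h
    have c1 := pow_pos (hc φ ⟨by linarith [h.1, ha.1], h.2⟩) m
    show _ ≤ cos φ ^ m * g (r * sin φ)
    rw [mul_comm]
    refine mul_le_mul_of_nonneg_left ?_ c1.le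
    have hs : 1 / 2 ≤ sin φ := by
      rw [← sin_pi_div_six]
      exact sin_le_sin_of_le_of_le_pi_div_two (by linarith) h.2.le h.1.le
    have : 0 < (1 + (r * sin φ) ^ 2)⁻¹ := by positivity
    simp only [hgdef]
    nlinarith [mul_pos hτ0 this]
  · intro φ h
    have c0 := hc φ h
    have c1 := pow_pos c0 m
    have hyφ := hy φ h.1.le h.2
    have hG := hgpos _ hyφ
    set y := r * sin φ with hyd
    have hxN : N * sin φ ^ 2 = y ^ 2 := by rw [hyd, mul_pow, hr2]
    -- the inequality for g
    have main : N * (cos φ ^ 2 * g'' y - y * g' y + (1 - η) * g y) ≤ 0 := by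
      have hu : 0 < 1 + y ^ 2 := by positivity
      have hp := sd_poly η y η0 η1 hyφ
      have e : cos φ ^ 2 * g'' y - y * g' y + (1 - η) * g y
          = (τ * (cos φ ^ 2 * (6 * y ^ 2 - 2) + 2 * y ^ 2 * (1 + y ^ 2)
            + (1 - η) * (1 + y ^ 2) ^ 2) - η * y * (1 + y ^ 2) ^ 3) * ((1 + y ^ 2) ^ 3)⁻¹ := by
        simp only [hgdef, hgdef', hgdef'']
        field_simp
        ring
      have hb : cos φ ^ 2 * (6 * y ^ 2 - 2) + 2 * y ^ 2 * (1 + y ^ 2)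
            + (1 - η) * (1 + y ^ 2) ^ 2 ≤ -1 + 11 * y ^ 2 + 3 * y ^ 4 := by
        have hs : 2 * sin φ ^ 2 ≤ y ^ 2 := by nlinarith [sq_nonneg (sin φ)]
        rw [cos_sq']
        nlinarith [mul_nonneg (sq_nonneg (sin φ)) (sq_nonneg y), mul_nonneg η0.le (sq_nonneg (1 + y ^ 2))]
      rw [← hτ] at hp
      have hb' := mul_le_mul_of_nonneg_left hb hτ0.le
      rw [e]
      refine mul_nonpos_of_nonneg_of_nonpos hNpos.le
        (mul_nonpos_of_nonpos_of_nonneg (by linarith) (by positivity))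
    have hlam : μ * (μ + 1) - m * (m + 1) ≤ N * (1 - η) := by
      nlinarith
    have hlg := mul_le_mul_of_nonneg_right hlam hG.le
    have e3 : r * sin φ = y := rfl
    have fin : r ^ 2 * cos φ ^ 2 * g'' y - N * y * g' y + (μ * (μ + 1) - m * (m + 1)) * g y ≤ 0 := by
      rw [hr2]
      have : (μ * (μ + 1) - m * (m + 1)) * g y ≤ N * (1 - η) * g y := hlg
      nlinarith
    have fin2 := mul_nonpos_of_nonneg_of_nonpos c1.le fin
    rw [← sub_nonpos]
    refine le_trans (le_of_eq ?_) fin2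
    have hcs : sin φ ^ 2 = 1 - cos φ ^ 2 := sin_sq φ
    have ht2 : tan φ ^ 2 = 1 / cos φ ^ 2 - 1 := by
      rw [tan_eq_sin_div_cos, div_pow, hcs]; field_simp
    have htc : tan φ * cos φ = sin φ := tan_mul_cos c0.ne'
    have e4 : N * y * g' y = r * (tan φ * cos φ) * (2 * (m + 1)) * g' y := by
      rw [htc, hyd, hN]; ring
    rw [e4, ← htc]
    have : (m : ℝ) ^ 2 / cos φ ^ 2 = m ^ 2 * (1 / cos φ ^ 2) := by ring
    rw [this]
    have : 1 / cos φ ^ 2 = tan φ ^ 2 + 1 := by linarith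
    rw [this]
    ring
end

section
/- Let (σ_m) be any sequence with σ_m ∈ (0, 1) for each positive integer m. For each m let μ_m ≥ m be a real number, and let v_m be a function, continuous on the closed rectangle [0, π/m] × [−π/2, π/2], vanishing on the boundary of that rectangle and on the slit {(θ, 0) : 0 ≤ θ ≤ σ_m·π/m}, positive on Ω_{m,σ_m}, even in φ (v_m(θ, φ) = v_m(θ, −φ)), C² on Ω_{m,σ_m}, and satisfying ∂²_φ v_m − tan(φ)·∂_φ v_m + (cos φ)^{−2}·∂²_θ v_m + μ_m(μ_m+1)·v_m = 0 on Ω_{m,σ_m}. Define ṽ_m(x, y) := v_m(x/m, y/m) for (x, y) ∈ [0, π] × [0, m·π/2], and assume the normalization ∫₀^π ṽ_m(x, 1)·sin(x) dx = π/2. If limsup_{m→∞} (μ_m − m) < 1, then ṽ_m converges to the function (x, y) ↦ sin(x) uniformly on every compact subset of [0, π] × [0, +∞); that is, for every compact K ⊂ [0, π] × [0, +∞) and every ε > 0 there is M such that |ṽ_m(x, y) − sin(x)| ≤ ε for all m ≥ M and all (x, y) ∈ K. -/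
open Real Set Filter

/-- The closed spherical rectangle `[0, π/m] × [-π/2, π/2]` in `(θ, φ)` coordinates. -/
def RectSet (m : ℕ) : Set (ℝ × ℝ) :=
  Set.Icc (0 : ℝ) (π / m) ×ˢ Set.Icc (-(π / 2)) (π / 2)

/-- The slit spherical rectangle
`Ω_{m,σ} = (0, π/m) × (-π/2, π/2) \ {(θ, 0) : 0 ≤ θ ≤ σπ/m}`. -/
def OmegaSet (m : ℕ) (σ : ℝ) : Set (ℝ × ℝ) :=
  (Set.Ioo (0 : ℝ) (π / m) ×ˢ Set.Ioo (-(π / 2)) (π / 2)) \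
    {p : ℝ × ℝ | 0 ≤ p.1 ∧ p.1 ≤ σ * π / m ∧ p.2 = 0}

/-- `v` is an eigenfunction on the slit spherical rectangle `Ω_{m,σ}` with eigenvalue
`μ(μ+1)`: continuous on the closed rectangle, vanishing on its boundary and on the slit,
`C²` on `Ω_{m,σ}` and solving
`∂²_φ v - tan(φ)·∂_φ v + (cos φ)⁻²·∂²_θ v + μ(μ+1)·v = 0` there. -/
def SphEigen (m : ℕ) (σ μ : ℝ) (v : ℝ × ℝ → ℝ) : Prop :=
  ContinuousOn v (RectSet m) ∧
  (∀ p ∈ RectSet m, (p.1 = 0 ∨ p.1 = π / m ∨ p.2 = -(π / 2) ∨ p.2 = π / 2) → v p = 0) ∧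
  (∀ θ : ℝ, 0 ≤ θ → θ ≤ σ * π / m → v (θ, 0) = 0) ∧
  ContDiffOn ℝ 2 v (OmegaSet m σ) ∧
  (∀ p ∈ OmegaSet m σ,
    pdy (pdy v) p - Real.tan p.2 * pdy v p + pdx (pdx v) p / Real.cos p.2 ^ 2
      + μ * (μ + 1) * v p = 0)

namespace Blow
open Topology

lemma snd_deriv_nonpos {f f1 : ℝ → ℝ} {c d : ℝ} (hmax : IsLocalMax f c)
    (h1 : ∀ᶠ x in 𝓝 c, HasDerivAt f (f1 x) x) (h2 : HasDerivAt f1 d c) : d ≤ 0 := by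
  by_contra hd
  push Not at hd
  have e1 : deriv f =ᶠ[𝓝 c] f1 := h1.mono fun x hx => hx.deriv
  have e2 : deriv f c = 0 := hmax.deriv_eq_zero
  have e3 : deriv (deriv f) c = d := by rw [e1.deriv_eq, h2.deriv]
  have hmin := isLocalMin_of_deriv_deriv_pos (by rw [e3]; exact hd) e2 h1.self_of_nhds.continuousAt
  have e4 : f =ᶠ[𝓝 c] fun _ => f c := by
    filter_upwards [hmax, hmin] with x a b using le_antisymm a b
  have e5 : deriv f =ᶠ[𝓝 c] fun _ => 0 := by
    have := e4.deriv
    simpa using this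
  have : deriv (deriv f) c = 0 := by rw [e5.deriv_eq]; simp
  linarith

/-- viscosity subsolution property at a point, for the one-dimensional operator -/
def Visc (F R : ℝ → ℝ) (c : ℝ) : Prop :=
  ∀ q q1 q2 : ℝ → ℝ, (∀ᶠ x in 𝓝 c, HasDerivAt q (q1 x) x ∧ HasDerivAt q1 (q2 x) x) →
    ContinuousAt q2 c → IsLocalMax (fun x => F x - q x) c →
    0 ≤ q2 c - Real.tan c * q1 c + R c

lemma visc_of_approx {F R : ℝ → ℝ} {c ρ : ℝ} (hρ : 0 < ρ) (hcos : Real.cos c ≠ 0)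
    (hR : ContinuousAt R c) 
    (h : ∀ η > 0, ∃ G G1 G2 : ℝ → ℝ, ∀ x ∈ Icc (c - ρ) (c + ρ),
      HasDerivAt G (G1 x) x ∧ HasDerivAt G1 (G2 x) x ∧ |G x - F x| ≤ η ∧
      -η ≤ G2 x - Real.tan x * G1 x + R x) : Visc F R c := by
  intro q q1 q2 hq hq2 hmax
  by_contra hneg
  push Not at hneg
  set D := -(q2 c - Real.tan c * q1 c + R c) with hD
  have hDpos : 0 < D := by linarith
  -- perturbation
  set κ := D / 4 with hκ
  have hκpos : 0 < κ := by positivity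
  have htan : ContinuousAt Real.tan c := Real.continuousAt_tan.2 hcos
  have hq1c : ContinuousAt q1 c := hq.self_of_nhds.2.continuousAt
  have hcont : ContinuousAt (fun x => (q2 x + 2 * κ) - Real.tan x * (q1 x + 2 * κ * (x - c)) + R x) c := by
    fun_prop
  have hval : (fun x => (q2 x + 2 * κ) - Real.tan x * (q1 x + 2 * κ * (x - c)) + R x) c < - D / 4 := by
    simp only [sub_self, mul_zero, add_zero]
    linarith
  have ev1 := hcont.eventually_lt_const hval
  have ev := (hq.and (hmax.and ev1))
  obtain ⟨r, hr, hball⟩ := Metric.eventually_nhds_iff.1 ev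
  set s := min (r / 2) (ρ / 2) with hs
  have hspos : 0 < s := by positivity
  have hsr : s ≤ r / 2 := min_le_left _ _
  have hsρ : s ≤ ρ / 2 := min_le_right _ _
  set η := min (κ * s ^ 2 / 4) (D / 8) with hη
  have hηpos : 0 < η := by positivity
  obtain ⟨G, G1, G2, hG⟩ := h η hηpos
  have hη1 : η ≤ κ * s ^ 2 / 4 := min_le_left _ _
  have hη2 : η ≤ D / 8 := min_le_right _ _
  have inball : ∀ x ∈ Icc (c - s) (c + s), dist x c < r := by
    intro x hx
    rw [Real.dist_eq, abs_lt]
    constructor <;> linarith [hx.1, hx.2]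
  have inρ : ∀ x ∈ Icc (c - s) (c + s), x ∈ Icc (c - ρ) (c + ρ) := by
    intro x hx
    constructor <;> linarith [hx.1, hx.2]
  set Ψ : ℝ → ℝ := fun x => G x - (q x + κ * (x - c) ^ 2) with hΨ
  have hΨc : ContinuousOn Ψ (Icc (c - s) (c + s)) := by
    intro x hx
    have a1 := (hG x (inρ x hx)).1.continuousAt
    have a2 := (hball (inball x hx)).1.1.continuousAt
    have : ContinuousAt Ψ x := by fun_prop
    exact this.continuousWithinAt
  obtain ⟨z, hz, hzmax⟩ := isCompact_Icc.exists_isMaxOn (nonempty_Icc.2 (by linarith)) hΨc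
  have hcmem : c ∈ Icc (c - s) (c + s) := ⟨by linarith, by linarith⟩
  have hcz : Ψ c ≤ Ψ z := hzmax hcmem
  have hend : ∀ x ∈ Icc (c - s) (c + s), (x - c) ^ 2 = s ^ 2 → Ψ x < Ψ c := by
    intro x hx hxs
    have b1 := abs_le.1 (hG x (inρ x hx)).2.2.1
    have b2 := abs_le.1 (hG c (inρ c hcmem)).2.2.1
    have b3 := (hball (inball x hx)).2.1
    simp only [hΨ, hxs, sub_self]
    have : 0 < κ * s ^ 2 := by positivity
    simp only at b3
    nlinarith [b1.2, b2.1]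
  have hz1 : z ≠ c - s := by
    rintro rfl
    exact absurd (hend _ hz (by ring)) (not_lt.2 hcz)
  have hz2 : z ≠ c + s := by
    rintro rfl
    exact absurd (hend _ hz (by ring)) (not_lt.2 hcz)
  have hzo : z ∈ Ioo (c - s) (c + s) := ⟨lt_of_le_of_ne hz.1 (Ne.symm hz1), lt_of_le_of_ne hz.2 hz2⟩
  have hnb : Icc (c - s) (c + s) ∈ 𝓝 z := Icc_mem_nhds hzo.1 hzo.2
  have hloc : IsLocalMax Ψ z := hzmax.isLocalMax hnb
  have hd1 : ∀ x ∈ Icc (c - s) (c + s), HasDerivAt Ψ (G1 x - (q1 x + 2 * κ * (x - c))) x := by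
    intro x hx
    have a1 := (hG x (inρ x hx)).1
    have a2 := (hball (inball x hx)).1.1
    have a3 : HasDerivAt (fun x => κ * (x - c) ^ 2) (2 * κ * (x - c)) x := by
      have := (((hasDerivAt_id x).sub_const c).pow 2).const_mul κ
      refine this.congr_deriv ?_
      simp; ring
    exact a1.sub (a2.add a3)
  have hd2 : HasDerivAt (fun x => G1 x - (q1 x + 2 * κ * (x - c))) (G2 z - (q2 z + 2 * κ)) z := by
    have a1 := (hG z (inρ z hz)).2.1
    have a2 := (hball (inball z hz)).1.2
    have a3 : HasDerivAt (fun x => 2 * κ * (x - c)) (2 * κ) z := by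
      have := ((hasDerivAt_id z).sub_const c).const_mul (2 * κ)
      refine this.congr_deriv ?_
      simp
    exact a1.sub (a2.add a3)
  have e1 := snd_deriv_nonpos hloc (Filter.eventually_of_mem hnb hd1) hd2
  have e2 : G1 z - (q1 z + 2 * κ * (z - c)) = 0 := hloc.hasDerivAt_eq_zero (hd1 z hz)
  have e3 := (hG z (inρ z hz)).2.2.2
  have e4 := (hball (inball z hz)).2.2
  have e5 : G1 z = q1 z + 2 * κ * (z - c) := by linarith
  rw [e5] at e3
  linarith

end Blow

namespace Blow
open Topology

lemma dui {u u2 : ℝ → ℝ → ℝ} {c1 c2 : ℝ} {ψ : ℝ → ℝ} (hψ : Continuous ψ)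
    (hu : ContinuousOn (Function.uncurry u) (Icc 0 π ×ˢ Ioo c1 c2))
    (hu2 : ContinuousOn (Function.uncurry u2) (Icc 0 π ×ˢ Ioo c1 c2))
    (hd : ∀ x ∈ Icc 0 π, ∀ y ∈ Ioo c1 c2, HasDerivAt (fun y => u x y) (u2 x y) y)
    {y : ℝ} (hy : y ∈ Ioo c1 c2) :
    HasDerivAt (fun y => ∫ x in (0:ℝ)..π, u x y * ψ x) (∫ x in (0:ℝ)..π, u2 x y * ψ x) y := by
  have hpi := Real.pi_pos
  obtain ⟨r, hr, hball⟩ := Metric.isOpen_iff.1 isOpen_Ioo y hy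
  have hsub : Icc (y - r/2) (y + r/2) ⊆ Ioo c1 c2 := by
    intro z hz
    apply hball
    rw [Metric.mem_ball, Real.dist_eq, abs_lt]
    constructor <;> linarith [hz.1, hz.2]
  have hcomp : IsCompact (Icc (0:ℝ) π ×ˢ Icc (y - r/2) (y + r/2)) := isCompact_Icc.prod isCompact_Icc
  have hc2 : ContinuousOn (fun p : ℝ × ℝ => u2 p.1 p.2 * ψ p.1) (Icc (0:ℝ) π ×ˢ Icc (y - r/2) (y + r/2)) := by
    apply ContinuousOn.mul
    · exact hu2.mono (prod_mono le_rfl hsub)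
    · fun_prop
  obtain ⟨C, hC⟩ := hcomp.exists_bound_of_continuousOn hc2
  have slice : ∀ w : ℝ → ℝ → ℝ, ContinuousOn (Function.uncurry w) (Icc 0 π ×ˢ Ioo c1 c2) →
      ∀ z ∈ Ioo c1 c2, ContinuousOn (fun x => w x z * ψ x) (Icc 0 π) := by
    intro w hw z hz
    apply ContinuousOn.mul _ hψ.continuousOn
    have : ContinuousOn (fun x : ℝ => (x, z)) (Icc 0 π) := by fun_prop
    exact hw.comp this (fun x hx => ⟨hx, hz⟩)
  have hmeas : ∀ w : ℝ → ℝ → ℝ, ContinuousOn (Function.uncurry w) (Icc 0 π ×ˢ Ioo c1 c2) →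
      ∀ z ∈ Ioo c1 c2, MeasureTheory.AEStronglyMeasurable (fun x => w x z * ψ x)
        (MeasureTheory.volume.restrict (Set.uIoc 0 π)) := by
    intro w hw z hz
    apply ContinuousOn.aestronglyMeasurable _ measurableSet_uIoc
    apply (slice w hw z hz).mono
    rw [uIoc_of_le hpi.le]; exact Ioc_subset_Icc_self
  have key := intervalIntegral.hasDerivAt_integral_of_dominated_loc_of_deriv_le
    (μ := MeasureTheory.volume) (a := 0) (b := π) (F := fun z x => u x z * ψ x)
    (F' := fun z x => u2 x z * ψ x) (x₀ := y) (s := Icc (y - r/2) (y + r/2)) (bound := fun _ => C)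
    (Icc_mem_nhds (by linarith) (by linarith))
    (by filter_upwards [isOpen_Ioo.mem_nhds hy] with z hz using hmeas u hu z hz)
    (by
      apply ContinuousOn.intervalIntegrable
      rw [uIcc_of_le hpi.le]; exact slice u hu y hy)
    (hmeas u2 hu2 y hy)
    (by
      refine Eventually.of_forall fun x hx z hz => ?_
      rw [uIoc_of_le hpi.le] at hx
      exact hC (x, z) ⟨Ioc_subset_Icc_self hx, hz⟩)
    (by simp)
    (by
      refine Eventually.of_forall fun x hx z hz => ?_
      rw [uIoc_of_le hpi.le] at hx
      exact (hd x (Ioc_subset_Icc_self hx) z (hsub hz)).mul_const _)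
  exact key.2

lemma ibp {g g1 g11 ψ ψ1 ψ2 : ℝ → ℝ} 
    (hg : ∀ x ∈ Icc 0 π, HasDerivAt g (g1 x) x) (hg1 : ∀ x ∈ Icc 0 π, HasDerivAt g1 (g11 x) x)
    (hg11 : ContinuousOn g11 (Icc 0 π))
    (hψ : ∀ x, HasDerivAt ψ (ψ1 x) x) (hψ1 : ∀ x, HasDerivAt ψ1 (ψ2 x) x) (hψ2 : Continuous ψ2)
    (h0 : ψ 0 = 0) (hp : ψ π = 0) :
    ∫ x in (0:ℝ)..π, g11 x * ψ x = (∫ x in (0:ℝ)..π, g x * ψ2 x) - (g π * ψ1 π - g 0 * ψ1 0) := by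
  have hpi := Real.pi_pos
  have hu := uIcc_of_le hpi.le
  have hc1 : Continuous ψ1 := continuous_iff_continuousAt.2 fun x => (hψ1 x).continuousAt
  have hgc : ContinuousOn g1 (Icc 0 π) := fun x hx => (hg1 x hx).continuousAt.continuousWithinAt
  have i1 := intervalIntegral.integral_mul_deriv_eq_deriv_mul (a := 0) (b := π)
    (u := ψ) (u' := ψ1) (v := g1) (v' := g11) (fun x _ => hψ x) 
    (fun x hx => hg1 x (by rwa [hu] at hx))
    (hc1.intervalIntegrable _ _) (ContinuousOn.intervalIntegrable (by rwa [hu]))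
  have i2 := intervalIntegral.integral_mul_deriv_eq_deriv_mul (a := 0) (b := π)
    (u := ψ1) (u' := ψ2) (v := g) (v' := g1) (fun x _ => hψ1 x) 
    (fun x hx => hg x (by rwa [hu] at hx))
    (hψ2.intervalIntegrable _ _) (ContinuousOn.intervalIntegrable (by rwa [hu]))
  rw [h0, hp] at i1
  have e1 : ∫ x in (0:ℝ)..π, g11 x * ψ x = ∫ x in (0:ℝ)..π, ψ x * g11 x := by
    congr 1; ext x; ring
  have e2 : ∫ x in (0:ℝ)..π, g x * ψ2 x = ∫ x in (0:ℝ)..π, ψ2 x * g x := by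
    congr 1; ext x; ring
  rw [e1, e2, i1, i2]
  ring

end Blow

namespace Blow
open Topology

/-- slit rectangle in rescaled first variable -/
def Om (s : ℝ) : Set (ℝ × ℝ) :=
  {p | p.1 ∈ Ioo 0 π ∧ p.2 ∈ Ioo (-(π/2)) (π/2) ∧ ¬ (p.1 ≤ s * π ∧ p.2 = 0)}

structure Good (M lam s : ℝ) (V Vx Vxx Vy Vyy : ℝ → ℝ → ℝ) : Prop where
  cont : Continuous (Function.uncurry V)
  zero : ∀ x y, (x, y) ∉ Om s → V x y = 0
  pos : ∀ x y, (x, y) ∈ Om s → 0 < V x y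
  even : ∀ x y, V x (-y) = V x y
  dx : ∀ x y, (x, y) ∈ Om s → HasDerivAt (fun t => V t y) (Vx x y) x
  dxx : ∀ x y, (x, y) ∈ Om s → HasDerivAt (fun t => Vx t y) (Vxx x y) x
  dy : ∀ x y, (x, y) ∈ Om s → HasDerivAt (fun t => V x t) (Vy x y) y
  dyy : ∀ x y, (x, y) ∈ Om s → HasDerivAt (fun t => Vy x t) (Vyy x y) y
  cx : ContinuousOn (Function.uncurry Vx) (Om s)
  cxx : ContinuousOn (Function.uncurry Vxx) (Om s)
  cy : ContinuousOn (Function.uncurry Vy) (Om s)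
  cyy : ContinuousOn (Function.uncurry Vyy) (Om s)
  pde : ∀ x y, (x, y) ∈ Om s →
    Vyy x y - Real.tan y * Vy x y + M * Vxx x y / Real.cos y ^ 2 + lam * V x y = 0

/-- admissible weights -/
structure Wt (ψ ψ1 ψ2 : ℝ → ℝ) : Prop where
  d1 : ∀ x, HasDerivAt ψ (ψ1 x) x
  d2 : ∀ x, HasDerivAt ψ1 (ψ2 x) x
  c2 : Continuous ψ2
  z0 : ψ 0 = 0
  zp : ψ π = 0

lemma Wt.c1 {ψ ψ1 ψ2 : ℝ → ℝ} (h : Wt ψ ψ1 ψ2) : Continuous ψ1 :=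
  continuous_iff_continuousAt.2 fun x => (h.d2 x).continuousAt

lemma Wt.c0 {ψ ψ1 ψ2 : ℝ → ℝ} (h : Wt ψ ψ1 ψ2) : Continuous ψ :=
  continuous_iff_continuousAt.2 fun x => (h.d1 x).continuousAt

variable {M lam s : ℝ} {V Vx Vxx Vy Vyy : ℝ → ℝ → ℝ}

lemma contH {V : ℝ → ℝ → ℝ} (hV : Continuous (Function.uncurry V)) {ψ : ℝ → ℝ} (hψ : Continuous ψ) :
    Continuous (fun p : ℝ × ℝ => ∫ x in (0:ℝ)..π, V (p.1 + (1 - 2 * p.1 / π) * x) p.2 * ψ x) := by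
  apply intervalIntegral.continuous_parametric_intervalIntegral_of_continuous'
  have : Continuous (fun q : (ℝ × ℝ) × ℝ => Function.uncurry V (q.1.1 + (1 - 2 * q.1.1 / π) * q.2, q.1.2)) := by
    apply hV.comp; fun_prop
  exact this.mul (by fun_prop)

lemma contF {V : ℝ → ℝ → ℝ} (hV : Continuous (Function.uncurry V)) {ψ : ℝ → ℝ} (hψ : Continuous ψ) :
    Continuous (fun y : ℝ => ∫ x in (0:ℝ)..π, V x y * ψ x) := by
  have := (contH hV hψ).comp (f := fun y : ℝ => ((0:ℝ), y)) (by fun_prop)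
  simpa [Function.comp_def] using this

lemma visc1 (hG : Good M lam s V Vx Vxx Vy Vyy) {ψ ψ1 ψ2 : ℝ → ℝ} (hψ : Wt ψ ψ1 ψ2)
    {c : ℝ} (hc : c ∈ Ioo 0 (π/2)) :
    Visc (fun y => ∫ x in (0:ℝ)..π, V x y * ψ x)
      (fun y => M / Real.cos y ^ 2 * (∫ x in (0:ℝ)..π, V x y * ψ2 x)
        + lam * ∫ x in (0:ℝ)..π, V x y * ψ x) c := by
  have hpi := Real.pi_pos
  obtain ⟨hc0, hc1⟩ := hc
  set ρ := min (c / 2) ((π/2 - c) / 2) with hρ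
  have hρ0 : 0 < ρ := lt_min (by linarith) (by linarith)
  have hρ1 : ρ ≤ c / 2 := min_le_left _ _
  have hρ2 : ρ ≤ (π/2 - c) / 2 := min_le_right _ _
  have hJ : ∀ y ∈ Icc (c - ρ) (c + ρ), y ∈ Ioo 0 (π/2) := fun y hy =>
    ⟨by linarith [hy.1], by linarith [hy.2]⟩
  have hcosp : ∀ y ∈ Ioo 0 (π/2), 0 < Real.cos y := fun y hy =>
    Real.cos_pos_of_mem_Ioo ⟨by linarith [hy.1], hy.2⟩
  have hcc := hcosp c ⟨hc0, hc1⟩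
  have F0 := contF hG.cont hψ.c0
  have F2 := contF hG.cont hψ.c2
  have H0 := contH hG.cont hψ.c0
  have H2 := contH hG.cont hψ.c2
  refine visc_of_approx hρ0 hcc.ne' ?_ ?_
  · refine ContinuousAt.add (ContinuousAt.mul ?_ F2.continuousAt) (F0.continuousAt.const_mul _)
    have := hcc.ne'
    fun_prop (disch := positivity)
  intro η hη
  -- the error function
  set T : ℝ × ℝ → ℝ := fun p => 
    (-(M / (Real.cos p.2 ^ 2 * (1 - 2 * p.1 / π) ^ 2)) * 
      ((∫ x in (0:ℝ)..π, V (p.1 + (1 - 2 * p.1 / π) * x) p.2 * ψ2 x)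
        - (V (p.1 + (1 - 2 * p.1 / π) * π) p.2 * ψ1 π - V (p.1 + (1 - 2 * p.1 / π) * 0) p.2 * ψ1 0))
      - lam * ∫ x in (0:ℝ)..π, V (p.1 + (1 - 2 * p.1 / π) * x) p.2 * ψ x)
    + (M / Real.cos p.2 ^ 2 * (∫ x in (0:ℝ)..π, V x p.2 * ψ2 x)
        + lam * ∫ x in (0:ℝ)..π, V x p.2 * ψ x) with hT
  have hV1 : Continuous (fun p : ℝ × ℝ => V (p.1 + (1 - 2 * p.1 / π) * π) p.2) := by
    have : Continuous (fun p : ℝ × ℝ => Function.uncurry V (p.1 + (1 - 2 * p.1 / π) * π, p.2)) := by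
      apply hG.cont.comp; fun_prop
    exact this
  have hV0 : Continuous (fun p : ℝ × ℝ => V (p.1 + (1 - 2 * p.1 / π) * 0) p.2) := by
    have : Continuous (fun p : ℝ × ℝ => Function.uncurry V (p.1 + (1 - 2 * p.1 / π) * 0, p.2)) := by
      apply hG.cont.comp; fun_prop
    exact this
  have hedge0 : ∀ y, V 0 y = 0 := fun y => hG.zero _ _ (by simp [Om])
  have hedgep : ∀ y, V π y = 0 := fun y => hG.zero _ _ (by simp [Om])
  have hTc : ∀ y ∈ Icc (c - ρ) (c + ρ), ContinuousAt T (0, y) := by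
    intro y hy
    have hcy := (hcosp y (hJ y hy)).ne'
    have k1 : ContinuousAt (fun p : ℝ × ℝ => M / (Real.cos p.2 ^ 2 * (1 - 2 * p.1 / π) ^ 2)) (0, y) := by
      have : Real.cos y ^ 2 * (1 - 2 * 0 / π) ^ 2 ≠ 0 := by simp [hcy]
      refine ContinuousAt.div (by fun_prop) (by fun_prop) this
    have k2 : ContinuousAt (fun p : ℝ × ℝ => M / (Real.cos p.2 ^ 2)) (0, y) := by
      have : Real.cos y ^ 2 ≠ 0 := by simp [hcy]
      refine ContinuousAt.div (by fun_prop) (by fun_prop) this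
    have k3 : Continuous (fun p : ℝ × ℝ => ∫ x in (0:ℝ)..π, V x p.2 * ψ2 x) := F2.comp continuous_snd
    have k4 : Continuous (fun p : ℝ × ℝ => ∫ x in (0:ℝ)..π, V x p.2 * ψ x) := F0.comp continuous_snd
    refine ContinuousAt.add (ContinuousAt.sub (ContinuousAt.mul k1.neg ?_) ?_) (ContinuousAt.add (k2.mul k3.continuousAt) ?_)
    · exact (H2.sub ((hV1.mul continuous_const).sub (hV0.mul continuous_const))).continuousAt
    · exact (H0.continuousAt).const_mul _
    · exact k4.continuousAt.const_mul _
  have hT0 : ∀ y, T (0, y) = 0 := by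
    intro y
    simp [hT, hedge0, hedgep]
  have hD : Continuous (fun p : ℝ × ℝ => (∫ x in (0:ℝ)..π, V (p.1 + (1 - 2 * p.1 / π) * x) p.2 * ψ x) - ∫ x in (0:ℝ)..π, V x p.2 * ψ x) := 
    H0.sub (F0.comp continuous_snd)
  have hev : ∀ᶠ a in 𝓝 (0:ℝ), ∀ y ∈ Icc (c - ρ) (c + ρ), 
      |(∫ x in (0:ℝ)..π, V (a + (1 - 2 * a / π) * x) y * ψ x) - ∫ x in (0:ℝ)..π, V x y * ψ x| < η
      ∧ -η < T (a, y) := by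
    refine isCompact_Icc.eventually_forall_of_forall_eventually ?_
    intro y hy
    have e1 := (hD.abs.continuousAt (x := ((0:ℝ), y))).eventually_lt_const (u := η) (by simpa using hη)
    have e2 := (hTc y hy).eventually_const_lt (u := -η) (by rw [hT0]; linarith)
    filter_upwards [e1, e2] with p h1 h2 using ⟨h1, h2⟩
  obtain ⟨a, ⟨hae, ha1⟩, ha0⟩ := (((hev.and (eventually_lt_nhds (show (0:ℝ) < 1 by norm_num))).filter_mono 
    nhdsWithin_le_nhds).and (self_mem_nhdsWithin (s := Ioi (0:ℝ)))).exists
  have ha0 : 0 < a := ha0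
  have hpi3 := Real.pi_gt_three
  set β := 1 - 2 * a / π with hβ
  have hβ0 : 0 < β := by
    rw [hβ, sub_pos, div_lt_one hpi]; linarith
  have hβπ : β * π = π - 2 * a := by rw [hβ]; field_simp
  have hin : ∀ x ∈ Icc 0 π, ∀ y ∈ Ioo 0 (π/2), (a + β * x, y) ∈ Om s := by
    intro x hx y hy
    have h1 : 0 ≤ β * x := mul_nonneg hβ0.le hx.1
    have h2 : β * x ≤ β * π := mul_le_mul_of_nonneg_left hx.2 hβ0.le
    refine ⟨⟨by simp only; linarith, by simp only; linarith⟩, ⟨by simp only; linarith [hy.1], hy.2⟩, ?_⟩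
    simp only
    rintro ⟨-, h⟩
    linarith [hy.1]
  have hmap : ContinuousOn (fun p : ℝ × ℝ => (a + β * p.1, p.2)) (Icc 0 π ×ˢ Ioo 0 (π/2)) := by fun_prop
  have hmt : MapsTo (fun p : ℝ × ℝ => (a + β * p.1, p.2)) (Icc 0 π ×ˢ Ioo 0 (π/2)) (Om s) :=
    fun p hp => hin p.1 hp.1 p.2 hp.2
  have cV : ContinuousOn (Function.uncurry fun x y => V (a + β * x) y) (Icc 0 π ×ˢ Ioo 0 (π/2)) :=
    hG.cont.comp_continuousOn hmap
  have cVy : ContinuousOn (Function.uncurry fun x y => Vy (a + β * x) y) (Icc 0 π ×ˢ Ioo 0 (π/2)) :=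
    hG.cy.comp hmap hmt
  have cVyy : ContinuousOn (Function.uncurry fun x y => Vyy (a + β * x) y) (Icc 0 π ×ˢ Ioo 0 (π/2)) :=
    hG.cyy.comp hmap hmt
  have cVxx : ContinuousOn (Function.uncurry fun x y => Vxx (a + β * x) y) (Icc 0 π ×ˢ Ioo 0 (π/2)) :=
    hG.cxx.comp hmap hmt
  refine ⟨fun y => ∫ x in (0:ℝ)..π, V (a + β * x) y * ψ x, fun y => ∫ x in (0:ℝ)..π, Vy (a + β * x) y * ψ x,
    fun y => ∫ x in (0:ℝ)..π, Vyy (a + β * x) y * ψ x, fun y hy => ?_⟩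
  have hyJ := hJ y hy
  have hcy := (hcosp y hyJ).ne'
  refine ⟨dui hψ.c0 cV cVy (fun x hx y hy => hG.dy _ _ (hin x hx y hy)) hyJ,
    dui hψ.c0 cVy cVyy (fun x hx y hy => hG.dyy _ _ (hin x hx y hy)) hyJ, (hae y hy).1.le, ?_⟩
  have hTa := (hae y hy).2
  have hsl : ∀ w : ℝ → ℝ → ℝ, ContinuousOn (Function.uncurry w) (Icc 0 π ×ˢ Ioo 0 (π/2)) → 
      ContinuousOn (fun x => w x y) (Icc 0 π) := by
    intro w hw
    have : ContinuousOn (fun x : ℝ => (x, y)) (Icc 0 π) := by fun_prop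
    exact hw.comp this (fun x hx => ⟨hx, hyJ⟩)
  have hlin : ∀ x, HasDerivAt (fun x => a + β * x) β x := fun x => by
    simpa using ((hasDerivAt_id x).const_mul β).const_add a
  have hib := ibp (g := fun x => V (a + β * x) y) (g1 := fun x => Vx (a + β * x) y * β)
    (g11 := fun x => Vxx (a + β * x) y * β * β)
    (fun x hx => HasDerivAt.comp x (hG.dx _ _ (hin x hx y hyJ)) (hlin x))
    (fun x hx => (HasDerivAt.comp x (hG.dxx _ _ (hin x hx y hyJ)) (hlin x)).mul_const β)
    (((hsl _ cVxx).mul_const β).mul_const β) hψ.d1 hψ.d2 hψ.c2 hψ.z0 hψ.zp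
  have hpull : ∫ x in (0:ℝ)..π, Vxx (a + β * x) y * β * β * ψ x = β ^ 2 * ∫ x in (0:ℝ)..π, Vxx (a + β * x) y * ψ x := by
    rw [← intervalIntegral.integral_const_mul]; congr 1; ext x; ring
  rw [hpull] at hib
  have ii : ∀ w : ℝ → ℝ → ℝ, ContinuousOn (Function.uncurry w) (Icc 0 π ×ˢ Ioo 0 (π/2)) → 
      IntervalIntegrable (fun x => w x y * ψ x) MeasureTheory.volume 0 π := by
    intro w hw
    apply ContinuousOn.intervalIntegrable
    rw [uIcc_of_le hpi.le]
    exact (hsl w hw).mul hψ.c0.continuousOn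
  have hcomb : (∫ x in (0:ℝ)..π, Vyy (a + β * x) y * ψ x) - Real.tan y * ∫ x in (0:ℝ)..π, Vy (a + β * x) y * ψ x
      = -(M / Real.cos y ^ 2) * (∫ x in (0:ℝ)..π, Vxx (a + β * x) y * ψ x) - lam * ∫ x in (0:ℝ)..π, V (a + β * x) y * ψ x := by
    rw [← intervalIntegral.integral_const_mul, ← intervalIntegral.integral_const_mul, ← intervalIntegral.integral_const_mul,
      ← intervalIntegral.integral_sub (ii _ cVyy) ((ii _ cVy).const_mul _),
      ← intervalIntegral.integral_sub ((ii _ cVxx).const_mul _) ((ii _ cV).const_mul _)]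
    apply intervalIntegral.integral_congr
    intro x hx
    rw [uIcc_of_le hpi.le] at hx
    have := hG.pde _ _ (hin x hx y hyJ)
    simp only
    linear_combination ψ x * this
  rw [hcomb]
  have hX : ∫ x in (0:ℝ)..π, Vxx (a + β * x) y * ψ x = ((∫ x in (0:ℝ)..π, V (a + β * x) y * ψ2 x) - 
      (V (a + β * π) y * ψ1 π - V (a + β * 0) y * ψ1 0)) / β ^ 2 := by
    rw [← hib]; field_simp
  have : T (a, y) = -(M / Real.cos y ^ 2) * (∫ x in (0:ℝ)..π, Vxx (a + β * x) y * ψ x) - lam * (∫ x in (0:ℝ)..π, V (a + β * x) y * ψ x)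
      + (M / Real.cos y ^ 2 * (∫ x in (0:ℝ)..π, V x y * ψ2 x)
        + lam * ∫ x in (0:ℝ)..π, V x y * ψ x) := by
    simp only [hT]
    rw [hX, ← hβ]
    field_simp
  rw [← this]
  exact hTa.le

end Blow

namespace Blow
open Topology

lemma hasDerivAt_comp_max {g g1 : ℝ → ℝ} (hg : ∀ x, HasDerivAt g (g1 x) x) (h0 : g1 0 = 0) (t : ℝ) :
    HasDerivAt (fun t => g (max t 0)) (g1 (max t 0)) t := by
  rcases lt_trichotomy t 0 with h | h | h
  · rw [max_eq_right h.le, h0]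
    have : (fun t => g (max t 0)) =ᶠ[𝓝 t] fun _ => g 0 := by
      filter_upwards [eventually_lt_nhds h] with x hx
      rw [max_eq_right hx.le]
    exact (hasDerivAt_const t (g 0)).congr_of_eventuallyEq this
  · subst h
    simp only [max_self]
    have h1 : HasDerivWithinAt (fun t => g (max t 0)) (g1 0) (Iic 0) 0 := by
      rw [h0]
      refine (hasDerivWithinAt_const 0 (Iic 0) (g 0)).congr (fun x hx => ?_) (by simp)
      rw [max_eq_right hx]
    have h2 : HasDerivWithinAt (fun t => g (max t 0)) (g1 0) (Ici 0) 0 := by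
      refine (hg 0).hasDerivWithinAt.congr (fun x hx => ?_) (by simp)
      rw [max_eq_left hx]
    have := h1.union h2
    rwa [Iic_union_Ici, hasDerivWithinAt_univ] at this
  · rw [max_eq_left h.le]
    have : (fun t => g (max t 0)) =ᶠ[𝓝 t] g := by
      filter_upwards [eventually_gt_nhds h] with x hx
      rw [max_eq_left hx.le]
    exact (hg t).congr_of_eventuallyEq this

lemma exU {ε : ℝ} (hε : 0 < ε) : ∃ U U1 U2 : ℝ → ℝ,
    (∀ v, HasDerivAt U (U1 v) v) ∧ (∀ v, HasDerivAt U1 (U2 v) v) ∧ Continuous U2 ∧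
    (∀ v ≤ ε, U v = 0 ∧ U1 v = 0 ∧ U2 v = 0) ∧ (∀ v, U1 v ≤ 1) ∧ (∀ v, 0 ≤ U2 v) ∧
    (∀ v, 0 ≤ v → |U v - v| ≤ 2 * ε) := by
  have hD : ∀ P : ℝ, 0 < P ^ 2 + P + 1 := fun P => by nlinarith [sq_nonneg (P + 1), sq_nonneg P]
  set g : ℝ → ℝ := fun P => P ^ 3 / (P ^ 2 + P + 1) with hg
  set g1 : ℝ → ℝ := fun P => (P ^ 4 + 2 * P ^ 3 + 3 * P ^ 2) / (P ^ 2 + P + 1) ^ 2 with hg1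
  set g2 : ℝ → ℝ := fun P => (6 * P ^ 2 + 6 * P) / (P ^ 2 + P + 1) ^ 3 with hg2
  have d0 : ∀ P, HasDerivAt (fun P : ℝ => P ^ 2 + P + 1) (2 * P + 1) P := by
    intro P
    have := (((hasDerivAt_id P).pow 2).add (hasDerivAt_id P)).add_const 1
    refine this.congr_deriv ?_
    simp
  have d1 : ∀ P, HasDerivAt g (g1 P) P := by
    intro P
    have := (((hasDerivAt_id P).pow 3).div (d0 P) (hD P).ne')
    refine this.congr_deriv ?_
    have := (hD P).ne'
    simp [hg1]
    ring
  have d2 : ∀ P, HasDerivAt g1 (g2 P) P := by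
    intro P
    have a1 : HasDerivAt (fun P : ℝ => P ^ 4 + 2 * P ^ 3 + 3 * P ^ 2) (4 * P ^ 3 + 6 * P ^ 2 + 6 * P) P := by
      have := (((hasDerivAt_id P).pow 4).add (((hasDerivAt_id P).pow 3).const_mul 2)).add 
        (((hasDerivAt_id P).pow 2).const_mul 3)
      refine this.congr_deriv ?_
      simp; ring
    have := a1.div ((d0 P).pow 2) (pow_ne_zero 2 (hD P).ne')
    refine this.congr_deriv ?_
    have := (hD P).ne'
    simp only [hg2, Pi.pow_apply]
    rw [div_eq_div_iff (by positivity) (by positivity)]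
    push_cast
    ring
  have hlin : ∀ v, HasDerivAt (fun v => (v - ε) / ε) (1 / ε) v := fun v => 
    ((hasDerivAt_id v).sub_const ε).div_const ε
  refine ⟨fun v => ε * g (max ((v - ε) / ε) 0), fun v => g1 (max ((v - ε) / ε) 0), 
    fun v => g2 (max ((v - ε) / ε) 0) * (1 / ε), ?_, ?_, ?_, ?_, ?_, ?_, ?_⟩
  · intro v
    have := (HasDerivAt.comp v (hasDerivAt_comp_max d1 (by simp [hg1]) ((v - ε) / ε)) (hlin v)).const_mul ε
    refine this.congr_deriv ?_
    field_simp
  · intro v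
    exact (HasDerivAt.comp v (hasDerivAt_comp_max d2 (by simp [hg2]) ((v - ε) / ε)) (hlin v))
  · have : Continuous g2 := by
      simp only [hg2]
      apply Continuous.div (by fun_prop) (by fun_prop)
      intro P; exact pow_ne_zero 3 (hD P).ne'
    exact (this.comp (by fun_prop)).mul continuous_const
  · intro v hv
    have : max ((v - ε) / ε) 0 = 0 := max_eq_right (div_nonpos_of_nonpos_of_nonneg (by linarith) hε.le)
    simp [this, hg, hg1, hg2]
  · intro v
    simp only [hg1]
    have hP : 0 ≤ max ((v - ε) / ε) 0 := le_max_right _ _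
    set P := max ((v - ε) / ε) 0
    rw [div_le_one (pow_pos (hD P) 2)]
    nlinarith
  · intro v
    simp only [hg2]
    have hP : 0 ≤ max ((v - ε) / ε) 0 := le_max_right _ _
    set P := max ((v - ε) / ε) 0
    have := hD P
    positivity
  · intro v hv
    simp only [hg]
    rcases le_total v ε with h | h
    · have : max ((v - ε) / ε) 0 = 0 := max_eq_right (div_nonpos_of_nonpos_of_nonneg (by linarith) hε.le)
      rw [this, abs_le]
      constructor <;> simp <;> linarith
    · have hm : max ((v - ε) / ε) 0 = (v - ε) / ε := max_eq_left (div_nonneg (by linarith) hε.le)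
      rw [hm]
      set P := (v - ε) / ε with hP
      have hP0 : 0 ≤ P := div_nonneg (by linarith) hε.le
      have hv' : v = ε + ε * P := by rw [hP]; field_simp; ring
      have e : ε * (P ^ 3 / (P ^ 2 + P + 1)) - v = - (ε + ε * ((P ^ 2 + P) / (P ^ 2 + P + 1))) := by
        rw [hv']
        have := (hD P).ne'
        field_simp
        ring
      have h1 : (P ^ 2 + P) / (P ^ 2 + P + 1) ≤ 1 := by
        rw [div_le_one (hD P)]; linarith
      have h2 : 0 ≤ (P ^ 2 + P) / (P ^ 2 + P + 1) := by have := hD P; positivity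
      rw [e, abs_neg, abs_of_nonneg (by positivity)]
      nlinarith

lemma isOpen_Om (s : ℝ) : IsOpen (Om s) := by
  have h1 : IsOpen {p : ℝ × ℝ | p.1 ∈ Ioo 0 π} := isOpen_Ioo.preimage continuous_fst
  have h2 : IsOpen {p : ℝ × ℝ | p.2 ∈ Ioo (-(π/2)) (π/2)} := isOpen_Ioo.preimage continuous_snd
  have h3 : IsClosed {p : ℝ × ℝ | p.1 ≤ s * π ∧ p.2 = 0} := 
    (isClosed_le continuous_fst continuous_const).inter (isClosed_eq continuous_snd continuous_const)
  exact h1.inter (h2.inter h3.isOpen_compl)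

variable {M lam s : ℝ} {V Vx Vxx Vy Vyy : ℝ → ℝ → ℝ}

lemma Good.nonneg (hG : Good M lam s V Vx Vxx Vy Vyy) (x y : ℝ) : 0 ≤ V x y := by
  by_cases h : (x, y) ∈ Om s
  · exact (hG.pos x y h).le
  · exact (hG.zero x y h).ge

lemma Good.glue (hG : Good M lam s V Vx Vxx Vy Vyy) {ε : ℝ} (hε : 0 < ε) {w : ℝ → ℝ → ℝ} 
    (h1 : ContinuousOn (Function.uncurry w) (Om s)) (h2 : ∀ x y, V x y ≤ ε → w x y = 0) :
    Continuous (Function.uncurry w) := by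
  rw [continuous_iff_continuousAt]
  rintro ⟨x, y⟩
  by_cases h : (x, y) ∈ Om s
  · exact h1.continuousAt ((isOpen_Om s).mem_nhds h)
  · have hV : Function.uncurry V (x, y) < ε := by
      change V x y < ε
      rw [hG.zero x y h]; exact hε
    have : Function.uncurry w =ᶠ[𝓝 (x, y)] fun _ => 0 := by
      filter_upwards [hG.cont.continuousAt.eventually_lt_const hV] with p hp
      exact h2 p.1 p.2 hp.le
    exact continuousAt_const.congr this.symm

lemma hasDerivAt_of_small {f W : ℝ → ℝ} {t ε : ℝ} (hW : Continuous W) (ht : W t < ε) 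
    (h2 : ∀ r, W r ≤ ε → f r = 0) : HasDerivAt f 0 t := by
  have : f =ᶠ[𝓝 t] fun _ => 0 := by
    filter_upwards [hW.continuousAt.eventually_lt_const ht] with p hp
    exact h2 p hp.le
  exact (hasDerivAt_const t 0).congr_of_eventuallyEq this

lemma visc2 (hG : Good M lam s V Vx Vxx Vy Vyy) (hM : 0 ≤ M) (hlam : 0 ≤ lam)
    {ψ ψ1 ψ2 : ℝ → ℝ} (hψ : Wt ψ ψ1 ψ2) (hnn : ∀ x ∈ Icc 0 π, 0 ≤ ψ x)
    {c : ℝ} (hc : c ∈ Ioo (-(π/2)) (π/2)) :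
    Visc (fun y => ∫ x in (0:ℝ)..π, V x y * ψ x)
      (fun y => M / Real.cos y ^ 2 * (∫ x in (0:ℝ)..π, V x y * ψ2 x)
        + lam * ∫ x in (0:ℝ)..π, V x y * ψ x) c := by
  have hpi := Real.pi_pos
  obtain ⟨hc0, hc1⟩ := hc
  set ρ := min ((c + π/2) / 2) ((π/2 - c) / 2) with hρ
  have hρ0 : 0 < ρ := lt_min (by linarith) (by linarith)
  have hρ1 : ρ ≤ (c + π/2) / 2 := min_le_left _ _
  have hρ2 : ρ ≤ (π/2 - c) / 2 := min_le_right _ _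
  have hJ : ∀ y ∈ Icc (c - ρ) (c + ρ), y ∈ Ioo (-(π/2)) (π/2) := fun y hy =>
    ⟨by linarith [hy.1], by linarith [hy.2]⟩
  have hcosp : ∀ y ∈ Ioo (-(π/2)) (π/2), 0 < Real.cos y := fun y hy =>
    Real.cos_pos_of_mem_Ioo hy
  have hcc := hcosp c ⟨hc0, hc1⟩
  have F0 := contF hG.cont hψ.c0
  have F2 := contF hG.cont hψ.c2
  refine visc_of_approx hρ0 hcc.ne' ?_ ?_
  · refine ContinuousAt.add (ContinuousAt.mul ?_ F2.continuousAt) (F0.continuousAt.const_mul _)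
    have := hcc.ne'
    fun_prop (disch := positivity)
  intro η hη
  -- bounds
  obtain ⟨C0, hC0⟩ := isCompact_Icc.exists_bound_of_continuousOn (s := Icc 0 π) hψ.c0.continuousOn
  obtain ⟨C2, hC2⟩ := isCompact_Icc.exists_bound_of_continuousOn (s := Icc 0 π) hψ.c2.continuousOn
  have hMc : ContinuousOn (fun y => M / Real.cos y ^ 2) (Icc (c - ρ) (c + ρ)) := by
    apply ContinuousOn.div (by fun_prop) (by fun_prop)
    intro y hy; exact pow_ne_zero 2 (hcosp y (hJ y hy)).ne'
  obtain ⟨K, hK⟩ := isCompact_Icc.exists_bound_of_continuousOn hMc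
  have hC0n : 0 ≤ C0 := (norm_nonneg _).trans (hC0 0 ⟨le_rfl, hpi.le⟩)
  have hC2n : 0 ≤ C2 := (norm_nonneg _).trans (hC2 0 ⟨le_rfl, hpi.le⟩)
  have hKn : 0 ≤ K := (norm_nonneg _).trans (hK c ⟨by linarith, by linarith⟩)
  set B := 2 * C0 * π + K * (2 * C2 * π) + 1 with hB
  have hBpos : 0 < B := by positivity
  set ε := η / B with hε'
  have hε : 0 < ε := by positivity
  have hεB : ε * B = η := by rw [hε']; field_simp
  obtain ⟨U, U1, U2, hU, hU1, hU2c, hU0, hU1le, hU2n, hUv⟩ := exU hε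
  have hUc : Continuous U := continuous_iff_continuousAt.2 fun v => (hU v).continuousAt
  have hU1c : Continuous U1 := continuous_iff_continuousAt.2 fun v => (hU1 v).continuousAt
  have cu : Continuous (Function.uncurry fun x y => U (V x y)) := hUc.comp hG.cont
  have cu1 : Continuous (Function.uncurry fun x y => U1 (V x y)) := hU1c.comp hG.cont
  have cu2 : Continuous (Function.uncurry fun x y => U2 (V x y)) := hU2c.comp hG.cont
  have cuy : Continuous (Function.uncurry fun x y => U1 (V x y) * Vy x y) := 
    hG.glue hε (cu1.continuousOn.mul hG.cy) (fun x y h => by simp [(hU0 _ h).2.1])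
  have cuyy : Continuous (Function.uncurry fun x y => U2 (V x y) * Vy x y * Vy x y + U1 (V x y) * Vyy x y) := 
    hG.glue hε (((cu2.continuousOn.mul hG.cy).mul hG.cy).add (cu1.continuousOn.mul hG.cyy)) 
      (fun x y h => by simp [(hU0 _ h).2.1, (hU0 _ h).2.2])
  have cuxx : Continuous (Function.uncurry fun x y => U2 (V x y) * Vx x y * Vx x y + U1 (V x y) * Vxx x y) := 
    hG.glue hε (((cu2.continuousOn.mul hG.cx).mul hG.cx).add (cu1.continuousOn.mul hG.cxx)) 
      (fun x y h => by simp [(hU0 _ h).2.1, (hU0 _ h).2.2])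
  have slx : ∀ {w : ℝ → ℝ → ℝ}, Continuous (Function.uncurry w) → ∀ y, Continuous (fun x => w x y) := by
    intro w hw y
    exact hw.comp (f := fun x : ℝ => (x, y)) (by fun_prop)
  have sly : ∀ {w : ℝ → ℝ → ℝ}, Continuous (Function.uncurry w) → ∀ x, Continuous (fun y => w x y) := by
    intro w hw x
    exact hw.comp (f := fun y : ℝ => (x, y)) (by fun_prop)
  have dUy : ∀ x y, HasDerivAt (fun t => U (V x t)) (U1 (V x y) * Vy x y) y := by
    intro x y
    by_cases h : (x, y) ∈ Om s
    · exact HasDerivAt.comp y (hU _) (hG.dy x y h)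
    · have hV := hG.zero x y h
      rw [hV, (hU0 0 hε.le).2.1, zero_mul]
      exact hasDerivAt_of_small (sly hG.cont x) (by rw [hV]; exact hε) (fun r hr => (hU0 _ hr).1)
  have dUyy : ∀ x y, HasDerivAt (fun t => U1 (V x t) * Vy x t) (U2 (V x y) * Vy x y * Vy x y + U1 (V x y) * Vyy x y) y := by
    intro x y
    by_cases h : (x, y) ∈ Om s
    · exact (HasDerivAt.comp y (hU1 _) (hG.dy x y h)).mul (hG.dyy x y h)
    · have hV := hG.zero x y h
      rw [hV, (hU0 0 hε.le).2.1, (hU0 0 hε.le).2.2, zero_mul, zero_mul, zero_mul, add_zero]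
      exact hasDerivAt_of_small (sly hG.cont x) (by rw [hV]; exact hε) (fun r hr => by simp [(hU0 _ hr).2.1])
  have dUx : ∀ x y, HasDerivAt (fun t => U (V t y)) (U1 (V x y) * Vx x y) x := by
    intro x y
    by_cases h : (x, y) ∈ Om s
    · exact HasDerivAt.comp x (hU _) (hG.dx x y h)
    · have hV := hG.zero x y h
      rw [hV, (hU0 0 hε.le).2.1, zero_mul]
      exact hasDerivAt_of_small (slx hG.cont y) (by rw [hV]; exact hε) (fun r hr => (hU0 _ hr).1)
  have dUxx : ∀ x y, HasDerivAt (fun t => U1 (V t y) * Vx t y) (U2 (V x y) * Vx x y * Vx x y + U1 (V x y) * Vxx x y) x := by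
    intro x y
    by_cases h : (x, y) ∈ Om s
    · exact (HasDerivAt.comp x (hU1 _) (hG.dx x y h)).mul (hG.dxx x y h)
    · have hV := hG.zero x y h
      rw [hV, (hU0 0 hε.le).2.1, (hU0 0 hε.le).2.2, zero_mul, zero_mul, zero_mul, add_zero]
      exact hasDerivAt_of_small (slx hG.cont y) (by rw [hV]; exact hε) (fun r hr => by simp [(hU0 _ hr).2.1])
  refine ⟨fun y => ∫ x in (0:ℝ)..π, U (V x y) * ψ x, fun y => ∫ x in (0:ℝ)..π, U1 (V x y) * Vy x y * ψ x,
    fun y => ∫ x in (0:ℝ)..π, (U2 (V x y) * Vy x y * Vy x y + U1 (V x y) * Vyy x y) * ψ x, fun y hy => ?_⟩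
  have hyJ := hJ y hy
  have hcy := (hcosp y hyJ).ne'
  refine ⟨dui hψ.c0 (u := fun x y => U (V x y)) (u2 := fun x y => U1 (V x y) * Vy x y) cu.continuousOn cuy.continuousOn (fun x hx y hy => dUy x y) hyJ,
    dui hψ.c0 (u := fun x y => U1 (V x y) * Vy x y) 
      (u2 := fun x y => (U2 (V x y) * Vy x y * Vy x y + U1 (V x y) * Vyy x y)) 
      cuy.continuousOn cuyy.continuousOn (fun x hx y hy => dUyy x y) hyJ, ?_, ?_⟩
  · have iu : IntervalIntegrable (fun x => U (V x y) * ψ x) MeasureTheory.volume 0 π :=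
      ((slx cu y).mul hψ.c0).intervalIntegrable _ _
    have iv : IntervalIntegrable (fun x => V x y * ψ x) MeasureTheory.volume 0 π :=
      ((slx hG.cont y).mul hψ.c0).intervalIntegrable _ _
    rw [← intervalIntegral.integral_sub iu iv]
    have := intervalIntegral.norm_integral_le_of_norm_le_const (a := 0) (b := π) 
      (f := fun x => U (V x y) * ψ x - V x y * ψ x) (C := 2 * ε * C0) (by
        intro x hx
        rw [uIoc_of_le hpi.le] at hx
        rw [← sub_mul, norm_mul]
        exact mul_le_mul (hUv _ (hG.nonneg x y)) (hC0 x (Ioc_subset_Icc_self hx)) (norm_nonneg _) (by positivity))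
    rw [Real.norm_eq_abs] at this
    refine this.trans ?_
    rw [sub_zero, abs_of_pos hpi, ← hεB, hB]
    have : 0 ≤ ε * (K * (2 * C2 * π) + 1) := by positivity
    nlinarith
  · have hib := ibp (g := fun x => U (V x y)) (g1 := fun x => U1 (V x y) * Vx x y)
      (g11 := fun x => U2 (V x y) * Vx x y * Vx x y + U1 (V x y) * Vxx x y)
      (fun x hx => dUx x y) (fun x hx => dUxx x y) (slx cuxx y).continuousOn hψ.d1 hψ.d2 hψ.c2 hψ.z0 hψ.zp
    have hedge0 : V 0 y = 0 := hG.zero _ _ (by simp [Om])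
    have hedgep : V π y = 0 := hG.zero _ _ (by simp [Om])
    rw [hedge0, hedgep, (hU0 0 hε.le).1] at hib
    simp only [zero_mul, sub_zero] at hib
    have I : ∀ {w : ℝ → ℝ → ℝ}, Continuous (Function.uncurry w) → 
        IntervalIntegrable (fun x => w x y * ψ x) MeasureTheory.volume 0 π := fun hw =>
      ((slx hw y).mul hψ.c0).intervalIntegrable _ _
    have I2 : ∀ {w : ℝ → ℝ → ℝ}, Continuous (Function.uncurry w) → 
        IntervalIntegrable (fun x => w x y * ψ2 x) MeasureTheory.volume 0 π := fun hw =>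
      ((slx hw y).mul hψ.c2).intervalIntegrable _ _
    have cUV : Continuous (Function.uncurry fun x y => U1 (V x y) * V x y) := cu1.mul hG.cont
    -- main inequality
    have main : 0 ≤ (∫ x in (0:ℝ)..π, (U2 (V x y) * Vy x y * Vy x y + U1 (V x y) * Vyy x y) * ψ x)
        - Real.tan y * (∫ x in (0:ℝ)..π, U1 (V x y) * Vy x y * ψ x)
        + M / Real.cos y ^ 2 * (∫ x in (0:ℝ)..π, (U2 (V x y) * Vx x y * Vx x y + U1 (V x y) * Vxx x y) * ψ x)
        + lam * ∫ x in (0:ℝ)..π, U1 (V x y) * V x y * ψ x := by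
      rw [← intervalIntegral.integral_const_mul, ← intervalIntegral.integral_const_mul, 
        ← intervalIntegral.integral_const_mul, ← intervalIntegral.integral_sub (I cuyy) ((I cuy).const_mul _),
        ← intervalIntegral.integral_add ((I cuyy).sub ((I cuy).const_mul _)) ((I cuxx).const_mul _),
        ← intervalIntegral.integral_add (((I cuyy).sub ((I cuy).const_mul _)).add ((I cuxx).const_mul _))
          ((I cUV).const_mul _)]
      apply intervalIntegral.integral_nonneg hpi.le
      intro x hx
      have e : (U2 (V x y) * Vy x y * Vy x y + U1 (V x y) * Vyy x y) * ψ x - Real.tan y * (U1 (V x y) * Vy x y * ψ x)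
          + M / Real.cos y ^ 2 * ((U2 (V x y) * Vx x y * Vx x y + U1 (V x y) * Vxx x y) * ψ x)
          + lam * (U1 (V x y) * V x y * ψ x) = 
          (U2 (V x y) * (Vy x y ^ 2 + M / Real.cos y ^ 2 * Vx x y ^ 2) + U1 (V x y) *
            (Vyy x y - Real.tan y * Vy x y + M * Vxx x y / Real.cos y ^ 2 + lam * V x y)) * ψ x := by ring
      rw [e]
      refine mul_nonneg ?_ (hnn x hx)
      have e2 : U1 (V x y) * (Vyy x y - Real.tan y * Vy x y + M * Vxx x y / Real.cos y ^ 2 + lam * V x y) = 0 := by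
        by_cases h : (x, y) ∈ Om s
        · rw [hG.pde x y h, mul_zero]
        · rw [hG.zero x y h, (hU0 0 hε.le).2.1, zero_mul]
      rw [e2, add_zero]
      have := hU2n (V x y)
      positivity
    rw [hib] at main
    have b1 : ∫ x in (0:ℝ)..π, U1 (V x y) * V x y * ψ x ≤ ∫ x in (0:ℝ)..π, V x y * ψ x := by
      apply intervalIntegral.integral_mono_on hpi.le (I cUV) (I hG.cont)
      intro x hx
      have := hG.nonneg x y
      have h2 := hnn x hx
      have h3 := hU1le (V x y)
      have : U1 (V x y) * V x y ≤ V x y := by nlinarith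
      exact mul_le_mul_of_nonneg_right this h2
    have b2 : |(∫ x in (0:ℝ)..π, U (V x y) * ψ2 x) - ∫ x in (0:ℝ)..π, V x y * ψ2 x| ≤ 2 * ε * C2 * π := by
      rw [← intervalIntegral.integral_sub (I2 cu) (I2 hG.cont)]
      have := intervalIntegral.norm_integral_le_of_norm_le_const (a := 0) (b := π) 
        (f := fun x => U (V x y) * ψ2 x - V x y * ψ2 x) (C := 2 * ε * C2) (by
          intro x hx
          rw [uIoc_of_le hpi.le] at hx
          rw [← sub_mul, norm_mul]
          exact mul_le_mul (hUv _ (hG.nonneg x y)) (hC2 x (Ioc_subset_Icc_self hx)) (norm_nonneg _) (by positivity))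
      rwa [Real.norm_eq_abs, sub_zero, abs_of_pos hpi] at this
    have b3 := hK y hy
    rw [Real.norm_eq_abs, abs_of_nonneg (by positivity)] at b3
    have b4 := mul_le_mul_of_nonneg_left b1 hlam
    set X := ∫ x in (0:ℝ)..π, U (V x y) * ψ2 x
    set Y := ∫ x in (0:ℝ)..π, V x y * ψ2 x
    have b5 : M / Real.cos y ^ 2 * (X - Y) ≤ K * (2 * ε * C2 * π) := by
      have hnn : 0 ≤ M / Real.cos y ^ 2 := by positivity
      calc M / Real.cos y ^ 2 * (X - Y) ≤ M / Real.cos y ^ 2 * (2 * ε * C2 * π) := 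
            mul_le_mul_of_nonneg_left ((le_abs_self _).trans b2) hnn
        _ ≤ _ := mul_le_mul_of_nonneg_right b3 (by positivity)
    have b6 : K * (2 * ε * C2 * π) ≤ η := by
      rw [← hεB, hB]
      have : 0 ≤ ε * (2 * C0 * π + 1) := by positivity
      nlinarith
    simp only
    nlinarith

end Blow

namespace Blow
open Topology

lemma comp {f P q q1 q2 : ℝ → ℝ} (hf : Continuous f)
    (hv : ∀ c ∈ Ioo 0 (π/2), Visc f (fun y => P y * f y) c)
    (hq : ContinuousOn q (Icc 0 (π/2))) (hqpos : ∀ y ∈ Icc 0 (π/2), 0 < q y)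
    (hd : ∀ y ∈ Ioo 0 (π/2), HasDerivAt q (q1 y) y ∧ HasDerivAt q1 (q2 y) y)
    (hc2 : ContinuousOn q2 (Ioo 0 (π/2)))
    (neg : ∀ c ∈ Ioo 0 (π/2), q2 c - tan c * q1 c + P c * q c < 0)
    (hfe : f (π/2) ≤ 0) {A : ℝ} (hA : 0 ≤ A) (h0 : f 0 ≤ A * q 0) :
    ∀ y ∈ Icc 0 (π/2), f y ≤ A * q y := by
  have hpi := Real.pi_pos
  obtain ⟨c, hc, hmax⟩ := isCompact_Icc.exists_isMaxOn (s := Icc 0 (π/2))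
    ⟨0, ⟨le_rfl, by positivity⟩⟩
    (f := fun y => f y / q y) (hf.continuousOn.div hq (fun y hy => (hqpos y hy).ne'))
  set T := f c / q c with hT
  have hm : ∀ y ∈ Icc 0 (π/2), f y ≤ T * q y := fun y hy => by
    have := hmax hy
    have this : f y / q y ≤ T := this
    rwa [div_le_iff₀ (hqpos y hy)] at this
  by_cases hTA : T ≤ A
  · intro y hy
    exact (hm y hy).trans (mul_le_mul_of_nonneg_right hTA (hqpos y hy).le)
  exfalso
  push Not at hTA
  have hfc : f c = T * q c := by
    rw [hT, div_mul_cancel₀ _ (hqpos c hc).ne']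
  have hT0 : 0 < T := lt_of_le_of_lt hA hTA
  have hc0 : c ≠ 0 := by
    rintro rfl
    have := hqpos 0 hc
    nlinarith
  have hc1 : c ≠ π/2 := by
    rintro rfl
    have := hqpos _ hc
    nlinarith [mul_pos hT0 this]
  have hcI : c ∈ Ioo 0 (π/2) := ⟨lt_of_le_of_ne hc.1 (Ne.symm hc0), lt_of_le_of_ne hc.2 hc1⟩
  have hnh : Ioo 0 (π/2) ∈ 𝓝 c := isOpen_Ioo.mem_nhds hcI
  have := hv c hcI (fun y => T * q y) (fun y => T * q1 y) (fun y => T * q2 y)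
    (by filter_upwards [hnh] with y hy
        exact ⟨(hd y hy).1.const_mul T, (hd y hy).2.const_mul T⟩)
    ((hc2.continuousAt hnh).const_mul T)
    (by filter_upwards [hnh] with y hy
        have := hm y (Ioo_subset_Icc_self hy)
        linarith)
  simp only [hfc] at this
  have h2 := neg c hcI
  nlinarith [mul_neg_of_pos_of_neg hT0 h2]

/-- exponential decay of higher modes -/
lemma decay {f : ℝ → ℝ} {m lam k : ℝ} (hf : Continuous f) (hm : 4 ≤ m) (hk : 2 ≤ k)
    (hlam : lam ≤ (m+1)*(m+2)) (hlam0 : 0 ≤ lam)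
    (hv : ∀ c ∈ Ioo 0 (π/2), Visc f (fun y => (lam - m^2*k^2/cos y^2) * f y) c)
    (hfe : f (π/2) ≤ 0) : ∀ y ∈ Icc 0 (π/2), f y ≤ |f 0| * exp (-(k*m/2*y)) := by
  have d : ∀ y, HasDerivAt (fun y => exp (-(k*m/2*y))) (-(k*m/2) * exp (-(k*m/2*y))) y := fun y => by
    have := (((hasDerivAt_id y).const_mul (k*m/2)).neg).exp
    refine this.congr_deriv ?_
    simp; ring
  refine comp hf hv (q1 := fun y => -(k*m/2) * exp (-(k*m/2*y)))
    (q2 := fun y => -(k*m/2) * (-(k*m/2) * exp (-(k*m/2*y)))) (by fun_prop)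
    (fun y _ => exp_pos _) (fun y _ => ⟨d y, (d y).const_mul _⟩) (by fun_prop) ?_ hfe (abs_nonneg _) ?_
  · intro c hc
    have hcos : 0 < cos c := cos_pos_of_mem_Ioo ⟨by linarith [hc.1, pi_pos], hc.2⟩
    have he := exp_pos (-(k*m/2*c))
    have key : (k*m/2)^2 + k*m/2*tan c + (lam - m^2*k^2/cos c^2) < 0 := by
      have : (k*m/2)^2 + k*m/2*tan c + (lam - m^2*k^2/cos c^2) =
        ((k*m/2)^2 * cos c^2 + k*m/2*(sin c*cos c) + lam * cos c^2 - m^2*k^2)/cos c^2 := by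
        rw [tan_eq_sin_div_cos]; field_simp; ring
      rw [this]
      apply div_neg_of_neg_of_pos _ (by positivity)
      have h1 := sin_sq_add_cos_sq c
      have hc1 : cos c^2 ≤ 1 := by nlinarith [sq_nonneg (sin c)]
      have hs : sin c * cos c ≤ 1/2 := by nlinarith [sq_nonneg (sin c - cos c)]
      have hkm : 0 < k*m/2 := by positivity
      have e1 : (k*m/2)^2 * cos c^2 ≤ (k*m/2)^2 := by nlinarith [sq_nonneg (k*m/2)]
      have e2 : k*m/2*(sin c*cos c) ≤ k*m/2*(1/2) := mul_le_mul_of_nonneg_left hs hkm.le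
      have e3 : lam * cos c^2 ≤ lam := by nlinarith
      have hkm8 : 2*m ≤ k*m := by nlinarith
      nlinarith [mul_le_mul hkm8 hkm8 (by linarith) (by linarith)]
    have := mul_neg_of_pos_of_neg he key
    nlinarith
  · simp [le_abs_self]

lemma bd_aux {m lam δ α β a t C : ℝ} (hm1 : 1 ≤ m) (hδ0 : 0 ≤ δ) (hδ : δ < 1)
    (hlam : lam ≤ m^2 + m + δ * (2*m+2)) (hβ : β = (1-δ)/2) (hβ0 : 0 < β) (hβ1 : β ≤ 1/2) (hα : α = 1 - β)
    (hα0 : 1/2 ≤ α) (ha0 : 0 < a) (ha1 : a ≤ 1) (ham : a^2 * m = β^2/64) (h2 : 0 ≤ t) (hs1 : t ≤ 1)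
    (hs : C = 1 - t^2) (hC : 0 ≤ C) :
    lam - m^2 - m - (2*m+2)*α*(t/(t + a)) - α*β*C/(t+a)^2 ≤ - (α * β * C / 8) := by
  have hu : 0 < t + a := by positivity
  obtain ⟨u, hu'⟩ : ∃ u, u = t + a := ⟨_, rfl⟩
  rw [← hu'] at hu ⊢
  have hu2 : u ≤ 2 := by linarith
  have e1 : (2*m+2)*(u*(δ*a - β*t)) ≤ α*β*C/2 := by
    by_cases ht : δ*a ≤ β*t
    · have : u*(δ*a - β*t) ≤ 0 := mul_nonpos_of_nonneg_of_nonpos hu.le (by linarith)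
      have h3 : (2*m+2)*(u*(δ*a - β*t)) ≤ 0 := mul_nonpos_of_nonneg_of_nonpos (by positivity) this
      have : 0 ≤ α*β*C/2 := by positivity
      linarith
    · push Not at ht
      have htb : β*t ≤ a := by nlinarith
      have hub : β*u ≤ 3/2*a := by rw [hu']; nlinarith
      have ham2 : a^2 ≤ β^2/64 := by nlinarith [sq_nonneg a]
      have ht8 : t ≤ 1/8 := by
        have : a ≤ β/8 := by nlinarith
        nlinarith
      have hc : 1/2 ≤ C := by nlinarith
      have h4 : u*(δ*a - β*t) ≤ u*a := by
        apply mul_le_mul_of_nonneg_left _ hu.le; nlinarith [mul_nonneg hβ0.le h2]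
      have h5 : β*((2*m+2)*(u*a)) ≤ β*(β/8) := by
        have : β*((2*m+2)*(u*a)) = (2*m+2)*((β*u)*a) := by ring
        rw [this]
        have h6 : (β*u)*a ≤ 3/2*a*a := mul_le_mul_of_nonneg_right hub ha0.le
        have h7 : (2*m+2)*((β*u)*a) ≤ (4*m)*(3/2*a*a) :=
          mul_le_mul (by linarith) h6 (by positivity) (by positivity)
        nlinarith
      have h6 := le_of_mul_le_mul_left h5 hβ0
      have h7 : (2*m+2)*(u*(δ*a - β*t)) ≤ (2*m+2)*(u*a) := mul_le_mul_of_nonneg_left h4 (by positivity)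
      have h8 : β/8 ≤ α*β*C/2 := by
        have : 1/2*(1/2) ≤ α*C := mul_le_mul hα0 hc (by norm_num) (by linarith)
        nlinarith
      linarith
  have e2 : lam - m^2 - m - (2*m+2)*α*(t/u) ≤ (2*m+2)*(u*(δ*a - β*t))/u^2 := by
    have : (2*m+2)*(u*(δ*a - β*t))/u^2 = (2*m+2)*δ - (2*m+2)*α*(t/u) := by
      have hα' : α = δ + β := by rw [hα, hβ]; ring
      field_simp
      rw [hα', hu']; ring
    rw [this]; linarith
  have e3 : (2*m+2)*(u*(δ*a - β*t))/u^2 ≤ (α*β*C/2)/u^2 := by gcongr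
  have e4 : α*β*C/u^2 = (α*β*C/2)/u^2 + (α*β*C/2)/u^2 := by ring
  have e5 : α*β*C/8 ≤ (α*β*C/2)/u^2 := by
    rw [le_div_iff₀ (by positivity)]
    have : u^2 ≤ 4 := by nlinarith
    have : 0 ≤ α*β*C := by positivity
    nlinarith
  linarith

lemma key_aux {m lam α s c u : ℝ} (hc : c ≠ 0) (hu : u ≠ 0) (hs : s^2 = 1 - c^2) :
    (-(m * (s/c)) + α * (c / u)) * (-(m * (s/c)) + α * (c / u)) +
      (-(m / c^2) + α * ((-s * u - c * c) / u^2)) - s/c * (-(m * (s/c)) + α * (c / u)) + (lam - m^2/c^2) =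
    lam - m^2 - m - (2*m+2)*α*(s/u) - α*(1-α)*c^2/u^2 := by
  field_simp
  linear_combination (u^2*m^2 + u^2*m) * hs

set_option maxHeartbeats 1000000 in
/-- upper growth bound for first mode -/
lemma upper1 {f : ℝ → ℝ} {m : ℕ} {lam δ : ℝ} (hf : Continuous f) (hm : 1 ≤ m) (hδ0 : 0 ≤ δ) (hδ : δ < 1)
    (hlam : lam ≤ m^2 + m + δ * (2*m+2)) (hlam0 : (m:ℝ)^2 ≤ lam)
    (hv : ∀ c ∈ Ioo 0 (π/2), Visc f (fun y => (lam - m^2/cos y^2) * f y) c)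
    (hfe : f (π/2) ≤ 0) (hf0 : 0 ≤ f 0) :
    ∀ y ∈ Icc 0 (π/2), f y ≤ f 0 * (1 + y * (16 / (1-δ) * √m)) := by
  have hm1 : (1:ℝ) ≤ m := by exact_mod_cast hm
  have hsm : 1 ≤ √(m:ℝ) := by rw [Real.one_le_sqrt]; exact hm1
  have hsm2 : √(m:ℝ)^2 = m := Real.sq_sqrt (by positivity)
  set β := (1-δ)/2 with hβ
  have hβ0 : 0 < β := by rw [hβ]; linarith
  have hβ1 : β ≤ 1/2 := by rw [hβ]; linarith
  set α := 1 - β with hα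
  set a := β / (8 * √m) with ha
  have ha0 : 0 < a := by positivity
  have ham : a^2 * m = β^2/64 := by rw [ha, div_pow, mul_pow, hsm2]; field_simp; norm_num
  have ha1 : a ≤ 1 := by rw [ha, div_le_one (by positivity)]; linarith
  set E : ℝ → ℝ := fun y => exp (m * log (cos y) + α * log (sin y + a)) with hE
  set G1 : ℝ → ℝ := fun y => -(m * tan y) + α * (cos y / (sin y + a)) with hG1
  set G2 : ℝ → ℝ := fun y => -(m / cos y^2) + α * ((-sin y * (sin y + a) - cos y * cos y) / (sin y + a)^2) with hG2
  set q : ℝ → ℝ := fun y => cos y^m * exp (α * log (sin y + a)) with hq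
  have hcosp : ∀ y ∈ Ioo 0 (π/2), 0 < cos y := fun y hy =>
    cos_pos_of_mem_Ioo ⟨by linarith [hy.1, pi_pos], hy.2⟩
  have hsinp : ∀ y ∈ Icc 0 (π/2), 0 ≤ sin y := fun y hy =>
    sin_nonneg_of_mem_Icc ⟨hy.1, by linarith [hy.2, pi_pos]⟩
  have hqE : ∀ y ∈ Ioo 0 (π/2), q y = E y := fun y hy => by
    simp only [hq, hE]
    rw [exp_add, exp_nat_mul, exp_log (hcosp y hy)]
  have dG : ∀ y ∈ Ioo 0 (π/2), HasDerivAt (fun y => m * log (cos y) + α * log (sin y + a)) (G1 y) y := by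
    intro y hy
    have h1 := hcosp y hy
    have h2 := hsinp y (Ioo_subset_Icc_self hy)
    have := (((hasDerivAt_cos y).log h1.ne').const_mul (m:ℝ)).add
      ((((hasDerivAt_sin y).add_const a).log (by positivity)).const_mul α)
    refine this.congr_deriv ?_
    simp only [hG1, tan_eq_sin_div_cos]; ring
  have dG1 : ∀ y ∈ Ioo 0 (π/2), HasDerivAt G1 (G2 y) y := by
    intro y hy
    have h1 := hcosp y hy
    have h2 := hsinp y (Ioo_subset_Icc_self hy)
    have := (((hasDerivAt_tan h1.ne').const_mul (m:ℝ)).neg).add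
      (((hasDerivAt_cos y).div ((hasDerivAt_sin y).add_const a) (by positivity)).const_mul α)
    refine this.congr_deriv ?_
    simp only [hG2]; ring
  have dE : ∀ y ∈ Ioo 0 (π/2), HasDerivAt E (E y * G1 y) y := fun y hy => (dG y hy).exp
  have dq : ∀ y ∈ Ioo 0 (π/2), HasDerivAt q (E y * G1 y) y := fun y hy => by
    refine (dE y hy).congr_of_eventuallyEq ?_
    filter_upwards [isOpen_Ioo.mem_nhds hy] with z hz using hqE z hz
  have dE1 : ∀ y ∈ Ioo 0 (π/2), HasDerivAt (fun y => E y * G1 y) (E y * G1 y * G1 y + E y * G2 y) y :=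
    fun y hy => (dE y hy).mul (dG1 y hy)
  have cE : ContinuousOn E (Ioo 0 (π/2)) := fun y hy => (dE y hy).continuousAt.continuousWithinAt
  have cG1 : ContinuousOn G1 (Ioo 0 (π/2)) := fun y hy => (dG1 y hy).continuousAt.continuousWithinAt
  have cG2 : ContinuousOn G2 (Ioo 0 (π/2)) := by
    intro y hy
    have h1 := (hcosp y hy).ne'
    have h2 : sin y + a ≠ 0 := by have := hsinp y (Ioo_subset_Icc_self hy); positivity
    apply ContinuousAt.continuousWithinAt
    simp only [hG2]
    fun_prop (disch := positivity)
  have Lq : ∀ y ∈ Ioo 0 (π/2), (E y * G1 y * G1 y + E y * G2 y) - tan y * (E y * G1 y)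
      + (lam - m^2/cos y^2) * E y ≤ - (E y * (α * β * cos y^2 / 8)) := by
    intro y hy
    have h1 := hcosp y hy
    have h2 := hsinp y (Ioo_subset_Icc_self hy)
    have hu : 0 < sin y + a := by positivity
    have key : G1 y * G1 y + G2 y - tan y * G1 y + (lam - m^2/cos y^2) =
        lam - m^2 - m - (2*m+2)*α*(sin y/(sin y + a)) - α*β*cos y^2/(sin y+a)^2 := by
      simp only [hG1, hG2, tan_eq_sin_div_cos]
      have hs : sin y^2 = 1 - cos y^2 := by linarith [sin_sq_add_cos_sq y]
      have hβα : β = 1 - α := by rw [hα]; ring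
      rw [hβα]
      exact key_aux h1.ne' hu.ne' hs
    have hs : cos y^2 = 1 - sin y^2 := by linarith [sin_sq_add_cos_sq y]
    have hs1 := sin_le_one y
    have hα0 : 1/2 ≤ α := by rw [hα]; linarith
    have bd : lam - m^2 - m - (2*m+2)*α*(sin y/(sin y + a)) - α*β*cos y^2/(sin y+a)^2
        ≤ - (α * β * cos y^2 / 8) := by
      exact bd_aux hm1 hδ0 hδ hlam hβ hβ0 hβ1 hα hα0 ha0 ha1 ham h2 hs1 hs (by positivity)
    have hEp : 0 < E y := exp_pos _
    have : (E y * G1 y * G1 y + E y * G2 y) - tan y * (E y * G1 y)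
      + (lam - m^2/cos y^2) * E y = E y * (G1 y * G1 y + G2 y - tan y * G1 y + (lam - m^2/cos y^2)) := by ring
    rw [this, key, ← mul_neg]
    exact mul_le_mul_of_nonneg_left bd hEp.le
  have hα0 : 1/2 ≤ α := by rw [hα]; linarith
  have hα1 : α ≤ 1 := by rw [hα]; linarith
  -- lower bound of the defect where the potential is positive
  have hlamp : 0 < lam := by nlinarith
  set r := (m:ℝ)^2/lam with hr
  have hr0 : 0 < r := by positivity
  set κ := r^m * exp (α * log a) * (α*β*r^2/8) with hκ
  have hκ0 : 0 < κ := by positivity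
  have low : ∀ y ∈ Ioo 0 (π/2), 0 < lam - m^2/cos y^2 → κ ≤ E y * (α * β * cos y^2 / 8) := by
    intro y hy hP
    have h1 := hcosp y hy
    have h2 := hsinp y (Ioo_subset_Icc_self hy)
    have hrc : r ≤ cos y := by
      have h3 : (m:ℝ)^2/cos y^2 < lam := by linarith
      rw [div_lt_iff₀ (by positivity)] at h3
      have : r ≤ cos y^2 := by rw [hr, div_le_iff₀ hlamp]; linarith
      nlinarith [cos_le_one y]
    rw [← hqE y hy]
    simp only [hq, hκ]
    gcongr
    linarith
  have qc : ContinuousOn q (Icc 0 (π/2)) := by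
    intro y hy
    have h2 : sin y + a ≠ 0 := by have := hsinp y hy; positivity
    apply ContinuousAt.continuousWithinAt
    simp only [hq]
    fun_prop (disch := assumption)
  have qnn : ∀ y ∈ Icc 0 (π/2), 0 ≤ q y := fun y hy => by
    have : 0 ≤ cos y := cos_nonneg_of_mem_Icc ⟨by linarith [hy.1, pi_pos], hy.2⟩
    positivity
  have q0 : q 0 = exp (α * log a) := by simp [hq]
  have q00 : 0 < q 0 := by rw [q0]; exact exp_pos _
  have main : ∀ y ∈ Icc 0 (π/2), ∀ ε > 0, f y ≤ f 0 / q 0 * (q y + ε) := by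
    intro y hy ε hε
    set e := min ε (κ/(2*lam)) with he
    have he0 : 0 < e := lt_min hε (by positivity)
    have he1 : e ≤ ε := min_le_left _ _
    have he2 : e ≤ κ/(2*lam) := min_le_right _ _
    have hA : 0 ≤ f 0 / q 0 := by positivity
    have := comp hf hv (q := fun y => q y + e) (q1 := fun y => E y * G1 y)
      (q2 := fun y => E y * G1 y * G1 y + E y * G2 y) (qc.add continuousOn_const)
      (fun y hy => by have := qnn y hy; positivity)
      (fun y hy => ⟨(dq y hy).add_const e, dE1 y hy⟩)
      (((cE.mul cG1).mul cG1).add (cE.mul cG2)) (by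
        intro c hc
        have h1 := Lq c hc
        have h2 := low c hc
        have h3 := hcosp c hc
        rw [hqE c hc]
        have hEp : 0 < E c := exp_pos _
        have h4 : 0 < E c * (α * β * cos c^2 / 8) := by positivity
        by_cases hP : 0 < lam - m^2/cos c^2
        · have h5 := h2 hP
          have h6 : lam - m^2/cos c^2 ≤ lam := by
            have : 0 ≤ (m:ℝ)^2/cos c^2 := by positivity
            linarith
          have h7 : (lam - m^2/cos c^2) * e ≤ lam * (κ/(2*lam)) :=
            mul_le_mul h6 he2 he0.le hlamp.le
          have h8 : lam * (κ/(2*lam)) = κ/2 := by field_simp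
          linarith
        · push Not at hP
          have := mul_nonpos_of_nonpos_of_nonneg hP he0.le
          linarith) hfe hA (by
        have : f 0 = f 0 / q 0 * q 0 := by rw [div_mul_cancel₀ _ q00.ne']
        have h3 := mul_nonneg hA he0.le
        rw [mul_add]; linarith) y hy
    refine this.trans (mul_le_mul_of_nonneg_left ?_ hA)
    linarith
  intro y hy
  have hA : 0 ≤ f 0 / q 0 := by positivity
  have h1 : f y ≤ f 0 / q 0 * q y := by
    have ht : Tendsto (fun ε => f 0 / q 0 * (q y + ε)) (𝓝[>] 0) (𝓝 (f 0 / q 0 * (q y + 0))) := by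
      apply tendsto_nhdsWithin_of_tendsto_nhds
      apply Continuous.tendsto
      fun_prop
    rw [add_zero] at ht
    refine ge_of_tendsto ht ?_
    filter_upwards [self_mem_nhdsWithin] with ε hε using main y hy ε hε
  have hs := hsinp y hy
  have h2 : q y ≤ q 0 * (1 + y / a) := by
    have hc1 : cos y^m ≤ 1 := pow_le_one₀ (cos_nonneg_of_mem_Icc ⟨by linarith [hy.1, pi_pos], hy.2⟩) (cos_le_one y)
    have e1 : q y ≤ exp (α * log (sin y + a)) := by
      simp only [hq]
      have := exp_pos (α * log (sin y + a))
      nlinarith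
    have e2 : log (sin y + a) = log a + log (1 + sin y / a) := by
      rw [← log_mul ha0.ne' (by positivity)]
      congr 1; field_simp; ring
    have e3 : 0 ≤ log (1 + sin y / a) := log_nonneg (by have : 0 ≤ sin y / a := by positivity
                                                        linarith)
    have e4 : exp (α * log (sin y + a)) ≤ q 0 * (1 + sin y / a) := by
      rw [q0, e2, mul_add, exp_add]
      apply mul_le_mul_of_nonneg_left _ (exp_pos _).le
      rw [← exp_log (show 0 < 1 + sin y / a by positivity)]
      simp only [log_exp]
      apply exp_le_exp.2
      nlinarith
    refine e1.trans (e4.trans ?_)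
    apply mul_le_mul_of_nonneg_left _ q00.le
    have := sin_le hy.1
    gcongr
  have h3 : y / a = y * (16 / (1-δ) * √m) := by
    rw [ha, hβ]
    have : 1 - δ ≠ 0 := by linarith
    field_simp
    ring
  rw [← h3]
  refine h1.trans ((mul_le_mul_of_nonneg_left h2 hA).trans (le_of_eq ?_))
  field_simp

/-- lower bound for first mode -/
lemma lower1 {f : ℝ → ℝ} {m lam : ℝ} (hf : Continuous f) (hm : 1 ≤ m)
    (hlam : m * (m+1) ≤ lam)
    (hv : ∀ c ∈ Ioo 0 (π/2), Visc (fun y => - f y) (fun y => (lam - m^2/cos y^2) * (- f y)) c)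
    (hfn : ∀ y, 0 ≤ f y) :
    ∀ y, 0 ≤ y → f 0 * (1 - y * √(m+1)) ≤ f y := by
  intro y hy0
  rcases (hfn 0).eq_or_lt with h0 | h0
  · rw [← h0, zero_mul]; exact hfn y
  set S := √(m+1) with hS
  have hS1 : 1 < S := by rw [hS, Real.lt_sqrt] <;> linarith
  have hS2 : S^2 = m+1 := Real.sq_sqrt (by linarith)
  by_cases hyS : 1 ≤ y * S
  · exact (mul_nonpos_of_nonneg_of_nonpos h0.le (by linarith)).trans (hfn y)
  push Not at hyS
  have hpi := Real.pi_gt_three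
  have hSl : 1/S < π/2 := by
    have : 1/S < 1 := by rw [div_lt_one (by linarith)]; exact hS1
    linarith
  obtain ⟨c, hc, hmax⟩ := isCompact_Icc.exists_isMaxOn (s := Icc 0 (1/S))
    ⟨0, ⟨le_rfl, by positivity⟩⟩
    (f := fun y => - f y - (- (f 0 * (1 - y * S)))) (by fun_prop)
  have hyI : y ∈ Icc 0 (1/S) := ⟨hy0, by rw [le_div_iff₀ (by linarith)]; exact hyS.le⟩
  have hmy : - f y - (- (f 0 * (1 - y * S))) ≤ - f c - (- (f 0 * (1 - c * S))) := hmax hyI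
  by_contra hlt
  push Not at hlt
  have hc0 : c ≠ 0 := by
    rintro rfl
    simp at hmy; linarith
  have hc1 : c ≠ 1/S := by
    rintro rfl
    have : 1/S*S = 1 := by field_simp
    rw [this] at hmy
    have := hfn (1/S)
    linarith
  have hcI : c ∈ Ioo 0 (1/S) := ⟨lt_of_le_of_ne hc.1 (Ne.symm hc0), lt_of_le_of_ne hc.2 hc1⟩
  have hnh : Ioo 0 (1/S) ∈ 𝓝 c := isOpen_Ioo.mem_nhds hcI
  have hcp : c ∈ Ioo 0 (π/2) := ⟨hcI.1, hcI.2.trans hSl⟩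
  have := hv c hcp (fun y => - (f 0 * (1 - y * S))) (fun y => f 0 * S) (fun y => 0)
    (by filter_upwards with y
        refine ⟨?_, hasDerivAt_const _ _⟩
        have := ((((hasDerivAt_id y).mul_const S).const_sub 1).const_mul (f 0)).neg
        refine this.congr_deriv ?_
        ring)
    continuousAt_const
    (by filter_upwards [hnh] with y hy
        exact hmax (Ioo_subset_Icc_self hy))
  have ht : 0 < tan c := tan_pos_of_pos_of_lt_pi_div_two hcp.1 hcp.2
  have hcos : 0 < cos c := cos_pos_of_mem_Ioo ⟨by linarith [hcp.1], hcp.2⟩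
  have hP : 0 ≤ lam - m^2/cos c^2 := by
    have h1 : c^2 ≤ 1/(m+1) := by
      rw [← hS2, ← one_div_pow]
      exact pow_le_pow_left₀ hcI.1.le hcI.2.le 2
    have h2 : m/(m+1) ≤ cos c^2 := by
      have : m/(m+1) = 1 - 1/(m+1) := by field_simp; ring
      have h3 := sin_sq_le_sq (x := c)
      have h4 := sin_sq_add_cos_sq c
      linarith
    have h3 : m^2/cos c^2 ≤ lam := by
      rw [div_le_iff₀ (by positivity)]
      rw [div_le_iff₀ (by positivity)] at h2
      have : m*(m+1)*cos c^2 ≤ lam * cos c^2 := by gcongr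
      nlinarith
    linarith
  have h5 := mul_nonneg hP (hfn c)
  have h6 := mul_pos ht (mul_pos h0 (by linarith : (0:ℝ) < S))
  linarith

end Blow

namespace Blow
open Topology

lemma even_quad {F R : ℝ → ℝ} (hF : Continuous F) (hev : ∀ y, F (-y) = F y)
    (hR : ContinuousOn R (Icc (-(1/2)) (1/2))) (hv : ∀ c ∈ Ioo (-(1/2):ℝ) (1/2), Visc F R c) :
    ∃ A, ∀ φ, 0 ≤ φ → φ ≤ 1/2 → F 0 ≤ F φ + A * φ^2 := by
  obtain ⟨D, hD⟩ := isCompact_Icc.exists_bound_of_continuousOn hR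
  have hD0 : 0 ≤ D := (norm_nonneg _).trans (hD 0 ⟨by norm_num, by norm_num⟩)
  refine ⟨D + 1, fun φ h0 h1 => ?_⟩
  by_contra hlt
  push Not at hlt
  set A := D + 1 with hA
  have hA0 : 0 < A := by linarith
  obtain ⟨c, hc, hmax⟩ := isCompact_Icc.exists_isMaxOn (s := Icc (-φ) φ)
    ⟨0, ⟨by linarith, h0⟩⟩ (f := fun y => F y - (- (A * y^2))) (by fun_prop)
  have hm0 : F 0 - (- (A * 0^2)) ≤ F c - (- (A * c^2)) := hmax (show (0:ℝ) ∈ Icc (-φ) φ from ⟨by linarith, h0⟩)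
  have hc0 : c ≠ -φ := by
    rintro rfl
    rw [hev] at hm0; nlinarith
  have hc1 : c ≠ φ := by
    rintro rfl
    nlinarith
  have hcI : c ∈ Ioo (-φ) φ := ⟨lt_of_le_of_ne hc.1 (Ne.symm hc0), lt_of_le_of_ne hc.2 hc1⟩
  have hnh : Ioo (-φ) φ ∈ 𝓝 c := isOpen_Ioo.mem_nhds hcI
  have hch : c ∈ Ioo (-(1/2):ℝ) (1/2) := ⟨by linarith [hcI.1], by linarith [hcI.2]⟩
  have := hv c hch (fun y => - (A * y^2)) (fun y => -(A * (2 * y))) (fun y => -(A * 2))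
    (by filter_upwards with y
        constructor
        · have := ((hasDerivAt_pow 2 y).const_mul A).neg
          refine this.congr_deriv ?_
          simp
        · have := (((hasDerivAt_id y).const_mul 2).const_mul A).neg
          refine this.congr_deriv ?_
          simp)
    continuousAt_const
    (by filter_upwards [hnh] with y hy
        exact hmax (Ioo_subset_Icc_self hy))
  have hRc := hD c (Ioo_subset_Icc_self hch)
  rw [Real.norm_eq_abs] at hRc
  have hRc' := (abs_le.1 hRc).2
  have hc2 : c^2 ≤ 1/4 := by nlinarith [hch.1, hch.2]
  have hpi := Real.pi_gt_three
  have hcos : 0 < cos c := cos_pos_of_mem_Ioo ⟨by linarith [hch.1], by linarith [hch.2]⟩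
  have hcos2 : 7/8 ≤ cos c := by have := one_sub_sq_div_two_le_cos (x := c); linarith
  have ht : c * tan c ≤ 1/2 := by
    rw [tan_eq_sin_div_cos, ← mul_div_assoc, div_le_iff₀ hcos]
    have h3 : c * sin c ≤ c^2 := by
      have h1 : |c * sin c| ≤ |c| * |c| := by
        rw [abs_mul]; exact mul_le_mul_of_nonneg_left (abs_sin_le_abs) (abs_nonneg _)
      have := le_abs_self (c * sin c)
      rw [abs_mul_abs_self] at h1
      nlinarith
    linarith
  have := mul_le_mul_of_nonneg_left ht hA0.le
  nlinarith

lemma abs_sin_nat_mul (k : ℕ) {x : ℝ} (hx : x ∈ Icc 0 π) : |sin (k * x)| ≤ k * sin x := by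
  have hs := sin_nonneg_of_mem_Icc hx
  induction k with
  | zero => simp
  | succ k ih =>
    push_cast
    rw [add_mul, one_mul, sin_add]
    calc |sin (k*x) * cos x + cos (k*x) * sin x| ≤ |sin (k*x)| * |cos x| + |cos (k*x)| * |sin x| := by
          rw [← abs_mul, ← abs_mul]; exact abs_add_le _ _
      _ ≤ k * sin x * 1 + 1 * sin x := by
          rw [abs_of_nonneg hs]
          gcongr
          · exact abs_cos_le_one x
          · exact abs_cos_le_one _
      _ = _ := by ring

lemma wt_sin (a b : ℝ) (k : ℕ) : Wt (fun x => a * sin x + b * sin (k * x))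
    (fun x => a * cos x + b * (k * cos (k * x))) (fun x => -(a * sin x) - b * (k^2 * sin (k * x))) where
  d1 x := by
    have := ((hasDerivAt_sin x).const_mul a).add ((((hasDerivAt_id x).const_mul (k:ℝ)).sin).const_mul b)
    refine this.congr_deriv ?_
    simp only [id, mul_one]; ring
  d2 x := by
    have := ((hasDerivAt_cos x).const_mul a).add
      (((((hasDerivAt_id x).const_mul (k:ℝ)).cos).const_mul (k:ℝ)).const_mul b)
    refine this.congr_deriv ?_
    simp only [id, mul_one]; ring
  c2 := by fun_prop
  z0 := by simp
  zp := by simp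

/-- Fourier modes -/
noncomputable def fk (V : ℝ → ℝ → ℝ) (k : ℕ) (y : ℝ) : ℝ := ∫ x in (0:ℝ)..π, V x y * sin (k * x)

variable {M lam s : ℝ} {V Vx Vxx Vy Vyy : ℝ → ℝ → ℝ}

lemma fk_cont (hV : Continuous (Function.uncurry V)) (k : ℕ) : Continuous (fk V k) :=
  contF hV (by fun_prop)

lemma Vy_cont (hV : Continuous (Function.uncurry V)) (y : ℝ) : Continuous (fun x => V x y) :=
  hV.comp (f := fun x : ℝ => (x, y)) (by fun_prop)

lemma int_lin (hV : Continuous (Function.uncurry V)) (a b : ℝ) (k : ℕ) (y : ℝ) :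
    ∫ x in (0:ℝ)..π, V x y * (a * sin x + b * sin (k * x)) = a * fk V 1 y + b * fk V k y := by
  have h := Vy_cont hV y
  unfold fk
  rw [← intervalIntegral.integral_const_mul, ← intervalIntegral.integral_const_mul,
    ← intervalIntegral.integral_add]
  · congr 1; ext x; simp; ring
  · apply Continuous.intervalIntegrable; fun_prop
  · apply Continuous.intervalIntegrable; fun_prop

lemma int_lin2 (hV : Continuous (Function.uncurry V)) (a b : ℝ) (k : ℕ) (y : ℝ) :
    ∫ x in (0:ℝ)..π, V x y * (-(a * sin x) - b * (k^2 * sin (k * x))) =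
      -(a * fk V 1 y) - k^2 * (b * fk V k y) := by
  have := int_lin hV (-a) (-(b*k^2)) k y
  rw [show -(a * fk V 1 y) - k^2 * (b * fk V k y) = -a * fk V 1 y + (-(b*k^2)) * fk V k y by ring, ← this]
  congr 1; ext x; ring

lemma visc_fk (hG : Good M lam s V Vx Vxx Vy Vyy) (b : ℝ) (k : ℕ) {c : ℝ} (hc : c ∈ Ioo 0 (π/2)) :
    Visc (fun y => b * fk V k y) (fun y => (lam - M*k^2/cos y^2) * (b * fk V k y)) c := by
  have := visc1 hG (wt_sin 0 b k) hc
  simp only [int_lin hG.cont, int_lin2 hG.cont] at this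
  convert this using 2
  · ring
  · ring

lemma visc_comb (hG : Good M lam s V Vx Vxx Vy Vyy) (hM : 0 ≤ M) (hlam : 0 ≤ lam) {b : ℝ} (hb : |b| ≤ 1)
    (k : ℕ) {c : ℝ} (hc : c ∈ Ioo (-(π/2)) (π/2)) :
    Visc (fun y => k * fk V 1 y + b * fk V k y) (fun y => M / cos y^2 * (-(k * fk V 1 y) - k^2 * (b * fk V k y))
      + lam * (k * fk V 1 y + b * fk V k y)) c := by
  have := visc2 hG hM hlam (wt_sin k b k) (fun x hx => by
    have h1 := abs_sin_nat_mul k hx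
    have h2 : |b * sin (k*x)| ≤ k * sin x := by
      rw [abs_mul]
      calc |b| * |sin (k*x)| ≤ 1 * |sin (k*x)| := by gcongr
        _ ≤ _ := by simpa using h1
    have := (abs_le.1 h2).1
    linarith) hc
  simpa only [int_lin hG.cont, int_lin2 hG.cont] using this

lemma f1_nonneg (hG : Good M lam s V Vx Vxx Vy Vyy) (y : ℝ) : 0 ≤ fk V 1 y := by
  apply intervalIntegral.integral_nonneg pi_pos.le
  intro x hx
  have := hG.nonneg x y
  have h2 := sin_nonneg_of_mem_Icc hx
  simp only [Nat.cast_one, one_mul]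
  positivity

lemma fk_end (hG : Good M lam s V Vx Vxx Vy Vyy) (k : ℕ) : fk V k (π/2) = 0 := by
  unfold fk
  have : ∀ x, V x (π/2) = 0 := fun x => hG.zero x _ (by
    intro h
    exact lt_irrefl _ h.2.1.2)
  simp [this]

lemma fk_even (hG : Good M lam s V Vx Vxx Vy Vyy) (k : ℕ) (y : ℝ) : fk V k (-y) = fk V k y := by
  unfold fk
  simp only [hG.even]

/-- the standing assumptions -/
structure Std (m : ℕ) (δ lam s : ℝ) (V Vx Vxx Vy Vyy : ℝ → ℝ → ℝ) : Prop where
  hm : 4 ≤ m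
  hδ0 : 0 ≤ δ
  hδ : δ < 1
  good : Good (m^2) lam s V Vx Vxx Vy Vyy
  l1 : (m:ℝ) * (m + 1) ≤ lam
  l2 : lam ≤ m^2 + m + δ * (2*m+2)
  hs : s ∈ Ioo (0:ℝ) 1
  norm : fk V 1 (1/m) = π/2

variable {m : ℕ} {δ : ℝ}

/-- growth constant -/
noncomputable def cc (m : ℕ) (δ : ℝ) : ℝ := 16 / (1-δ) * √m

lemma Std.bounds (h : Std m δ lam s V Vx Vxx Vy Vyy) {y : ℝ} (hy : y ∈ Icc 0 (π/2)) :
    fk V 1 0 * (1 - y * cc m δ) ≤ fk V 1 y ∧ fk V 1 y ≤ fk V 1 0 * (1 + y * cc m δ) := by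
  have hm4 : (4:ℝ) ≤ m := by exact_mod_cast h.hm
  have hδ0 := h.hδ0
  have hδ1 := h.hδ
  constructor
  · have := lower1 (fk_cont h.good.cont 1) (m := m) (lam := lam) (by linarith) h.l1 (fun c hc => by
      have := visc_fk h.good (-1) 1 hc
      simpa using this) (f1_nonneg h.good) y hy.1
    refine le_trans (mul_le_mul_of_nonneg_left ?_ (f1_nonneg h.good 0)) this
    have h1 : √((m:ℝ)+1) ≤ cc m δ := by
      have h2 : √((m:ℝ)+1) ≤ 2 * √m := by
        rw [Real.sqrt_le_left (by positivity), mul_pow, Real.sq_sqrt (by positivity)]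
        linarith
      have h3 : (2:ℝ) ≤ 16/(1-δ) := by rw [le_div_iff₀ (by linarith)]; linarith
      have := mul_le_mul_of_nonneg_right h3 (Real.sqrt_nonneg (m:ℝ))
      unfold cc; linarith
    have := mul_le_mul_of_nonneg_left h1 hy.1
    linarith
  · exact upper1 (fk_cont h.good.cont 1) (by have := h.hm; omega) h.hδ0 h.hδ h.l2
      (by have := h.l1; nlinarith) (fun c hc => by
      have := visc_fk h.good 1 1 hc
      simpa using this) (fk_end h.good 1).le (f1_nonneg h.good 0) y hy

lemma Std.decay (h : Std m δ lam s V Vx Vxx Vy Vyy) {k : ℕ} (hk : 2 ≤ k) {y : ℝ} (hy : y ∈ Icc 0 (π/2)) :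
    |fk V k y| ≤ |fk V k 0| * exp (-(k*m/2*y)) := by
  have hm4 : (4:ℝ) ≤ m := by exact_mod_cast h.hm
  have hk2 : (2:ℝ) ≤ k := by exact_mod_cast hk
  have hl : lam ≤ ((m:ℝ)+1)*(m+2) := by nlinarith [h.l2, h.hδ]
  have hl0 : 0 ≤ lam := by nlinarith [h.l1]
  have key : ∀ b : ℝ, |b| = 1 → b * fk V k y ≤ |fk V k 0| * exp (-(k*m/2*y)) := fun b hb => by
    have := Blow.decay (f := fun y => b * fk V k y) (m := m) (lam := lam) (k := k)
      (continuous_const.mul (fk_cont h.good.cont k)) hm4 hk2 hl hl0 (fun c hc => visc_fk h.good b k hc)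
      (by simp [fk_end h.good]) y hy
    rwa [abs_mul, hb, one_mul] at this
  rw [abs_le]
  have h1 := key 1 (by simp)
  have h2 := key (-1) (by simp)
  constructor <;> linarith

lemma Std.small (h : Std m δ lam s V Vx Vxx Vy Vyy) {k : ℕ} (hk : 2 ≤ k) :
    |fk V k 0| ≤ 2 * k * fk V 1 0 * (cc m δ / m) := by
  have hm4 : (4:ℝ) ≤ m := by exact_mod_cast h.hm
  have hk2 : (2:ℝ) ≤ k := by exact_mod_cast hk
  have hl0 : 0 ≤ lam := by nlinarith [h.l1]
  have hpi := Real.pi_gt_three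
  have hev : ∀ b : ℝ, |b| ≤ 1 → ∃ A, ∀ φ, 0 ≤ φ → φ ≤ 1/2 →
      k * fk V 1 0 + b * fk V k 0 ≤ k * fk V 1 φ + b * fk V k φ + A * φ^2 := fun b hb => by
    have c1 := fk_cont h.good.cont 1
    have ck := fk_cont h.good.cont k
    refine even_quad (F := fun y => k * fk V 1 y + b * fk V k y) (R := fun y => m^2 / cos y^2 * (-(k * fk V 1 y) - k^2 * (b * fk V k y))
      + lam * (k * fk V 1 y + b * fk V k y)) (by fun_prop) (fun y => by simp only [fk_even h.good]) ?_
      (fun c hc => visc_comb h.good (by positivity) hl0 hb k ⟨by linarith [hc.1], by linarith [hc.2]⟩)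
    intro y hy
    have hcos : cos y ≠ 0 := (cos_pos_of_mem_Ioo ⟨by linarith [hy.1], by linarith [hy.2]⟩).ne'
    apply ContinuousAt.continuousWithinAt
    have d1 := c1.continuousAt (x := y)
    have dk := ck.continuousAt (x := y)
    fun_prop (disch := positivity)
  obtain ⟨A1, h1⟩ := hev 1 (by simp)
  obtain ⟨A2, h2⟩ := hev (-1) (by simp)
  set A := max A1 A2
  have main : ∀ φ : ℝ, 0 < φ → φ ≤ 1/m → |fk V k 0| * (m/2) ≤ k * fk V 1 0 * cc m δ + A * φ := by
    intro φ hφ0 hφ1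
    have hφ4 : φ ≤ 1/4 := hφ1.trans (by gcongr)
    have hI : φ ∈ Icc 0 (π/2) := ⟨hφ0.le, by linarith⟩
    have b1 := h1 φ hφ0.le (by linarith)
    have b2 := h2 φ hφ0.le (by linarith)
    have hd := h.decay hk hI
    have hb := (h.bounds hI).2
    have e1 : A1 * φ^2 ≤ A * φ^2 := mul_le_mul_of_nonneg_right (le_max_left _ _) (sq_nonneg _)
    have e2 : A2 * φ^2 ≤ A * φ^2 := mul_le_mul_of_nonneg_right (le_max_right _ _) (sq_nonneg _)
    have hkb := mul_le_mul_of_nonneg_left hb (by positivity : (0:ℝ) ≤ k)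
    have hd' := abs_le.1 hd
    have e3 : |fk V k 0| ≤ k * (fk V 1 0 * (1 + φ * cc m δ)) - k * fk V 1 0 +
        |fk V k 0| * exp (-(k*m/2*φ)) + A * φ^2 := by
      rw [abs_le]
      have := le_abs_self (fk V k φ)
      have := neg_abs_le (fk V k φ)
      constructor <;> linarith
    have hh : m * φ ≤ 1 := by
      rw [le_div_iff₀ (by linarith)] at hφ1; linarith
    have hh0 : 0 < m * φ := by positivity
    have e4 : exp (-(k*m/2*φ)) ≤ 1 - m*φ/2 := by
      have a1 : exp (-(k*m/2*φ)) ≤ exp (-(m*φ)) := by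
        apply exp_le_exp.2; nlinarith
      refine a1.trans ?_
      rw [exp_neg]
      have a2 : 1 + m*φ ≤ exp (m*φ) := by linarith [add_one_le_exp (m*φ)]
      rw [inv_le_comm₀ (exp_pos _) (by linarith)]
      refine le_trans ?_ a2
      rw [inv_le_iff_one_le_mul₀ (by linarith)]
      nlinarith
    have e5 := mul_le_mul_of_nonneg_left e4 (abs_nonneg (fk V k 0))
    have e6 : (|fk V k 0| * (m/2)) * φ ≤ (k * fk V 1 0 * cc m δ + A * φ) * φ := by nlinarith
    exact le_of_mul_le_mul_right e6 hφ0
  have lim : |fk V k 0| * (m/2) ≤ k * fk V 1 0 * cc m δ := by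
    have ht : Tendsto (fun φ => k * fk V 1 0 * cc m δ + A * φ) (𝓝[>] 0) (𝓝 (k * fk V 1 0 * cc m δ + A * 0)) := by
      apply tendsto_nhdsWithin_of_tendsto_nhds
      apply Continuous.tendsto
      fun_prop
    rw [mul_zero, add_zero] at ht
    refine ge_of_tendsto ht ?_
    filter_upwards [Ioo_mem_nhdsGT (show (0:ℝ) < 1/m by positivity)] with φ hφ using main φ hφ.1 hφ.2.le
  rw [show 2 * k * fk V 1 0 * (cc m δ / m) = (k * fk V 1 0 * cc m δ) / (m/2) by field_simp]
  rw [le_div_iff₀ (by positivity)]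
  exact lim

end Blow

namespace Blow
open Topology

lemma fourier_sine {g : ℝ → ℝ} (hg : Continuous g) (h0 : ∀ x ≤ 0, g x = 0) (h1 : ∀ x, π ≤ x → g x = 0)
    {b : ℕ → ℝ} (hb : ∀ k : ℕ, b k = ∫ x in (0:ℝ)..π, g x * sin (k * x)) (hs : Summable b) {x : ℝ}
    (hx : x ∈ Icc 0 π) : HasSum (fun k : ℕ => 2/π * b k * sin (k * x)) (g x) := by
  have hpi := Real.pi_pos
  have hT : Fact (0 < 2 * π) := ⟨by positivity⟩
  set O : ℝ → ℂ := fun x => ((g x - g (-x) : ℝ) : ℂ) with hO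
  have hOc : Continuous O := by simp only [hO]; fun_prop
  set F := AddCircle.liftIco (2*π) (-π) O with hF
  have hFc : Continuous F := by
    apply AddCircle.liftIco_continuous _ hOc.continuousOn
    simp only [hO]
    rw [show -π + 2*π = π by ring, h0 (-π) (by linarith), neg_neg, h1 π le_rfl]
  have hcoef : ∀ n : ℤ, fourierCoeff F n = -(Complex.I/π) * ((∫ x in (0:ℝ)..π, g x * sin (n * x) : ℝ) : ℂ) := by
    intro n
    rw [fourierCoeff_eq_intervalIntegral F n (-π)]
    have e1 : ∫ x in (-π)..(-π + 2*π), fourier (-n) (x : AddCircle (2*π)) • F x =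
        ∫ x in (-π)..π, Complex.exp (-(Complex.I * n * x)) * O x := by
      rw [show -π + 2*π = π by ring]
      refine intervalIntegral.integral_congr_Ioo_of_le (by linarith) fun x hx => ?_
      rw [hF, AddCircle.liftIco_coe_apply ⟨hx.1.le, by linarith [hx.2]⟩, fourier_coe_apply, smul_eq_mul]
      congr 2
      push_cast
      have : (π:ℂ) ≠ 0 := by exact_mod_cast hpi.ne'
      field_simp
    rw [e1]
    have e2 : ∫ x in (-π)..π, Complex.exp (-(Complex.I * n * x)) * O x =
        (∫ x in (-π)..π, Complex.exp (-(Complex.I * n * x)) * (g x : ℂ)) -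
        ∫ x in (-π)..π, Complex.exp (-(Complex.I * n * x)) * (g (-x) : ℂ) := by
      rw [← intervalIntegral.integral_sub]
      · congr 1; ext x; simp only [hO]; push_cast; ring
      · apply Continuous.intervalIntegrable; fun_prop
      · apply Continuous.intervalIntegrable; fun_prop
    have e3 : ∫ x in (-π)..π, Complex.exp (-(Complex.I * n * x)) * (g (-x) : ℂ) =
        ∫ x in (-π)..π, Complex.exp (Complex.I * n * x) * (g x : ℂ) := by
      have := intervalIntegral.integral_comp_neg (a := -π) (b := π) (fun x : ℝ => Complex.exp (Complex.I * n * x) * (g x : ℂ))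
      rw [neg_neg] at this
      rw [← this]
      congr 1; ext x; push_cast; ring_nf
    rw [e2, e3, ← intervalIntegral.integral_sub]
    rotate_left
    · apply Continuous.intervalIntegrable; fun_prop
    · apply Continuous.intervalIntegrable; fun_prop
    have e4 : ∀ x : ℝ, Complex.exp (-(Complex.I * n * x)) * (g x : ℂ) - Complex.exp (Complex.I * n * x) * (g x : ℂ)
        = -(2 * Complex.I) * ((g x * sin (n * x) : ℝ) : ℂ) := by
      intro x
      push_cast
      rw [Complex.sin, show -((n:ℂ) * x) * Complex.I = -(Complex.I * n * x) by ring,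
        show ((n:ℂ) * x) * Complex.I = (Complex.I * n * x) by ring]
      have := Complex.I_mul_I
      linear_combination ((Complex.exp (-(Complex.I * n * x)) - Complex.exp (Complex.I * n * x)) * g x) * this
    simp only [e4]
    rw [intervalIntegral.integral_const_mul, intervalIntegral.integral_ofReal]
    have e5 : ∫ x in (-π)..π, g x * sin (n * x) = ∫ x in (0:ℝ)..π, g x * sin (n * x) := by
      rw [← intervalIntegral.integral_add_adjacent_intervals (b := 0)]
      · have : ∫ x in (-π)..0, g x * sin (n * x) = ∫ x in (-π)..0, (0:ℝ) := by
          apply intervalIntegral.integral_congr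
          intro x hx
          rw [uIcc_of_le (by linarith)] at hx
          simp [h0 x hx.2]
        rw [this]; simp
      · apply Continuous.intervalIntegrable; fun_prop
      · apply Continuous.intervalIntegrable; fun_prop
    rw [e5, Complex.real_smul]
    push_cast
    have : (π:ℂ) ≠ 0 := by exact_mod_cast hpi.ne'
    field_simp
  have hcn : ∀ k : ℕ, fourierCoeff F k = -(Complex.I/π) * (b k : ℂ) := fun k => by
    rw [hcoef, hb]; simp
  have hcn' : ∀ k : ℕ, fourierCoeff F (-k) = (Complex.I/π) * (b k : ℂ) := fun k => by
    rw [hcoef, hb]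
    have : ∫ x in (0:ℝ)..π, g x * sin (((-(k:ℤ):ℤ):ℝ) * x) = - ∫ x in (0:ℝ)..π, g x * sin (k * x) := by
      rw [← intervalIntegral.integral_neg]
      congr 1; ext x; push_cast; rw [neg_mul, sin_neg]; ring
    rw [this]; push_cast; ring
  have hsc : Summable (fun k => (b k : ℂ)) := by exact_mod_cast hs
  have hsum : Summable (fourierCoeff F) := by
    apply Summable.of_nat_of_neg
    · simp only [hcn]; exact hsc.mul_left _
    · simp only [hcn']; exact hsc.mul_left _
  have key := has_pointwise_sum_fourier_series_of_summable (f := ⟨F, hFc⟩) hsum (x : AddCircle (2*π))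
  have key2 := key.nat_add_neg
  have hb0 : b 0 = 0 := by rw [hb]; simp
  have hf0 : fourierCoeff F 0 = 0 := by have := hcn 0; simpa [hb0] using this
  have hFx : F (x : AddCircle (2*π)) = (g x : ℂ) := by
    rcases hx.2.eq_or_lt with h | h
    · have : (x : AddCircle (2*π)) = ((-π : ℝ) : AddCircle (2*π)) := by
        rw [h, ← AddCircle.coe_add_period (2*π) (-π)]; congr 1; ring
      rw [this, hF, AddCircle.liftIco_coe_apply ⟨le_rfl, by linarith⟩]
      simp only [hO]
      rw [h0 (-π) (by linarith), neg_neg, h1 π le_rfl, h1 x h.ge]; simp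
    · rw [hF, AddCircle.liftIco_coe_apply ⟨by linarith [hx.1], by linarith⟩]
      simp only [hO]
      rw [h0 (-x) (by linarith [hx.1])]; simp
  simp only [ContinuousMap.coe_mk, hf0, zero_smul, add_zero, hFx] at key2
  rw [← Complex.hasSum_ofReal]
  convert key2 using 1
  ext k
  rw [hcn, hcn', fourier_coe_apply, fourier_coe_apply]
  push_cast
  rw [Complex.sin]
  have hpc : (π:ℂ) ≠ 0 := by exact_mod_cast hpi.ne'
  rw [show 2 * (π:ℂ) * Complex.I * k * x / (2 * π) = Complex.I * k * x by field_simp,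
    show 2 * (π:ℂ) * Complex.I * (-k) * x / (2 * π) = -(Complex.I * k * x) by field_simp,
    show -((k:ℂ) * x) * Complex.I = -(Complex.I * k * x) by ring,
    show ((k:ℂ) * x) * Complex.I = (Complex.I * k * x) by ring]
  simp only [smul_eq_mul]
  field_simp
  ring

end Blow

namespace Blow
open Topology

noncomputable def S0 : ℝ := ∑' k : ℕ, (k:ℝ) * exp (-(k/4))

lemma summ0 : Summable (fun k : ℕ => (k:ℝ) * exp (-(k/4))) := by
  have := Real.summable_pow_mul_exp_neg_nat_mul 1 (show (0:ℝ) < 1/4 by norm_num)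
  refine this.congr fun k => ?_
  rw [pow_one]; congr 2; ring

lemma S0_nonneg : 0 ≤ S0 := tsum_nonneg fun k => by positivity

variable {lam s : ℝ} {V Vx Vxx Vy Vyy : ℝ → ℝ → ℝ} {m : ℕ} {δ : ℝ}

lemma Std.cc_nonneg (h : Std m δ lam s V Vx Vxx Vy Vyy) : 0 ≤ cc m δ / m := by
  have := h.hδ
  have : 0 < 1 - δ := by linarith
  unfold cc; positivity

lemma Std.f0 (h : Std m δ lam s V Vx Vxx Vy Vyy) (hr : cc m δ / m ≤ 1/2) :
    fk V 1 0 ≤ 4 ∧ |fk V 1 0 - π/2| ≤ 4 * (cc m δ / m) := by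
  have hm4 : (4:ℝ) ≤ m := by exact_mod_cast h.hm
  have hpi := Real.pi_gt_three
  have hpi4 := Real.pi_le_four
  have hr0 := h.cc_nonneg
  have hb := h.bounds (y := 1/m) ⟨by positivity, by
    have : (1:ℝ)/m ≤ 1/4 := by gcongr
    linarith⟩
  rw [h.norm, show 1/(m:ℝ) * cc m δ = cc m δ / m by ring] at hb
  set r := cc m δ / m
  have hf := f1_nonneg h.good 0
  have h4 : fk V 1 0 ≤ 4 := by nlinarith
  refine ⟨h4, ?_⟩
  rw [abs_le]
  constructor <;> nlinarith

lemma Std.far (h : Std m δ lam s V Vx Vxx Vy Vyy) (hr : cc m δ / m ≤ 1/2) {φ x Y : ℝ}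
    (hφ : φ ∈ Icc 0 (π/2)) (h1 : 1/2 ≤ m * φ) (h2 : m * φ ≤ Y) (hx : x ∈ Icc 0 π) :
    |V x φ - sin x| ≤ (cc m δ / m) * (4 + 4 * Y + 8 * S0) := by
  have hm4 : (4:ℝ) ≤ m := by exact_mod_cast h.hm
  have hpi := Real.pi_gt_three
  have hr0 := h.cc_nonneg
  obtain ⟨hf4, hf5⟩ := h.f0 hr
  have hf := f1_nonneg h.good 0
  have hb := h.bounds hφ
  rw [show φ * cc m δ = (m * φ) * (cc m δ / m) by field_simp] at hb
  have hsmall : ∀ k : ℕ, 2 ≤ k → |fk V k φ| ≤ 8 * (cc m δ / m) * (k * exp (-(k/4))) := by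
    intro k hk
    have hk2 : (2:ℝ) ≤ k := by exact_mod_cast hk
    have e1 := h.decay hk hφ
    have e2 := h.small hk
    calc |fk V k φ| ≤ |fk V k 0| * exp (-(k*m/2*φ)) := e1
      _ ≤ (2 * k * 4 * (cc m δ / m)) * exp (-(k/4)) := by
        gcongr
        · refine e2.trans ?_
          gcongr
        · nlinarith
      _ = _ := by ring
  set r := cc m δ / m
  have hsum : Summable (fun k => fk V k φ) := by
    rw [← summable_nat_add_iff 2]
    refine Summable.of_norm_bounded (g := fun k : ℕ => 8 * r * (((k+2:ℕ):ℝ) * exp (-(((k+2:ℕ):ℝ)/4)))) ?_ (fun k => hsmall (k+2) (by omega))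
    exact ((summable_nat_add_iff 2).2 summ0).mul_left _
  have hF := fourier_sine (g := fun x => V x φ) (b := fun k => fk V k φ) (Vy_cont h.good.cont φ)
    (fun x hx => h.good.zero _ _ fun hh => absurd hh.1.1 (not_lt.2 hx))
    (fun x hx => h.good.zero _ _ fun hh => absurd hh.1.2 (not_lt.2 hx))
    (fun k => rfl) hsum hx
  have hF1 := hF.sub (hasSum_ite_eq 1 (2/π * fk V 1 φ * sin x))
  have h2pi : 2/π ≤ 1 := by rw [div_le_one (by linarith)]; linarith
  have h2pi0 : 0 ≤ 2/π := by positivity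
  have hbd : |V x φ - 2/π * fk V 1 φ * sin x| ≤ 8 * r * S0 := by
    rw [← Real.norm_eq_abs, ← hF1.tsum_eq]
    refine tsum_of_norm_bounded (summ0.hasSum.mul_left (8*r)) fun k => ?_
    rcases Nat.lt_or_ge k 2 with hk | hk
    · interval_cases k
      · simp
      · simp; positivity
    · rw [if_neg (by omega), sub_zero, Real.norm_eq_abs, abs_mul, abs_mul, abs_of_nonneg h2pi0]
      calc 2/π * |fk V k φ| * |sin (k*x)| ≤ 1 * |fk V k φ| * 1 := by
            gcongr
            exact abs_sin_le_one _
        _ ≤ _ := by simpa using hsmall k hk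
  have hf1 : |fk V 1 φ - π/2| ≤ r * (4 + 4 * Y) := by
    have hf5' := abs_le.1 hf5
    have e1 : m * φ * r ≤ Y * r := by gcongr
    have e0 : 0 ≤ m * φ * r := by have := hφ.1; positivity
    rw [abs_le]
    constructor <;> nlinarith
  have e3 : 2/π * fk V 1 φ * sin x - sin x = 2/π * (fk V 1 φ - π/2) * sin x := by
    field_simp
  have e4 : |2/π * fk V 1 φ * sin x - sin x| ≤ r * (4 + 4*Y) := by
    rw [e3, abs_mul, abs_mul, abs_of_nonneg h2pi0]
    calc 2/π * |fk V 1 φ - π/2| * |sin x| ≤ 1 * |fk V 1 φ - π/2| * 1 := by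
          gcongr
          exact abs_sin_le_one _
      _ ≤ _ := by simpa using hf1
  calc |V x φ - sin x| = |(V x φ - 2/π * fk V 1 φ * sin x) + (2/π * fk V 1 φ * sin x - sin x)| := by ring_nf
    _ ≤ |V x φ - 2/π * fk V 1 φ * sin x| + |2/π * fk V 1 φ * sin x - sin x| := abs_add_le _ _
    _ ≤ _ := by linarith

end Blow

namespace Blow
open Topology

variable {lam s : ℝ} {V Vx Vxx Vy Vyy : ℝ → ℝ → ℝ} {m : ℕ} {δ : ℝ}

lemma strip_alg {m lam S tn cs sg K sx e sn : ℝ} (hm : 4 ≤ m) (l1 : m * (m+1) ≤ lam) (l2 : lam ≤ m^2 + 3*m + 2)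
    (hS : 1/2 ≤ S) (_hsg : |sn| ≤ 1) (ht : |tn| ≤ 1/m) (hcs : 1/cs = 1 + tn^2) (hK : 0 ≤ K)
    (hsx0 : 0 ≤ sx) (hsx1 : sx ≤ 1) (he : e = 1 ∨ e = -1) (hsg : sg = tn * sn)
    (hmain : 0 ≤ K * (-(4*m^2*S) + 2*m*sg + lam*S) + e * sx * (lam - m^2/cs)) : K ≤ 8/m := by
  have hm0 : 0 < m := by linarith
  have h1 : |sg| ≤ 1/m := by
    rw [hsg, abs_mul]
    calc |tn| * |sn| ≤ 1/m * 1 := by gcongr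
      _ = 1/m := mul_one _
  have h2 : 2*m*sg ≤ 2 := by
    have := (abs_le.1 h1).2
    rw [le_div_iff₀ hm0] at this
    linarith
  have h3 : -(4*m^2*S) + 2*m*sg + lam*S ≤ -(m^2/2) := by
    have : lam ≤ 2*m^2 := by nlinarith
    nlinarith
  have h4 : m^2 * tn^2 ≤ 1 := by
    have := pow_le_pow_left₀ (abs_nonneg tn) ht 2
    rw [sq_abs, one_div_pow, le_div_iff₀ (by positivity)] at this
    linarith
  have h5 : |lam - m^2/cs| ≤ 4*m := by
    rw [div_eq_mul_one_div, hcs, abs_le]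
    have : 0 ≤ m^2 * tn^2 := by positivity
    constructor <;> nlinarith
  have h6 : e * sx * (lam - m^2/cs) ≤ 4*m := by
    refine (le_abs_self _).trans ?_
    rw [abs_mul, abs_mul, abs_of_nonneg hsx0]
    have : |e| = 1 := by rcases he with rfl | rfl <;> simp
    rw [this]
    calc 1 * sx * |lam - m^2/cs| ≤ 1 * 1 * (4*m) := by gcongr
      _ = _ := by ring
  have h7 := mul_le_mul_of_nonneg_left h3 hK
  rw [le_div_iff₀ hm0]
  have h8 : (K * m) * m ≤ 8 * m := by nlinarith
  exact le_of_mul_le_mul_right h8 hm0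

lemma Std.strip (h : Std m δ lam s V Vx Vxx Vy Vyy) {e ε τ : ℝ} (he : e = 1 ∨ e = -1)
    (hε : ∀ x ∈ Icc 0 π, |V x (1/(2*m)) - sin x| ≤ ε) (hτ0 : 0 ≤ τ)
    (hτ : ∀ x ∈ Icc 0 π, x ≤ s * π → -(e * sin x) ≤ τ) {x φ : ℝ} (hx : x ∈ Icc 0 π)
    (hφ : φ ∈ Icc (-(1/(2*m):ℝ)) (1/(2*m))) : e * (V x φ - sin x) ≤ 2*ε + τ + 8/m := by
  have hm4 : (4:ℝ) ≤ m := by exact_mod_cast h.hm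
  have hpi := Real.pi_gt_three
  have hG := h.good
  have hε0 : 0 ≤ ε := (abs_nonneg _).trans (hε x hx)
  set d := 1/(2*(m:ℝ)) with hd
  have hd0 : 0 < d := by positivity
  have hd1 : 2 * m * d = 1 := by rw [hd]; field_simp
  have hd8 : d ≤ 1/8 := by nlinarith
  have hS : ∀ y ∈ Icc (-d) d, 1/2 ≤ cos (2*m*y) := fun y hy => by
    have h1 := one_sub_sq_div_two_le_cos (x := 2*m*y)
    have : |2*m*y| ≤ 1 := by
      rw [abs_mul, abs_of_nonneg (by positivity), ← hd1]
      exact mul_le_mul_of_nonneg_left (abs_le.2 hy) (by positivity)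
    have := sq_le_one_iff_abs_le_one (2*m*y) |>.2 this
    linarith
  have hVc := hG.cont
  have hW : Continuous (fun p : ℝ × ℝ => e * (V p.1 p.2 - sin p.1)) := by
    have : Continuous (fun p : ℝ × ℝ => V p.1 p.2) := hVc
    fun_prop
  obtain ⟨⟨x0, y0⟩, hp, hmax⟩ := (isCompact_Icc.prod isCompact_Icc).exists_isMaxOn
    (s := Icc 0 π ×ˢ Icc (-d) d) ⟨(x, φ), ⟨hx, hφ⟩⟩
    (f := fun p : ℝ × ℝ => e * (V p.1 p.2 - sin p.1) / cos (2*m*p.2))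
    (hW.continuousOn.div (by fun_prop) (fun p hp => by have := hS p.2 hp.2; positivity))
  obtain ⟨hx0, hy0⟩ := hp
  simp only at hx0 hy0
  set K := e * (V x0 y0 - sin x0) / cos (2*m*y0) with hK
  have hle : ∀ x ∈ Icc 0 π, ∀ y ∈ Icc (-d) d, e * (V x y - sin x) ≤ K * cos (2*m*y) := by
    intro x hx y hy
    have h1 : e * (V x y - sin x) / cos (2*m*y) ≤ K := hmax (show (x, y) ∈ Icc 0 π ×ˢ Icc (-d) d from ⟨hx, hy⟩)
    have := hS y hy
    rwa [div_le_iff₀ (by linarith)] at h1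
  have hS0 := hS y0 hy0
  have heq : e * (V x0 y0 - sin x0) = K * cos (2*m*y0) := by
    rw [hK, div_mul_cancel₀ _ (by positivity)]
  have h8m : 0 ≤ 8/(m:ℝ) := by positivity
  suffices hKb : K ≤ 2*ε + τ + 8/m by
    have h1 := hle x hx φ hφ
    have h2 := hS φ hφ
    have h3 := cos_le_one (2*m*φ)
    have h4 : 0 ≤ 2*ε + τ + 8/m := by positivity
    nlinarith
  by_cases hK0 : K ≤ 0
  · refine hK0.trans (by positivity)
  push Not at hK0
  have hsin0 := sin_nonneg_of_mem_Icc hx0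
  by_cases hOm : (x0, y0) ∈ Om s
  swap
  · have hV0 := hG.zero _ _ hOm
    rw [hV0] at heq
    by_cases hxe : x0 ∈ Ioo 0 π
    · have hyI : y0 ∈ Ioo (-(π/2)) (π/2) := ⟨by linarith [hy0.1], by linarith [hy0.2]⟩
      have : x0 ≤ s * π ∧ y0 = 0 := by
        by_contra hn; exact hOm ⟨hxe, hyI, hn⟩
      have h1 := hτ x0 hx0 this.1
      rw [this.2, mul_zero, cos_zero] at heq
      linarith
    · have : sin x0 = 0 := by
        rcases hx0.1.eq_or_lt with h1 | h1
        · rw [← h1]; simp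
        · rcases hx0.2.eq_or_lt with h2 | h2
          · rw [h2]; simp
          · exact absurd ⟨h1, h2⟩ hxe
      rw [this] at heq
      have : 0 < K * cos (2*m*y0) := by positivity
      linarith
  have heabs : |e| = 1 := by rcases he with rfl | rfl <;> simp
  have htop : (y0 = d ∨ y0 = -d) → K ≤ 2*ε + τ + 8/m := by
    intro hyy
    have hVd : V x0 y0 = V x0 d := by
      rcases hyy with h | h
      · rw [h]
      · rw [h, hG.even]
    have h1 : e * (V x0 y0 - sin x0) ≤ ε := by
      refine (le_abs_self _).trans ?_
      rw [abs_mul, heabs, one_mul, hVd]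
      exact hε x0 hx0
    nlinarith
  by_cases hyd : y0 = d
  · exact htop (Or.inl hyd)
  by_cases hyd' : y0 = -d
  · exact htop (Or.inr hyd')
  have hyI : y0 ∈ Ioo (-d) d := ⟨lt_of_le_of_ne hy0.1 (Ne.symm hyd'), lt_of_le_of_ne hy0.2 hyd⟩
  -- interior maximum
  have hOmn := (isOpen_Om s).mem_nhds hOm
  have hOmx : ∀ᶠ t in 𝓝 x0, (t, y0) ∈ Om s :=
    (Continuous.continuousAt (f := fun t : ℝ => (t, y0)) (by fun_prop)).eventually hOmn
  have hOmy : ∀ᶠ t in 𝓝 y0, (x0, t) ∈ Om s :=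
    (Continuous.continuousAt (f := fun t : ℝ => (x0, t)) (by fun_prop)).eventually hOmn
  have hxx : e * (Vxx x0 y0 + sin x0) ≤ 0 := by
    refine snd_deriv_nonpos (f := fun t => e * (V t y0 - sin t)) (f1 := fun t => e * (Vx t y0 - cos t)) (c := x0) ?_ ?_ ?_
    · filter_upwards [isOpen_Ioo.mem_nhds hOm.1] with t ht
      change e * (V t y0 - sin t) ≤ e * (V x0 y0 - sin x0)
      rw [heq]
      exact hle t (Ioo_subset_Icc_self ht) y0 hy0
    · filter_upwards [hOmx] with t ht
      exact ((hG.dx t y0 ht).sub (hasDerivAt_sin t)).const_mul e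
    · refine (((hG.dxx x0 y0 hOm).sub (hasDerivAt_cos x0)).const_mul e).congr_deriv ?_
      ring
  have dS : ∀ t : ℝ, HasDerivAt (fun t => cos (2*m*t)) (-(2*m*sin (2*m*t))) t := fun t => by
    refine (((hasDerivAt_id t).const_mul (2*(m:ℝ))).cos).congr_deriv ?_
    simp only [id]; ring
  have dS2 : ∀ t : ℝ, HasDerivAt (fun t => -(2*m*sin (2*m*t))) (-(4*m^2*cos (2*m*t))) t := fun t => by
    refine (((((hasDerivAt_id t).const_mul (2*(m:ℝ))).sin).const_mul (2*(m:ℝ))).neg).congr_deriv ?_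
    simp only [id]; ring
  have hlm : IsLocalMax (fun t => e * (V x0 t - sin x0) - K * cos (2*m*t)) y0 := by
    filter_upwards [isOpen_Ioo.mem_nhds hyI] with t ht
    change e * (V x0 t - sin x0) - K * cos (2*m*t) ≤ e * (V x0 y0 - sin x0) - K * cos (2*m*y0)
    rw [heq]
    have := hle x0 hx0 t (Ioo_subset_Icc_self ht)
    linarith
  have dy : ∀ᶠ t in 𝓝 y0, HasDerivAt (fun t => e * (V x0 t - sin x0) - K * cos (2*m*t))
      (e * Vy x0 t - K * (-(2*m*sin (2*m*t)))) t := by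
    filter_upwards [hOmy] with t ht
    exact (((hG.dy x0 t ht).sub_const _).const_mul e).sub ((dS t).const_mul K)
  have hyy : e * Vyy x0 y0 - K * (-(4*m^2*cos (2*m*y0))) ≤ 0 := by
    refine snd_deriv_nonpos hlm dy ?_
    exact ((hG.dyy x0 y0 hOm).const_mul e).sub ((dS2 y0).const_mul K)
  have hy1 : e * Vy x0 y0 - K * (-(2*m*sin (2*m*y0))) = 0 := hlm.hasDerivAt_eq_zero dy.self_of_nhds
  have hpde := hG.pde x0 y0 hOm
  have hcos : 7/8 ≤ cos y0 := by
    have := one_sub_sq_div_two_le_cos (x := y0)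
    nlinarith [hy0.1, hy0.2]
  have htan : |tan y0| ≤ 1/m := by
    rw [tan_eq_sin_div_cos, abs_div, abs_of_pos (by linarith : 0 < cos y0), div_le_iff₀ (by linarith)]
    have h1 : |sin y0| ≤ |y0| := abs_sin_le_abs
    have h2 : |y0| ≤ d := abs_le.2 hy0
    have h3 : d = 1/m*(1/2) := by rw [hd]; field_simp
    have h4 : 1/m*(1/2) ≤ 1/(m:ℝ) * cos y0 := mul_le_mul_of_nonneg_left (by linarith) (by positivity)
    linarith
  have hcs : 1/cos y0^2 = 1 + tan y0^2 := by
    have h1 := sin_sq_add_cos_sq y0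
    rw [tan_eq_sin_div_cos]
    field_simp; linarith
  have hfin : K ≤ 8/m := by
    refine strip_alg (m := m) (lam := lam) (S := cos (2*m*y0)) (tn := tan y0) (cs := cos y0^2)
      (sg := tan y0 * sin (2*m*y0)) (sx := sin x0) (e := e) (sn := sin (2*m*y0)) hm4 h.l1 ?_ hS0
      (abs_sin_le_one _) htan hcs hK0.le hsin0 (sin_le_one _) he rfl ?_
    · nlinarith [h.l2, h.hδ]
    · have e1 : e * V x0 y0 = K * cos (2*m*y0) + e * sin x0 := by linarith
      have e2 : e * Vy x0 y0 = -(K * (2*m*sin (2*m*y0))) := by linarith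
      have e3 : (m:ℝ)^2/cos y0^2 * (e * Vxx x0 y0) ≤ (m:ℝ)^2/cos y0^2 * (-(e * sin x0)) := by
        apply mul_le_mul_of_nonneg_left (by linarith) (by positivity)
      have e4 : e * Vyy x0 y0 - tan y0 * (e * Vy x0 y0) + (m:ℝ)^2/cos y0^2 * (e * Vxx x0 y0) + lam * (e * V x0 y0) = 0 := by
        linear_combination e * hpde
      rw [e1, e2] at e4
      nlinarith
  linarith

lemma Std.slit (h : Std m δ lam s V Vx Vxx Vy Vyy) {η x0 : ℝ} (hη : 0 ≤ η)
    (hU : ∀ x ∈ Icc 0 π, V x 0 ≤ sin x + η) (hx0 : x0 ∈ Icc 0 π) (hs : x0 ≤ s * π) :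
    sin x0^3/3 ≤ π/2 - fk V 1 0 + 4*η := by
  have hpi := Real.pi_pos
  have hVc := Vy_cont h.good.cont 0
  have hi : ∀ a b : ℝ, IntervalIntegrable (fun x => V x 0 * sin x) MeasureTheory.volume a b := fun a b => by
    apply Continuous.intervalIntegrable; fun_prop
  have hi2 : ∀ a b : ℝ, IntervalIntegrable (fun x => sin x^2) MeasureTheory.volume a b := fun a b => by
    apply Continuous.intervalIntegrable; fun_prop
  have e1 : fk V 1 0 = ∫ x in x0..π, V x 0 * sin x := by
    unfold fk
    simp only [Nat.cast_one, one_mul]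
    rw [← intervalIntegral.integral_add_adjacent_intervals (hi 0 x0) (hi x0 π)]
    have : ∫ x in (0:ℝ)..x0, V x 0 * sin x = ∫ x in (0:ℝ)..x0, (0:ℝ) := by
      apply intervalIntegral.integral_congr
      intro x hx
      rw [uIcc_of_le hx0.1] at hx
      have : V x 0 = 0 := h.good.zero _ _ fun hh => hh.2.2 ⟨by simpa using hx.2.trans hs, rfl⟩
      simp [this]
    rw [this]; simp
  have e2 : ∫ x in x0..π, V x 0 * sin x ≤ ∫ x in x0..π, (sin x^2 + η) := by
    apply intervalIntegral.integral_mono_on hx0.2 (hi _ _) (by apply Continuous.intervalIntegrable; fun_prop)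
    intro x hx
    have hxI : x ∈ Icc 0 π := ⟨hx0.1.trans hx.1, hx.2⟩
    have h1 := hU x hxI
    have h2 := sin_nonneg_of_mem_Icc hxI
    have h3 := sin_le_one x
    nlinarith
  have e3 : ∫ x in x0..π, (sin x^2 + η) = (∫ x in x0..π, sin x^2) + (π - x0) * η := by
    rw [intervalIntegral.integral_add (hi2 _ _) (by simp)]; simp
  have e4 : (∫ x in (0:ℝ)..x0, sin x^2) + ∫ x in x0..π, sin x^2 = π/2 := by
    rw [intervalIntegral.integral_add_adjacent_intervals (hi2 _ _) (hi2 _ _), integral_sin_sq]; simp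
  have e5 : ∫ x in (0:ℝ)..x0, sin x^2 * cos x = sin x0^3/3 := by
    rw [intervalIntegral.integral_eq_sub_of_hasDerivAt (f := fun x => sin x^3/3)]
    · simp
    · intro x _
      refine (((hasDerivAt_sin x).pow 3).div_const 3).congr_deriv ?_
      simp; ring
    · apply Continuous.intervalIntegrable; fun_prop
  have e6 : ∫ x in (0:ℝ)..x0, sin x^2 * cos x ≤ ∫ x in (0:ℝ)..x0, sin x^2 := by
    apply intervalIntegral.integral_mono_on hx0.1 (by apply Continuous.intervalIntegrable; fun_prop) (hi2 _ _)
    intro x hx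
    have := cos_le_one x
    have := sq_nonneg (sin x)
    nlinarith
  have e7 : (π - x0) * η ≤ 4 * η := by
    have := Real.pi_le_four
    have := hx0.1
    gcongr; linarith
  linarith

end Blow

namespace Blow
open Topology

section
variable {lam s : ℝ} {V Vx Vxx Vy Vyy : ℝ → ℝ → ℝ} {m : ℕ} {δ : ℝ}

lemma Std.final (h : Std m δ lam s V Vx Vxx Vy Vyy) {ε0 Y : ℝ} (hε0 : 0 < ε0) (hr : cc m δ / m ≤ 1/2)
    (a1 : (cc m δ / m) * (4 + 4*Y + 8*S0) ≤ ε0)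
    (a2 : 2 * ((cc m δ / m) * (8 + 8*S0)) + 8/m ≤ ε0/2)
    (a3 : 3 * (4 * (cc m δ / m) + 4 * (2 * ((cc m δ / m) * (8 + 8*S0)) + 8/m)) ≤ (ε0/2)^3)
    {x φ : ℝ} (hx : x ∈ Icc 0 π) (hφ : φ ∈ Icc 0 (π/2)) (hY : m * φ ≤ Y) :
    |V x φ - sin x| ≤ ε0 := by
  have hm4 : (4:ℝ) ≤ m := by exact_mod_cast h.hm
  have hpi := Real.pi_gt_three
  have hr0 := h.cc_nonneg
  have hS := S0_nonneg
  by_cases hc : 1/2 ≤ m * φ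
  · exact (h.far hr hφ hc hY hx).trans a1
  push Not at hc
  have hf0 := h.f0 hr
  set r := cc m δ / m
  set d := 1/(2*(m:ℝ)) with hd
  have hd0 : 0 < d := by positivity
  have hd1 : m * d = 1/2 := by rw [hd]; field_simp
  have hd8 : d ≤ 1/8 := by nlinarith
  have hφd : φ ∈ Icc (-d) d := ⟨by linarith [hφ.1], by
    have : m * φ ≤ m * d := by linarith
    exact le_of_mul_le_mul_left this (by linarith)⟩
  have top : ∀ x ∈ Icc 0 π, |V x d - sin x| ≤ r * (8 + 8*S0) := fun x hx => by
    have := h.far hr (φ := d) (Y := 1) ⟨hd0.le, by linarith⟩ hd1.ge (by linarith) hx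
    refine this.trans (le_of_eq (by ring))
  have up : ∀ x ∈ Icc 0 π, ∀ y ∈ Icc (-d) d, V x y - sin x ≤ 2 * (r * (8 + 8*S0)) + 8/m := fun x hx y hy => by
    have := h.strip (Or.inl rfl) top le_rfl (fun x hx _ => by
      have := sin_nonneg_of_mem_Icc hx
      linarith) hx hy
    linarith
  have h8 : 0 ≤ 8/(m:ℝ) := by positivity
  have hη : 0 ≤ 2 * (r * (8 + 8*S0)) + 8/m := by positivity
  have hslit : ∀ x ∈ Icc 0 π, x ≤ s * π → -(-1 * sin x) ≤ ε0/2 := by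
    intro x hx hxs
    have h1 := h.slit hη (fun x hx => by
      have := up x hx 0 ⟨by linarith, hd0.le⟩
      linarith) hx hxs
    have h2 := (abs_le.1 hf0.2).1
    have h3 : sin x^3 ≤ (ε0/2)^3 := by linarith
    have h4 := le_of_pow_le_pow_left₀ (by norm_num) (by positivity) h3
    linarith
  have low := h.strip (Or.inr rfl) top (by positivity) hslit hx hφd
  have hu := up x hx φ hφd
  rw [abs_le]
  constructor <;> linarith

end

/-- clamping -/
def clamp (a b x : ℝ) : ℝ := max a (min x b)

lemma clamp_cont (a b : ℝ) : Continuous (clamp a b) := by unfold clamp; fun_prop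

lemma clamp_mem {a b : ℝ} (hab : a ≤ b) (x : ℝ) : clamp a b x ∈ Icc a b :=
  ⟨le_max_left _ _, max_le hab (min_le_right _ _)⟩

lemma clamp_id {a b x : ℝ} (hx : x ∈ Icc a b) : clamp a b x = x := by
  unfold clamp; rw [min_eq_left hx.2, max_eq_right hx.1]

lemma clamp_lo {a b x : ℝ} (hx : x ≤ a) : clamp a b x = a := by
  unfold clamp; rw [max_eq_left]; exact (min_le_left _ _).trans hx

lemma clamp_hi {a b x : ℝ} (hab : a ≤ b) (hx : b ≤ x) : clamp a b x = b := by
  unfold clamp; rw [min_eq_right hx, max_eq_right hab]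

lemma isOpen_Omega (m : ℕ) (σ : ℝ) : IsOpen (OmegaSet m σ) := by
  unfold OmegaSet
  refine (isOpen_Ioo.prod isOpen_Ioo).sdiff ?_
  exact (isClosed_le continuous_const continuous_fst).inter
    ((isClosed_le continuous_fst continuous_const).inter (isClosed_eq continuous_snd continuous_const))

lemma d_x {w : ℝ × ℝ → ℝ} {m x y : ℝ} (hw : DifferentiableAt ℝ w (x/m, y)) :
    HasDerivAt (fun t => w (t/m, y)) (1/m * pdx w (x/m, y)) x := by
  have h1 : HasDerivAt (fun t : ℝ => (t/m, y)) (1/m, (0:ℝ)) x :=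
    ((hasDerivAt_id x).div_const m).prodMk (hasDerivAt_const x y)
  have := hw.hasFDerivAt.comp_hasDerivAt x h1
  refine this.congr_deriv ?_
  unfold pdx
  rw [← smul_eq_mul, ← map_smul]; simp

lemma d_y {w : ℝ × ℝ → ℝ} {m x y : ℝ} (hw : DifferentiableAt ℝ w (x/m, y)) :
    HasDerivAt (fun t => w (x/m, t)) (pdy w (x/m, y)) y := by
  have h1 : HasDerivAt (fun t : ℝ => (x/m, t)) ((0:ℝ), (1:ℝ)) y :=
    (hasDerivAt_const y (x/m)).prodMk (hasDerivAt_id y)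
  exact hw.hasFDerivAt.comp_hasDerivAt y h1

lemma omega_iff {m : ℕ} (hm : 1 ≤ m) {σ x y : ℝ} : (x/m, y) ∈ OmegaSet m σ ↔ (x, y) ∈ Om σ := by
  have hm0 : (0:ℝ) < m := by exact_mod_cast hm
  unfold OmegaSet Om
  simp only [Set.mem_sdiff, mem_prod, mem_Ioo, mem_ofPred_eq, div_pos_iff_of_pos_right hm0,
    div_lt_div_iff_of_pos_right hm0, div_le_div_iff_of_pos_right hm0]
  constructor
  · rintro ⟨⟨h1, h2⟩, h3⟩
    exact ⟨h1, h2, fun h => h3 ⟨div_nonneg h1.1.le hm0.le, h⟩⟩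
  · rintro ⟨h1, h2, h3⟩
    exact ⟨⟨h1, h2⟩, fun h => h3 h.2⟩

lemma good_of {m : ℕ} (hm : 1 ≤ m) {σ μ : ℝ} {v : ℝ × ℝ → ℝ} (hv : SphEigen m σ μ v)
    (hpos : ∀ p ∈ OmegaSet m σ, 0 < v p) (heven : ∀ x y : ℝ, v (x, -y) = v (x, y)) :
    Good (m^2) (μ * (μ+1)) σ (fun x y => v (clamp 0 π x / m, clamp (-(π/2)) (π/2) y))
      (fun x y => 1/m * pdx v (x/m, y)) (fun x y => 1/m * (1/m * pdx (pdx v) (x/m, y)))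
      (fun x y => pdy v (x/m, y)) (fun x y => pdy (pdy v) (x/m, y)) := by
  obtain ⟨hc, hb, hsl, hC2, hpde⟩ := hv
  have hpi := Real.pi_pos
  have hm0 : (0:ℝ) < m := by exact_mod_cast hm
  have hop := isOpen_Omega m σ
  have hmem : ∀ x y, (clamp 0 π x / m, clamp (-(π/2)) (π/2) y) ∈ RectSet m := fun x y => by
    have h1 := clamp_mem hpi.le x
    exact ⟨⟨div_nonneg h1.1 hm0.le, div_le_div_of_nonneg_right h1.2 hm0.le⟩, clamp_mem (by linarith) y⟩
  have hVeq : ∀ x y, (x, y) ∈ Om σ → v (clamp 0 π x / m, clamp (-(π/2)) (π/2) y) = v (x/m, y) := by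
    intro x y h
    rw [clamp_id (Ioo_subset_Icc_self h.1), clamp_id (Ioo_subset_Icc_self h.2.1)]
  have hfd : ContDiffOn ℝ 1 (fderiv ℝ v) (OmegaSet m σ) := hC2.fderiv_of_isOpen hop (by norm_num)
  have hX : ContDiffOn ℝ 1 (pdx v) (OmegaSet m σ) := hfd.clm_apply contDiffOn_const
  have hY : ContDiffOn ℝ 1 (pdy v) (OmegaSet m σ) := hfd.clm_apply contDiffOn_const
  have cont1 : ∀ w : ℝ × ℝ → ℝ, ContDiffOn ℝ 1 w (OmegaSet m σ) → ∀ e : ℝ × ℝ,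
      ContinuousOn (fun p => fderiv ℝ w p e) (OmegaSet m σ) := fun w hw e =>
    (hw.continuousOn_fderiv_of_isOpen hop le_rfl).clm_apply continuousOn_const
  have diff : ∀ w : ℝ × ℝ → ℝ, ContDiffOn ℝ 1 w (OmegaSet m σ) → ∀ x y, (x, y) ∈ Om σ →
      DifferentiableAt ℝ w (x/m, y) := fun w hw x y h =>
    (hw.differentiableOn (by norm_num)).differentiableAt (hop.mem_nhds ((omega_iff hm).2 h))
  have hC1 : ContDiffOn ℝ 1 v (OmegaSet m σ) := hC2.of_le (by norm_num)
  have comp : ∀ w : ℝ × ℝ → ℝ, ContinuousOn w (OmegaSet m σ) →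
      ContinuousOn (fun p : ℝ × ℝ => w (p.1/m, p.2)) (Om σ) := fun w hw =>
    hw.comp (f := fun p : ℝ × ℝ => (p.1/m, p.2)) (by fun_prop) (fun p hp => (omega_iff hm).2 hp)
  have hOmx : ∀ x y, (x, y) ∈ Om σ → ∀ᶠ t in 𝓝 x, (t, y) ∈ Om σ := fun x y h =>
    (Continuous.continuousAt (f := fun t : ℝ => (t, y)) (by fun_prop)).eventually ((isOpen_Om σ).mem_nhds h)
  have hOmy : ∀ x y, (x, y) ∈ Om σ → ∀ᶠ t in 𝓝 y, (x, t) ∈ Om σ := fun x y h =>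
    (Continuous.continuousAt (f := fun t : ℝ => (x, t)) (by fun_prop)).eventually ((isOpen_Om σ).mem_nhds h)
  refine ⟨?_, ?_, ?_, ?_, ?_, ?_, ?_, ?_, ?_, ?_, ?_, ?_, ?_⟩
  · have h1 : Continuous (fun p : ℝ × ℝ => (clamp 0 π p.1 / m, clamp (-(π/2)) (π/2) p.2)) := by
      have a := clamp_cont 0 π
      have b := clamp_cont (-(π/2)) (π/2)
      fun_prop
    exact hc.comp_continuous h1 (fun p => hmem p.1 p.2)
  · intro x y h
    by_cases hx : x ∈ Ioo 0 π
    · by_cases hy : y ∈ Ioo (-(π/2)) (π/2)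
      · have h3 : x ≤ σ * π ∧ y = 0 := by
          by_contra hn; exact h ⟨hx, hy, hn⟩
        rw [clamp_id (Ioo_subset_Icc_self hx), clamp_id (Ioo_subset_Icc_self hy), h3.2]
        exact hsl _ (div_nonneg hx.1.le hm0.le) (div_le_div_of_nonneg_right h3.1 hm0.le)
      · apply hb _ (hmem x y)
        simp only [mem_Ioo, not_and_or, not_lt] at hy
        rcases hy with hy | hy
        · right; right; left; exact clamp_lo hy
        · right; right; right; exact clamp_hi (by linarith) hy
    · apply hb _ (hmem x y)
      simp only [mem_Ioo, not_and_or, not_lt] at hx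
      rcases hx with hx | hx
      · left; simp only; rw [clamp_lo hx, zero_div]
      · right; left; simp only; rw [clamp_hi hpi.le hx]
  · intro x y h
    rw [hVeq x y h]
    exact hpos _ ((omega_iff hm).2 h)
  · intro x y
    have : clamp (-(π/2)) (π/2) (-y) = -clamp (-(π/2)) (π/2) y := by
      rcases le_total y (-(π/2)) with h | h
      · rw [clamp_lo h, clamp_hi (by linarith) (by linarith), neg_neg]
      rcases le_total (π/2) y with h' | h'
      · rw [clamp_hi (by linarith) h', clamp_lo (by linarith)]
      rw [clamp_id ⟨h, h'⟩, clamp_id ⟨by linarith, by linarith⟩]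
    rw [this, heven]
  · intro x y h
    refine (d_x (diff v hC1 x y h)).congr_of_eventuallyEq ?_
    filter_upwards [hOmx x y h] with t ht using hVeq t y ht
  · intro x y h
    exact (d_x (diff _ hX x y h)).const_mul _
  · intro x y h
    refine (d_y (diff v hC1 x y h)).congr_of_eventuallyEq ?_
    filter_upwards [hOmy x y h] with t ht using hVeq x t ht
  · intro x y h
    exact d_y (diff _ hY x y h)
  · exact continuousOn_const.mul (comp _ hX.continuousOn)
  · exact continuousOn_const.mul (continuousOn_const.mul (comp _ (cont1 _ hX _)))
  · exact comp _ hY.continuousOn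
  · exact comp _ (cont1 _ hY _)
  · intro x y h
    have := hpde _ ((omega_iff hm).2 h)
    simp only at this
    rw [hVeq x y h, ← this]
    field_simp

end Blow

/-- **Proposition 3.1 (blow-up).** If `σ_m ∈ (0,1)`, `μ_m ≥ m`, and `v_m` are positive
first eigenfunctions on the slit rectangles `Ω_{m,σ_m}`, even in `φ` and normalized by
`∫₀^π v_m(x/m, 1/m)·sin x dx = π/2`, and if `limsup (μ_m - m) < 1`, then the rescalings
`ṽ_m(x, y) = v_m(x/m, y/m)` converge to `sin x` uniformly on compact subsets of
`[0, π] × [0, ∞)`. -/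
theorem blowup_to_sine (σ : ℕ → ℝ) (μ : ℕ → ℝ) (v : ℕ → ℝ × ℝ → ℝ)
    (hσ : ∀ m : ℕ, 1 ≤ m → σ m ∈ Set.Ioo (0 : ℝ) 1)
    (hμ : ∀ m : ℕ, 1 ≤ m → (m : ℝ) ≤ μ m)
    (hv : ∀ m : ℕ, 1 ≤ m → SphEigen m (σ m) (μ m) (v m))
    (hpos : ∀ m : ℕ, 1 ≤ m → ∀ p ∈ OmegaSet m (σ m), 0 < v m p)
    (heven : ∀ m : ℕ, 1 ≤ m → ∀ x y : ℝ, v m (x, -y) = v m (x, y))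
    (hnorm : ∀ m : ℕ, 1 ≤ m →
      (∫ x in (0 : ℝ)..π, v m (x / m, 1 / m) * Real.sin x) = π / 2)
    (hlim : ∃ δ : ℝ, δ < 1 ∧ ∀ᶠ m : ℕ in Filter.atTop, μ m - m ≤ δ) :
    ∀ K : Set (ℝ × ℝ), IsCompact K → K ⊆ Set.Icc (0 : ℝ) π ×ˢ Set.Ici (0 : ℝ) →
      ∀ ε : ℝ, 0 < ε → ∃ M : ℕ, ∀ m : ℕ, M ≤ m → ∀ p ∈ K,
        |v m (p.1 / m, p.2 / m) - Real.sin p.1| ≤ ε := by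
  intro K hK hKs ε hε
  obtain ⟨δ0, hδ0, hev⟩ := hlim
  have hpi := Real.pi_gt_three
  set δ := max δ0 0 with hδ
  have hδ1 : δ < 1 := max_lt hδ0 one_pos
  have hδp : 0 ≤ δ := le_max_right _ _
  obtain ⟨Y, hY⟩ : ∃ Y : ℝ, ∀ p ∈ K, p.2 ≤ Y := by
    obtain ⟨Y, hY⟩ := (hK.image continuous_snd).bddAbove
    exact ⟨Y, fun p hp => hY (mem_image_of_mem _ hp)⟩
  -- limits
  have tn : Tendsto (fun m : ℕ => (8:ℝ)/m) atTop (nhds 0) := tendsto_const_div_atTop_nhds_zero_nat 8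
  have tr : Tendsto (fun m : ℕ => Blow.cc m δ / m) atTop (nhds 0) := by
    have h1 : Tendsto (fun m : ℕ => 16/(1-δ) * (√(m:ℝ))⁻¹) atTop (nhds (16/(1-δ) * 0)) :=
      ((tendsto_inv_atTop_zero.comp Real.tendsto_sqrt_atTop).comp tendsto_natCast_atTop_atTop).const_mul _
    rw [mul_zero] at h1
    refine h1.congr fun m => ?_
    unfold Blow.cc
    rw [mul_div_assoc, Real.sqrt_div_self', one_div]
  have c1 : Tendsto (fun m : ℕ => (Blow.cc m δ / m) * (4 + 4*Y + 8*Blow.S0)) atTop (nhds (0 * (4 + 4*Y + 8*Blow.S0))) :=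
    tr.mul_const _
  have c2 : Tendsto (fun m : ℕ => 2 * ((Blow.cc m δ / m) * (8 + 8*Blow.S0)) + 8/m) atTop
      (nhds (2 * (0 * (8 + 8*Blow.S0)) + 0)) := ((tr.mul_const _).const_mul 2).add tn
  have c3 : Tendsto (fun m : ℕ => 3 * (4 * (Blow.cc m δ / m) + 4 * (2 * ((Blow.cc m δ / m) * (8 + 8*Blow.S0)) + 8/m))) atTop
      (nhds (3 * (4 * 0 + 4 * (2 * (0 * (8 + 8*Blow.S0)) + 0)))) :=
    ((tr.const_mul 4).add (c2.const_mul 4)).const_mul 3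
  simp only [zero_mul, mul_zero, add_zero] at c1 c2 c3
  have d0 := tr.eventually_le_const (show (0:ℝ) < 1/2 by norm_num)
  have d1 := c1.eventually_le_const hε
  have d2 := c2.eventually_le_const (show 0 < ε/2 by positivity)
  have d3 := c3.eventually_le_const (show 0 < (ε/2)^3 by positivity)
  have dY : ∀ᶠ m : ℕ in atTop, Y ≤ (m:ℝ) := tendsto_natCast_atTop_atTop.eventually_ge_atTop Y
  rw [← Filter.eventually_atTop]
  filter_upwards [hev, d0, d1, d2, d3, dY, Filter.eventually_ge_atTop 4] with m h0 e0 e1 e2 e3 eY hm p hp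
  have hm1 : 1 ≤ m := by omega
  have hm4 : (4:ℝ) ≤ m := by exact_mod_cast hm
  have hν : μ m - m ≤ δ := h0.trans (le_max_left _ _)
  have hν0 := hμ m hm1
  have hVeq : ∀ x ∈ Icc 0 π, ∀ y ∈ Icc 0 (π/2),
      v m (Blow.clamp 0 π x / m, Blow.clamp (-(π/2)) (π/2) y) = v m (x/m, y) := fun x hx y hy => by
    rw [Blow.clamp_id hx, Blow.clamp_id ⟨by linarith [hy.1], hy.2⟩]
  have h1m : 1/(m:ℝ) ≤ 1/4 := by gcongr
  have std : Blow.Std m δ (μ m * (μ m + 1)) (σ m) _ _ _ _ _ :=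
    { hm := hm, hδ0 := hδp, hδ := hδ1
      good := Blow.good_of hm1 (hv m hm1) (hpos m hm1) (heven m hm1)
      l1 := by nlinarith
      l2 := by
        have h1 : 0 ≤ μ m - m := by linarith
        have : μ m * (μ m + 1) = m^2 + m + (μ m - m) * (2*m + 1 + (μ m - m)) := by ring
        rw [this]
        have : (μ m - m) * (2*m + 1 + (μ m - m)) ≤ δ * (2*m + 2) := by
          apply mul_le_mul hν (by linarith) (by linarith) hδp
        linarith
      hs := hσ m hm1
      norm := by
        refine Eq.trans ?_ (hnorm m hm1)
        unfold Blow.fk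
        apply intervalIntegral.integral_congr
        intro x hx
        rw [uIcc_of_le (by linarith)] at hx
        simp only [Nat.cast_one, one_mul]
        rw [hVeq x hx _ ⟨by positivity, by linarith⟩] }
  obtain ⟨hx, hy⟩ := hKs hp
  have hy0 : 0 ≤ p.2 := hy
  have hpY := hY p hp
  have hφ : p.2/m ∈ Icc 0 (π/2) := by
    refine ⟨by positivity, ?_⟩
    rw [div_le_iff₀ (by linarith)]
    nlinarith
  have := std.final hε e0 e1 e2 e3 hx hφ (by rw [mul_div_cancel₀ _ (by linarith)]; exact hpY)
  rwa [hVeq _ hx _ hφ] at this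
end
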